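/- arXiv:1304.8032 — 3 statements merged into one kernel-verified Lean document; each statement's English description precedes it below -/
import Mathlib

section
/- Let F : S^N → ℝ be uniformly elliptic with constants 0 < λ ≤ Λ, let h be Lipschitz continuous, and let b : ℝ^N × ℝ^N → ℝ satisfy [b1] and [b2] with α = 0 and in addition be γ-Hölder continuous in its first variable, |b(x,q) − b(y,q)| ≤ C_b|x−y|^γ(|q|^{β₀} + |q|^{β∞}), for some γ ≥ max(β₀, β∞). Let j : ℝ → ℝ be strictly increasing, let Ω ⊂ ℝ^N be a bounded open set, and let f, g be continuous on Ω with f ≤ g in Ω. If u is a continuous viscosity supersolution of F(D²u) + h(x)·∇u + b(x,∇u) − j(u) = f(x) in Ω (i.e. F(D²u) + h(x)·∇u + b(x,∇u) − j(u) ≤ f(x) in the viscosity sense), v is a continuous viscosity subsolution of F(D²v) + h(x)·∇v + b(x,∇v) − j(v) = g(x) in Ω (i.e. ≥ g(x) in the viscosity sense), and u ≥ v on ∂Ω, then u ≥ v in Ω. The same conclusion holds when j is only nondecreasing, provided f < g in Ω. -/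
open Metric Set Real
open scoped RealInnerProductSpace

noncomputable section

/-- `ℝ^N` with the euclidean structure. -/
abbrev Euc (N : ℕ) : Type := EuclideanSpace ℝ (Fin N)

/-- The Hessian matrix `D²φ(x)` of a function `φ` at a point `x`. -/
def hess {N : ℕ} (φ : Euc N → ℝ) (x : Euc N) : Matrix (Fin N) (Fin N) ℝ :=
  Matrix.of fun i j =>
    iteratedFDeriv ℝ 2 φ x ![EuclideanSpace.single i (1 : ℝ), EuclideanSpace.single j (1 : ℝ)]

/-- `F` is uniformly elliptic with ellipticity constants `lam ≤ Lam`: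
`lam * tr P ≤ F (M + P) - F M ≤ Lam * tr P` for symmetric `M` and positive semidefinite `P`. -/
def UnifElliptic {N : ℕ} (lam Lam : ℝ) (F : Matrix (Fin N) (Fin N) ℝ → ℝ) : Prop :=
  ∀ M P : Matrix (Fin N) (Fin N) ℝ, M.IsSymm → P.PosSemidef →
    lam * Matrix.trace P ≤ F (M + P) - F M ∧ F (M + P) - F M ≤ Lam * Matrix.trace P

/-- Standard viscosity subsolution of `G(x, ∇u, D²u) = f(x)` on `Ω`. -/
def ViscSub {N : ℕ} (Ω : Set (Euc N)) (G : Euc N → Euc N → Matrix (Fin N) (Fin N) ℝ → ℝ)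
    (f u : Euc N → ℝ) : Prop :=
  ∀ x₀ ∈ Ω, ∀ φ : Euc N → ℝ, ContDiff ℝ 2 φ →
    IsLocalMaxOn (fun x => u x - φ x) Ω x₀ →
    f x₀ ≤ G x₀ (gradient φ x₀) (hess φ x₀)

/-- Standard viscosity supersolution of `G(x, ∇u, D²u) = f(x)` on `Ω`. -/
def ViscSuper {N : ℕ} (Ω : Set (Euc N)) (G : Euc N → Euc N → Matrix (Fin N) (Fin N) ℝ → ℝ)
    (f u : Euc N → ℝ) : Prop :=
  ∀ x₀ ∈ Ω, ∀ φ : Euc N → ℝ, ContDiff ℝ 2 φ →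
    IsLocalMinOn (fun x => u x - φ x) Ω x₀ →
    G x₀ (gradient φ x₀) (hess φ x₀) ≤ f x₀

/-- Standard viscosity solution. -/
def ViscSol {N : ℕ} (Ω : Set (Euc N)) (G : Euc N → Euc N → Matrix (Fin N) (Fin N) ℝ → ℝ)
    (f u : Euc N → ℝ) : Prop :=
  ViscSub Ω G f u ∧ ViscSuper Ω G f u

/-- `u` is not constant on any neighbourhood of `x₀`. -/
def NotLocallyConst {N : ℕ} (u : Euc N → ℝ) (x₀ : Euc N) : Prop :=
  ∀ δ > 0, ∃ y ∈ ball x₀ δ, u y ≠ u x₀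

/-- Viscosity subsolution in the singular sense: test functions have nonvanishing gradient and
are only tested at points where `u` is not locally constant. -/
def ViscSubSing {N : ℕ} (Ω : Set (Euc N)) (G : Euc N → Euc N → Matrix (Fin N) (Fin N) ℝ → ℝ)
    (f u : Euc N → ℝ) : Prop :=
  ∀ x₀ ∈ Ω, NotLocallyConst u x₀ → ∀ φ : Euc N → ℝ, ContDiff ℝ 2 φ →
    gradient φ x₀ ≠ 0 → IsLocalMaxOn (fun x => u x - φ x) Ω x₀ →
    f x₀ ≤ G x₀ (gradient φ x₀) (hess φ x₀)

/-- Viscosity supersolution in the singular sense. -/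
def ViscSuperSing {N : ℕ} (Ω : Set (Euc N)) (G : Euc N → Euc N → Matrix (Fin N) (Fin N) ℝ → ℝ)
    (f u : Euc N → ℝ) : Prop :=
  ∀ x₀ ∈ Ω, NotLocallyConst u x₀ → ∀ φ : Euc N → ℝ, ContDiff ℝ 2 φ →
    gradient φ x₀ ≠ 0 → IsLocalMinOn (fun x => u x - φ x) Ω x₀ →
    G x₀ (gradient φ x₀) (hess φ x₀) ≤ f x₀

/-- Viscosity solution in the singular sense. -/
def ViscSolSing {N : ℕ} (Ω : Set (Euc N)) (G : Euc N → Euc N → Matrix (Fin N) (Fin N) ℝ → ℝ)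
    (f u : Euc N → ℝ) : Prop :=
  ViscSubSing Ω G f u ∧ ViscSuperSing Ω G f u

/-- Viscosity subsolution for the `α`-dependent notion: for `α = 0` it is the standard notion,
for `α ≠ 0` the singular one. -/
def ViscSubA {N : ℕ} (α : ℝ) (Ω : Set (Euc N))
    (G : Euc N → Euc N → Matrix (Fin N) (Fin N) ℝ → ℝ) (f u : Euc N → ℝ) : Prop :=
  ∀ x₀ ∈ Ω, ∀ φ : Euc N → ℝ, ContDiff ℝ 2 φ →
    IsLocalMaxOn (fun x => u x - φ x) Ω x₀ →
    (α = 0 ∨ (NotLocallyConst u x₀ ∧ gradient φ x₀ ≠ 0)) →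
    f x₀ ≤ G x₀ (gradient φ x₀) (hess φ x₀)

/-- Viscosity supersolution for the `α`-dependent notion. -/
def ViscSuperA {N : ℕ} (α : ℝ) (Ω : Set (Euc N))
    (G : Euc N → Euc N → Matrix (Fin N) (Fin N) ℝ → ℝ) (f u : Euc N → ℝ) : Prop :=
  ∀ x₀ ∈ Ω, ∀ φ : Euc N → ℝ, ContDiff ℝ 2 φ →
    IsLocalMinOn (fun x => u x - φ x) Ω x₀ →
    (α = 0 ∨ (NotLocallyConst u x₀ ∧ gradient φ x₀ ≠ 0)) →
    G x₀ (gradient φ x₀) (hess φ x₀) ≤ f x₀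

/-- Viscosity solution for the `α`-dependent notion. -/
def ViscSolA {N : ℕ} (α : ℝ) (Ω : Set (Euc N))
    (G : Euc N → Euc N → Matrix (Fin N) (Fin N) ℝ → ℝ) (f u : Euc N → ℝ) : Prop :=
  ViscSubA α Ω G f u ∧ ViscSuperA α Ω G f u

section Convex

variable {E : Type*} [NormedAddCommGroup E] [InnerProductSpace ℝ E]

theorem ConvexOn.exists_subgradient [FiniteDimensional ℝ E] {H : E → ℝ}
    (hH : ConvexOn ℝ univ H) (x : E) : ∃ p : E, ∀ y, H x + ⟪p, y⟫ ≤ H (x + y) := by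
  have hcont : Continuous H := by
    simpa [continuousOn_univ] using hH.continuousOn_interior
  have hconv : Convex ℝ {q : E × ℝ | H q.1 < q.2} := by
    simpa using hH.convex_strict_epigraph
  have hopen : IsOpen {q : E × ℝ | H q.1 < q.2} :=
    isOpen_lt (hcont.comp continuous_fst) continuous_snd
  obtain ⟨L, hL⟩ := geometric_hahn_banach_open_point hconv hopen
    (show (x, H x) ∉ {q : E × ℝ | H q.1 < q.2} by simp)
  set l : E →L[ℝ] ℝ := L.comp (.inl ℝ E ℝ)
  set c : ℝ := L (0, 1)
  have hLeq : ∀ y t, L (y, t) = l y + t * c := fun y t => by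
    have : ((y, t) : E × ℝ) = (y, 0) + t • (0, 1) := by simp
    rw [this, map_add, map_smul]; simp [l, c]
  have hstrict : ∀ y t, H y < t → l y + t * c < l x + H x * c := fun y t hyt => by
    rw [← hLeq, ← hLeq]; exact hL (y, t) hyt
  have hc : c < 0 := by
    have := hstrict x (H x + 1) (by linarith)
    linarith
  have hle : ∀ y, l y + H y * c ≤ l x + H x * c := fun y => by
    refine le_of_forall_pos_le_add fun ε hε => ?_
    have := hstrict y (H y + ε / (-c)) (by have := div_pos hε (neg_pos.2 hc); linarith)
    have h2 : ε / (-c) * c = -ε := by rw [div_neg, neg_mul, div_mul_cancel₀ _ hc.ne]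
    rw [add_mul, h2] at this
    linarith
  refine ⟨(InnerProductSpace.toDual ℝ E).symm ((-c)⁻¹ • l), fun y => ?_⟩
  rw [InnerProductSpace.toDual_symm_apply]
  have := hle (x + y)
  rw [map_add] at this
  have h3 : ((-c)⁻¹ • l) y = l y / (-c) := by simp [div_eq_inv_mul]
  rw [h3, ← le_sub_iff_add_le', div_le_iff₀ (neg_pos.2 hc)]
  nlinarith

theorem ConvexOn.exists_lipschitz_gradient [FiniteDimensional ℝ E] {H : E → ℝ} {C : ℝ}
    (hC0 : 0 ≤ C) (hH : ConvexOn ℝ univ H)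
    (hC : ∀ x y, H (x + y) + H (x - y) ≤ 2 * H x + C * ‖y‖ ^ 2) :
    ∃ (P : E → E) (K : NNReal), LipschitzWith K P ∧ ∀ x, HasGradientAt H (P x) x := by
  choose P hP using hH.exists_subgradient
  have hup : ∀ x y, H (x + y) ≤ H x + ⟪P x, y⟫ + C * ‖y‖ ^ 2 := fun x y => by
    have h1 := hC x y
    have h2 := hP x (-y)
    rw [inner_neg_right, ← sub_eq_add_neg x] at h2
    linarith
  refine ⟨P, ⟨4 * C, by positivity⟩, LipschitzWith.of_dist_le_mul fun b a => ?_, fun x => ?_⟩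
  · rw [dist_eq_norm, dist_eq_norm]
    change ‖P b - P a‖ ≤ 4 * C * ‖b - a‖
    set D := P b - P a with hD
    have key : ∀ w, ⟪D, w⟫ ≤ C * ‖b - a + w‖ ^ 2 := fun w => by
      have h1 := hP b w
      have h2 := hup a (b - a + w)
      have h3 := hP a (b - a)
      rw [show a + (b - a + w) = b + w by abel, inner_add_right] at h2
      rw [show a + (b - a) = b by abel] at h3
      rw [hD, inner_sub_left]
      linarith
    rcases eq_or_ne D 0 with h0 | h0
    · rw [h0, norm_zero]; positivity
    have hDn : 0 < ‖D‖ := norm_pos_iff.2 h0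
    rcases eq_or_ne b a with hba | hba
    · exact absurd (by rw [hD, hba, sub_self]) h0
    have hn : 0 < ‖b - a‖ := norm_pos_iff.2 (sub_ne_zero.2 hba)
    have h4 := key ((‖b - a‖ / ‖D‖) • D)
    have h5 : ‖(‖b - a‖ / ‖D‖) • D‖ = ‖b - a‖ := by
      rw [norm_smul, Real.norm_of_nonneg (by positivity)]; field_simp
    have h6 : ‖b - a + (‖b - a‖ / ‖D‖) • D‖ ≤ 2 * ‖b - a‖ :=
      (norm_add_le _ _).trans (by rw [h5]; linarith)
    rw [inner_smul_right, real_inner_self_eq_norm_sq] at h4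
    have h7 : ‖b - a‖ / ‖D‖ * ‖D‖ ^ 2 = ‖b - a‖ * ‖D‖ := by field_simp
    have h8 : ‖b - a + (‖b - a‖ / ‖D‖) • D‖ ^ 2 ≤ (2 * ‖b - a‖) ^ 2 := by gcongr
    have h9 := mul_le_mul_of_nonneg_left h8 hC0
    have : ‖b - a‖ * ‖D‖ ≤ ‖b - a‖ * (4 * C * ‖b - a‖) := by
      rw [← h7]; refine h4.trans (h9.trans (le_of_eq (by ring)))
    exact le_of_mul_le_mul_left this hn
  · rw [hasGradientAt_iff_isLittleO_nhds_zero]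
    have hO : (fun y => H (x + y) - H x - ⟪P x, y⟫) =O[nhds 0] fun y => ‖y‖ ^ 2 := by
      refine Asymptotics.IsBigO.of_bound C (Filter.Eventually.of_forall fun y => ?_)
      rw [Real.norm_eq_abs, abs_of_nonneg (by linarith [hP x y]), norm_pow, norm_norm]
      linarith [hup x y]
    refine hO.trans_isLittleO ?_
    have := (Asymptotics.isLittleO_norm_pow_id (E' := E) (one_lt_two))
    simpa [Function.id_def] using this

theorem exists_convexOn_between {f G : E → ℝ} {C : ℝ} (hf : ConvexOn ℝ univ f)
    (hfG : ∀ x, f x ≤ G x) (hC : ∀ x y, G (x + y) + G (x - y) ≤ 2 * G x + C * ‖y‖ ^ 2) :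
    ∃ H : E → ℝ, ConvexOn ℝ univ H ∧ (∀ x, f x ≤ H x) ∧ (∀ x, H x ≤ G x) ∧
      ∀ x y, H (x + y) + H (x - y) ≤ 2 * H x + C * ‖y‖ ^ 2 := by
  let ι := {k : E → ℝ // ConvexOn ℝ univ k ∧ ∀ x, k x ≤ G x}
  have : Nonempty ι := ⟨⟨f, hf, hfG⟩⟩
  have hbdd : ∀ x, BddAbove (range fun k : ι => k.1 x) := fun x =>
    ⟨G x, by rintro _ ⟨k, rfl⟩; exact k.2.2 x⟩
  let H : E → ℝ := fun x => ⨆ k : ι, k.1 x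
  have hle : ∀ k : E → ℝ, ConvexOn ℝ univ k → (∀ x, k x ≤ G x) → ∀ x, k x ≤ H x :=
    fun k h1 h2 x => le_ciSup (hbdd x) ⟨k, h1, h2⟩
  have hHG : ∀ x, H x ≤ G x := fun x => ciSup_le fun k => k.2.2 x
  have hHc : ConvexOn ℝ univ H := by
    refine ⟨convex_univ, fun x _ y _ a b ha hb hab => ciSup_le fun k => ?_⟩
    refine (k.2.1.2 (mem_univ x) (mem_univ y) ha hb hab).trans ?_
    simp only [smul_eq_mul]
    exact add_le_add (mul_le_mul_of_nonneg_left (le_ciSup (hbdd x) k) ha)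
      (mul_le_mul_of_nonneg_left (le_ciSup (hbdd y) k) hb)
  refine ⟨H, hHc, hle f hf hfG, hHG, fun x y => ?_⟩
  have hK : ConvexOn ℝ univ fun z => (1 / 2 : ℝ) • (H (z + y) + H (z - y)) + -(C * ‖y‖ ^ 2 / 2) := by
    refine ConvexOn.add_const (ConvexOn.smul (by norm_num) (ConvexOn.add ?_ ?_)) _
    · simpa [Function.comp_def] using hHc.translate_left y
    · simpa [Function.comp_def, sub_eq_add_neg] using hHc.translate_left (-y)
  have := hle _ hK (fun z => by
    have := hC z y; have := hHG (z + y); have := hHG (z - y)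
    simp only [smul_eq_mul]; linarith) x
  simp only [smul_eq_mul] at this
  linarith

theorem ConcaveOn.add_sub_le_of_sub_sq {g : E → ℝ} {c : ℝ}
    (hg : ConcaveOn ℝ univ fun x => g x - c * ‖x‖ ^ 2) (x y : E) :
    g (x + y) + g (x - y) ≤ 2 * g x + 2 * c * ‖y‖ ^ 2 := by
  have h1 := hg.2 (mem_univ (x + y)) (mem_univ (x - y)) (show (0 : ℝ) ≤ 1 / 2 by norm_num)
    (show (0 : ℝ) ≤ 1 / 2 by norm_num) (by norm_num)
  have h2 : (1 / 2 : ℝ) • (x + y) + (1 / 2 : ℝ) • (x - y) = x := by module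
  have h3 := parallelogram_law_with_norm ℝ x y
  rw [h2] at h1
  simp only [smul_eq_mul] at h1
  linear_combination 2 * h1 + c * h3

theorem exists_between_lipschitz_gradient [FiniteDimensional ℝ E] {f g : E → ℝ} {c : ℝ}
    (hc : 0 ≤ c) (hf : ConvexOn ℝ univ fun x => f x + c * ‖x‖ ^ 2)
    (hg : ConcaveOn ℝ univ fun x => g x - c * ‖x‖ ^ 2) (hfg : ∀ x, f x ≤ g x) :
    ∃ (k : E → ℝ) (P : E → E) (K : NNReal), (∀ x, f x ≤ k x) ∧ (∀ x, k x ≤ g x) ∧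
      ConvexOn ℝ univ (fun x => k x + c * ‖x‖ ^ 2) ∧ LipschitzWith K P ∧
      ∀ x, HasGradientAt k (P x) x := by
  obtain ⟨H, hH, hfH, hHg, hHC⟩ := exists_convexOn_between (C := 4 * c) hf
    (G := fun x => g x + c * ‖x‖ ^ 2) (fun x => by linarith [hfg x]) fun x y => by
      have := hg.add_sub_le_of_sub_sq x y
      have := parallelogram_law_with_norm ℝ x y
      nlinarith
  obtain ⟨P, K, hP, hHP⟩ := hH.exists_lipschitz_gradient (by positivity) hHC
  refine ⟨fun x => H x - c * ‖x‖ ^ 2, fun x => P x - (2 * c) • x, K + ‖2 * c‖₊,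
    fun x => by linarith [hfH x], fun x => by linarith [hHg x], by simpa using hH,
    hP.sub (lipschitzWith_smul _), fun x => ?_⟩
  rw [hasGradientAt_iff_hasFDerivAt]
  refine ((hHP x).hasFDerivAt.sub
    ((hasStrictFDerivAt_norm_sq x).hasFDerivAt.const_mul c)).congr_fderiv ?_
  ext y
  simp
  ring

theorem hasGradientAt_second_order {k : E → ℝ} {P : E → E} [CompleteSpace E]
    (hk : ∀ x, HasGradientAt k (P x) x) {z : E} {A : E →L[ℝ] E} (hA : HasFDerivAt P A z)
    {δ : ℝ} (hδ : 0 < δ) :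
    ∀ᶠ y in nhds (0 : E),
      |k (z + y) - k z - ⟪P z, y⟫ - 1 / 2 * ⟪A y, y⟫| ≤ δ * ‖y‖ ^ 2 := by
  have h1 := (hasFDerivAt_iff_isLittleO_nhds_zero.1 hA).def hδ
  obtain ⟨r, hr, hball⟩ := Metric.eventually_nhds_iff_ball.1 h1
  filter_upwards [Metric.ball_mem_nhds (0 : E) hr] with y hy
  have hder : ∀ t ∈ Icc (0 : ℝ) 1, HasDerivWithinAt
      (fun t : ℝ => k (z + t • y) - t * ⟪P z, y⟫ - t ^ 2 * (1 / 2 * ⟪A y, y⟫))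
      (⟪P (z + t • y) - P z - A (t • y), y⟫) (Icc 0 1) t := fun t _ => by
    have hl : HasDerivAt (fun t : ℝ => z + t • y) y t := by
      simpa using ((hasDerivAt_id t).smul_const y).const_add z
    have h2 := (hk (z + t • y)).hasFDerivAt.comp_hasDerivAt t hl
    have h3 := (h2.sub ((hasDerivAt_id t).mul_const ⟪P z, y⟫)).sub
      ((hasDerivAt_pow 2 t).mul_const (1 / 2 * ⟪A y, y⟫))
    refine (h3.congr_deriv ?_).hasDerivWithinAt
    simp [inner_sub_left, inner_smul_left]
    ring
  have hbound : ∀ t ∈ Ico (0 : ℝ) 1, ‖⟪P (z + t • y) - P z - A (t • y), y⟫‖ ≤ δ * ‖y‖ ^ 2 :=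
    fun t ht => by
    have hty : ‖t • y‖ ≤ ‖y‖ := by
      rw [norm_smul, Real.norm_of_nonneg ht.1]
      exact mul_le_of_le_one_left (norm_nonneg _) ht.2.le
    have h4 := hball (t • y) (by rw [mem_ball_zero_iff] at hy ⊢; exact hty.trans_lt hy)
    calc _ ≤ ‖P (z + t • y) - P z - A (t • y)‖ * ‖y‖ := norm_inner_le_norm _ _
      _ ≤ (δ * ‖y‖) * ‖y‖ := by
        gcongr; exact h4.trans (by gcongr)
      _ = _ := by ring
  have := norm_image_sub_le_of_norm_deriv_le_segment_01' hder hbound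
  simp only [one_smul, one_mul, one_pow, zero_smul, add_zero, zero_mul, Real.norm_eq_abs] at this
  convert this using 2
  ring

end Convex

section SupConv

variable {E : Type*} [NormedAddCommGroup E] {K : Set E} {c : ℝ} {v : E → ℝ}

/-- The sup-convolution over `K` with a paraboloid of opening `c`. -/
def supConv (K : Set E) (c : ℝ) (v : E → ℝ) (z : E) : ℝ := ⨆ x : K, (v x - c * ‖(x : E) - z‖ ^ 2)

theorem exists_supConv_eq (hK : IsCompact K) (hK0 : K.Nonempty)
    (hv : ContinuousOn v K) (z : E) :
    ∃ x ∈ K, supConv K c v z = v x - c * ‖x - z‖ ^ 2 ∧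
      ∀ y ∈ K, v y - c * ‖y - z‖ ^ 2 ≤ supConv K c v z := by
  obtain ⟨x, hx, hmax⟩ := hK.exists_isMaxOn hK0
    (f := fun y => v y - c * ‖y - z‖ ^ 2) (hv.sub (by fun_prop))
  have : Nonempty K := hK0.to_subtype
  have he : supConv K c v z = v x - c * ‖x - z‖ ^ 2 :=
    le_antisymm (ciSup_le fun y => hmax y.2)
      (le_ciSup (f := fun y : K => v y - c * ‖(y : E) - z‖ ^ 2)
        ⟨_, by rintro _ ⟨y, rfl⟩; exact hmax y.2⟩ ⟨x, hx⟩)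
  exact ⟨x, hx, he, fun y hy => he ▸ hmax hy⟩

theorem exists_supConv_le (hc : 0 ≤ c) (hK : IsCompact K) (hK0 : K.Nonempty)
    (hv : ContinuousOn v K) : ∃ C, ∀ z, supConv K c v z ≤ C - c / 2 * ‖z‖ ^ 2 := by
  obtain ⟨R, hR⟩ := hK.isBounded.exists_norm_le
  obtain ⟨m, hm, hmax⟩ := hK.exists_isMaxOn hK0 hv
  refine ⟨v m + c * R ^ 2, fun z => ?_⟩
  obtain ⟨x, hx, he, -⟩ := exists_supConv_eq (c := c) hK hK0 hv z
  have h1 : v x ≤ v m := hmax hx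
  have h2 : ‖x‖ ^ 2 ≤ R ^ 2 := by gcongr; exact hR x hx
  have h3 : ‖z‖ ≤ ‖x‖ + ‖x - z‖ := by
    have := norm_sub_le x (x - z); rwa [sub_sub_cancel] at this
  have h4 : ‖z‖ ^ 2 ≤ (‖x‖ + ‖x - z‖) ^ 2 := by gcongr
  have h5 : ‖z‖ ^ 2 ≤ 2 * R ^ 2 + 2 * ‖x - z‖ ^ 2 := by nlinarith [sq_nonneg (‖x‖ - ‖x - z‖)]
  have h6 := mul_le_mul_of_nonneg_left h5 hc
  rw [he]
  linarith

theorem convexOn_supConv [InnerProductSpace ℝ E] (hK : IsCompact K) (hK0 : K.Nonempty)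
    (hv : ContinuousOn v K) : ConvexOn ℝ univ fun z => supConv K c v z + c * ‖z‖ ^ 2 := by
  refine ⟨convex_univ, fun y _ z _ a b ha hb hab => ?_⟩
  obtain ⟨x, hx, he, -⟩ := exists_supConv_eq (c := c) hK hK0 hv (a • y + b • z)
  obtain ⟨-, -, -, hy⟩ := exists_supConv_eq (c := c) hK hK0 hv y
  obtain ⟨-, -, -, hz⟩ := exists_supConv_eq (c := c) hK hK0 hv z
  have h1 := mul_le_mul_of_nonneg_left (hy x hx) ha
  have h2 := mul_le_mul_of_nonneg_left (hz x hx) hb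
  simp only [smul_eq_mul]
  rw [he]
  rw [norm_sub_sq_real, inner_add_right, inner_smul_right, inner_smul_right]
  rw [norm_sub_sq_real] at h1 h2
  have h3 : (1 : ℝ) = a + b := hab.symm
  linear_combination h1 + h2 + (c * ‖x‖ ^ 2 - v x) * hab

end SupConv

section Jensen

variable {E : Type*} [NormedAddCommGroup E] [InnerProductSpace ℝ E]

theorem eq_zero_of_eventually_inner_le {q : E} {C : ℝ}
    (h : ∀ᶠ w in nhds (0 : E), ⟪q, w⟫ ≤ C * ‖w‖ ^ 2) : q = 0 := by
  by_contra hq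
  have hqn : 0 < ‖q‖ ^ 2 := by positivity
  have ht : Filter.Tendsto (fun t : ℝ => t • q) (nhdsWithin 0 (Ioi 0)) (nhds 0) := by
    have : Continuous fun t : ℝ => t • q := by fun_prop
    simpa using (this.tendsto 0).mono_left nhdsWithin_le_nhds
  have h1 : ∀ᶠ t : ℝ in nhdsWithin 0 (Ioi 0), t < 1 / (|C| + 1) :=
    nhdsWithin_le_nhds (Iio_mem_nhds (by positivity))
  obtain ⟨t, ht1, ht2, ht3⟩ :=
    ((ht.eventually h).and (h1.and self_mem_nhdsWithin)).exists
  have ht0 : 0 < t := ht3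
  rw [inner_smul_right, real_inner_self_eq_norm_sq, norm_smul, Real.norm_of_nonneg ht0.le,
    mul_pow] at ht1
  rw [lt_div_iff₀ (by positivity)] at ht2
  have h2 : t * ‖q‖ ^ 2 * 1 ≤ t * ‖q‖ ^ 2 * (C * t) := by linarith
  have h3 := le_of_mul_le_mul_left h2 (by positivity)
  nlinarith [le_abs_self C]

theorem inner_le_zero_of_eventually {A : E →L[ℝ] E}
    (h : ∀ δ > 0, ∀ᶠ w in nhds (0 : E), ⟪A w, w⟫ ≤ δ * ‖w‖ ^ 2) (y : E) : ⟪A y, y⟫ ≤ 0 := by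
  have hδ : ∀ δ > 0, ⟪A y, y⟫ ≤ δ * ‖y‖ ^ 2 := fun δ hδ => by
    have ht : Filter.Tendsto (fun t : ℝ => t • y) (nhdsWithin 0 (Ioi 0)) (nhds 0) := by
      have : Continuous fun t : ℝ => t • y := by fun_prop
      simpa using (this.tendsto 0).mono_left nhdsWithin_le_nhds
    obtain ⟨t, ht1, ht2⟩ := ((ht.eventually (h δ hδ)).and self_mem_nhdsWithin).exists
    have ht0 : 0 < t := ht2
    rw [map_smul, inner_smul_left, inner_smul_right, norm_smul, Real.norm_of_nonneg ht0.le,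
      mul_pow] at ht1
    have h2 : t ^ 2 * ⟪A y, y⟫ ≤ t ^ 2 * (δ * ‖y‖ ^ 2) := by
      simp only [conj_trivial] at ht1
      linarith
    exact le_of_mul_le_mul_left h2 (by positivity)
  refine le_of_forall_pos_le_add fun ε hε => ?_
  have := hδ (ε / (‖y‖ ^ 2 + 1)) (by positivity)
  refine this.trans ?_
  rw [zero_add, div_mul_eq_mul_div, div_le_iff₀ (by positivity)]
  nlinarith

/-- A semiconvex function minus a semiconcave one, all of whose small linear perturbations attain
their maximum, has such a maximum point at which both functions are touched by functions with
a second order expansion. -/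
theorem exists_max_with_second_order [FiniteDimensional ℝ E] {V U : E → ℝ} {c r : ℝ}
    (hc : 0 ≤ c) (hr : 0 < r) (hV : ConvexOn ℝ univ fun x => V x + c * ‖x‖ ^ 2)
    (hU : ConcaveOn ℝ univ fun x => U x - c * ‖x‖ ^ 2)
    (hmax : ∀ p : E, ‖p‖ < r → ∃ z, ∀ y, V y - U y - ⟪p, y⟫ ≤ V z - U z - ⟪p, z⟫) :
    ∃ (z p₁ p₂ : E) (A₁ A₂ : E →L[ℝ] E), ‖p₁ - p₂‖ < r ∧
      (∀ y, V y - U y - ⟪p₁ - p₂, y⟫ ≤ V z - U z - ⟪p₁ - p₂, z⟫) ∧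
      (∀ y, ⟪A₁ y, y⟫ ≤ ⟪A₂ y, y⟫) ∧
      ∀ δ > 0, (∀ᶠ w in nhds (0 : E),
          V (z + w) ≤ V z + ⟪p₁, w⟫ + 1 / 2 * ⟪A₁ w, w⟫ + δ * ‖w‖ ^ 2) ∧
        ∀ᶠ w in nhds (0 : E),
          U z + ⟪p₂, w⟫ + 1 / 2 * ⟪A₂ w, w⟫ - δ * ‖w‖ ^ 2 ≤ U (z + w) := by
  let I := {p : E // ‖p‖ < r}
  have : Nonempty I := ⟨⟨0, by simpa using hr⟩⟩
  choose z hz using fun p : I => hmax p.1 p.2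
  let a : I → E → ℝ := fun p x => V (z p) - U (z p) - ⟪p.1, z p⟫ + ⟪p.1, x⟫
  have hbdd : ∀ x, BddBelow (range fun p : I => a p x) := fun x =>
    ⟨V x - U x, by rintro _ ⟨p, rfl⟩; have := hz p x; simp only [a]; linarith⟩
  let Γ : E → ℝ := fun x => ⨅ p : I, a p x
  have hΓa : ∀ p x, Γ x ≤ a p x := fun p x => ciInf_le (hbdd x) p
  have hΓw : ∀ x, V x - U x ≤ Γ x := fun x => le_ciInf fun p => by
    have := hz p x; simp only [a]; linarith
  have hΓ : ConcaveOn ℝ univ Γ := by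
    refine ⟨convex_univ, fun x _ y _ s t hs ht hst => le_ciInf fun p => ?_⟩
    have h1 : a p (s • x + t • y) = s * a p x + t * a p y := by
      simp only [a, inner_add_right, inner_smul_right]
      linear_combination (-(V (z p) - U (z p) - ⟪p.1, z p⟫)) * hst
    rw [h1]
    exact add_le_add (mul_le_mul_of_nonneg_left (hΓa p x) hs)
      (mul_le_mul_of_nonneg_left (hΓa p y) ht)
  obtain ⟨k₁, P₁, K₁, hVk, hkU, hk₁, hP₁, hg₁⟩ := exists_between_lipschitz_gradient hc hV
    (g := fun x => U x + Γ x) ((hU.add hΓ).congr fun x _ => by simp only [Pi.add_apply]; ring)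
    (fun x => by linarith [hΓw x])
  obtain ⟨k₂, P₂, K₂, hkk, hk₂U, -, hP₂, hg₂⟩ := exists_between_lipschitz_gradient hc
    (f := fun x => k₁ x - Γ x) ((hk₁.sub hΓ).congr fun x _ => by simp only [Pi.sub_apply]; ring) hU
    (fun x => by linarith [hkU x])
  have hΓz : ∀ p, Γ (z p) = V (z p) - U (z p) := fun p =>
    le_antisymm ((hΓa p _).trans (by simp [a])) (hΓw _)
  have e₁ : ∀ p, k₁ (z p) = V (z p) := fun p =>
    le_antisymm (by linarith [hkU (z p), hΓz p]) (hVk _)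
  have e₂ : ∀ p, k₂ (z p) = U (z p) := fun p =>
    le_antisymm (hk₂U _) (by linarith [hkk (z p), hΓz p, e₁ p])
  have hle : ∀ p x, k₁ x - k₂ x ≤ k₁ (z p) - k₂ (z p) - ⟪p.1, z p⟫ + ⟪p.1, x⟫ := fun p x => by
    have := hkk x; have := hΓa p x; simp only [a] at this; rw [e₁, e₂]; linarith
  have hgrad : ∀ p : I, P₁ (z p) - P₂ (z p) = p.1 := fun p => by
    have hloc : IsLocalMax (fun x => k₁ x - k₂ x - innerSL ℝ p.1 x) (z p) :=
      Filter.Eventually.of_forall fun x => by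
        have := hle p x; simp only [innerSL_apply_apply]; linarith
    have hd := hloc.hasFDerivAt_eq_zero
      (((hg₁ (z p)).hasFDerivAt.sub (hg₂ (z p)).hasFDerivAt).sub (innerSL ℝ p.1).hasFDerivAt)
    refine ext_inner_right ℝ fun y => ?_
    have := DFunLike.congr_fun hd y
    simp [inner_sub_left] at this ⊢
    linarith
  obtain ⟨p, hd₁, hd₂⟩ : ∃ p, DifferentiableAt ℝ P₁ (z p) ∧ DifferentiableAt ℝ P₂ (z p) := by
    by_contra! hcon
    let _ : MeasurableSpace E := borel E
    have : BorelSpace E := ⟨rfl⟩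
    let μ : MeasureTheory.Measure E := MeasureTheory.Measure.hausdorffMeasure (Module.finrank ℝ E)
    have hae : ∀ᵐ x ∂μ, DifferentiableAt ℝ P₁ x ∧ DifferentiableAt ℝ P₂ x :=
      hP₁.ae_differentiableAt.and hP₂.ae_differentiableAt
    rw [MeasureTheory.ae_iff] at hae
    have himg := (hP₁.sub hP₂).hausdorffMeasure_image_le (d := Module.finrank ℝ E) (by positivity)
      {x | ¬(DifferentiableAt ℝ P₁ x ∧ DifferentiableAt ℝ P₂ x)}
    have hsub : ball (0 : E) r ⊆ (fun x => P₁ x - P₂ x) ''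
        {x | ¬(DifferentiableAt ℝ P₁ x ∧ DifferentiableAt ℝ P₂ x)} := fun p hp =>
      ⟨z ⟨p, by simpa using hp⟩, fun hh => hcon _ hh.1 hh.2, hgrad ⟨p, by simpa using hp⟩⟩
    have hpos : 0 < μ (ball (0 : E) r) := measure_ball_pos μ 0 hr
    have h0 : μ (ball (0 : E) r) ≤ 0 := by
      refine (MeasureTheory.measure_mono hsub).trans (himg.trans ?_)
      change _ * μ _ ≤ 0
      rw [hae, mul_zero]
    exact absurd hpos (not_lt.2 h0)
  refine ⟨z p, P₁ (z p), P₂ (z p), fderiv ℝ P₁ (z p), fderiv ℝ P₂ (z p), ?_, ?_, ?_, ?_⟩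
  · rw [hgrad]; exact p.2
  · rw [hgrad]; exact hz p
  · intro y
    have := inner_le_zero_of_eventually (A := fderiv ℝ P₁ (z p) - fderiv ℝ P₂ (z p))
      (fun δ hδ => by
        filter_upwards [hasGradientAt_second_order hg₁ hd₁.hasFDerivAt (δ := δ / 4) (by linarith),
          hasGradientAt_second_order hg₂ hd₂.hasFDerivAt (δ := δ / 4) (by linarith)] with w h₁ h₂
        have h₃ := hle p (z p + w)
        have h₄ : ⟪P₁ (z p), w⟫ - ⟪P₂ (z p), w⟫ = ⟪p.1, w⟫ := by
          rw [← inner_sub_left, hgrad]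
        rw [inner_add_right] at h₃
        rw [abs_le] at h₁ h₂
        rw [_root_.sub_apply, inner_sub_left]
        linarith [h₁.1, h₂.2]) y
    rw [_root_.sub_apply, inner_sub_left] at this
    linarith
  · intro δ hδ
    constructor
    · filter_upwards [hasGradientAt_second_order hg₁ hd₁.hasFDerivAt hδ] with w h₁
      rw [abs_le, e₁] at h₁
      linarith [hVk (z p + w), h₁.2]
    · filter_upwards [hasGradientAt_second_order hg₂ hd₂.hasFDerivAt hδ] with w h₂
      rw [abs_le, e₂] at h₂
      linarith [hk₂U (z p + w), h₂.1]

theorem exists_doubling_max [FiniteDimensional ℝ E] {K : Set E} {c r : ℝ} {u v : E → ℝ}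
    (hc : 0 < c) (hr : 0 < r) (hK : IsCompact K) (hK0 : K.Nonempty) (hu : ContinuousOn u K)
    (hv : ContinuousOn v K) :
    ∃ (x y z p₁ p₂ : E) (A₁ A₂ : E →L[ℝ] E), x ∈ K ∧ y ∈ K ∧ ‖p₁ - p₂‖ < r ∧
      p₁ = (2 * c) • (x - z) ∧ p₂ = (2 * c) • (z - y) ∧
      (∀ x₀ ∈ K, v x₀ - u x₀ - ⟪p₁ - p₂, x₀⟫ ≤
        v x - u y - c * ‖x - z‖ ^ 2 - c * ‖y - z‖ ^ 2 - ⟪p₁ - p₂, z⟫) ∧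
      (∀ w, ⟪A₁ w, w⟫ ≤ ⟪A₂ w, w⟫) ∧
      ∀ δ > 0, (∀ᶠ w in nhds (0 : E), x + w ∈ K →
          v (x + w) ≤ v x + ⟪p₁, w⟫ + 1 / 2 * ⟪A₁ w, w⟫ + δ * ‖w‖ ^ 2) ∧
        ∀ᶠ w in nhds (0 : E), y + w ∈ K →
          u y + ⟪p₂, w⟫ + 1 / 2 * ⟪A₂ w, w⟫ - δ * ‖w‖ ^ 2 ≤ u (y + w) := by
  have hu' : ContinuousOn (fun x => -u x) K := hu.neg
  set V := supConv K c v with hVdef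
  set W := supConv K c (fun x => -u x) with hWdef
  have hV : ConvexOn ℝ univ fun z => V z + c * ‖z‖ ^ 2 := convexOn_supConv hK hK0 hv
  have hW : ConvexOn ℝ univ fun z => W z + c * ‖z‖ ^ 2 := convexOn_supConv hK hK0 hu'
  have hcont : ∀ f : E → ℝ, ConvexOn ℝ univ (fun z => f z + c * ‖z‖ ^ 2) → Continuous f := by
    intro f hf
    have h1 : Continuous fun z => f z + c * ‖z‖ ^ 2 := by
      simpa [continuousOn_univ] using hf.continuousOn_interior
    have h2 : Continuous fun z : E => c * ‖z‖ ^ 2 := by fun_prop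
    exact (h1.sub h2).congr fun z => add_sub_cancel_right _ _
  obtain ⟨C₁, hC₁⟩ := exists_supConv_le hc.le hK hK0 hv
  obtain ⟨C₂, hC₂⟩ := exists_supConv_le hc.le hK hK0 hu'
  have hmax : ∀ p : E, ‖p‖ < r →
      ∃ z, ∀ y, V y - -W y - ⟪p, y⟫ ≤ V z - -W z - ⟪p, z⟫ := fun p _ => by
    have hf : Continuous fun y => V y - -W y - ⟪p, y⟫ :=
      ((hcont V hV).sub (hcont W hW).neg).sub (by fun_prop)
    refine hf.exists_forall_ge' 0 ?_
    filter_upwards [(tendsto_norm_cocompact_atTop (E := E)).eventually_ge_atTop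
      (max ((‖p‖ + 1) / c) (C₁ + C₂ - (V 0 - -W 0 - ⟪p, 0⟫)))] with y hy
    have h1 := (div_le_iff₀ hc).1 ((le_max_left _ _).trans hy)
    have h2 := (le_max_right _ _).trans hy
    have h3 := hC₁ y
    have h4 := hC₂ y
    have h5 := neg_le_of_abs_le (abs_real_inner_le_norm p y)
    nlinarith [norm_nonneg y]
  obtain ⟨z, p₁, p₂, A₁, A₂, hp, hz, hA, hexp⟩ := exists_max_with_second_order hc.le hr hV
    (U := fun z => -W z) (hW.neg.congr fun z _ => by simp only [Pi.neg_apply]; ring) hmax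
  obtain ⟨x, hx, hxe, hxm⟩ := exists_supConv_eq (c := c) hK hK0 hv z
  obtain ⟨y, hy, hye, hym⟩ := exists_supConv_eq (c := c) hK hK0 hu' z
  rw [← hVdef] at hxe hxm
  rw [← hWdef] at hye hym
  have hVge : ∀ z, ∀ x ∈ K, v x - c * ‖x - z‖ ^ 2 ≤ V z := fun z =>
    (exists_supConv_eq hK hK0 hv z).choose_spec.2.2
  have hWge : ∀ z, ∀ x ∈ K, -u x - c * ‖x - z‖ ^ 2 ≤ W z := fun z =>
    (exists_supConv_eq hK hK0 hu' z).choose_spec.2.2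
  have hAle : ∀ (A : E →L[ℝ] E) w, |⟪A w, w⟫| ≤ ‖A‖ * ‖w‖ ^ 2 := fun A w =>
    (abs_real_inner_le_norm _ _).trans (by nlinarith [A.le_opNorm w, norm_nonneg w])
  refine ⟨x, y, z, p₁, p₂, A₁, A₂, hx, hy, hp, ?_, ?_, ?_, hA, fun δ hδ => ⟨?_, ?_⟩⟩
  · have : (2 * c) • (x - z) - p₁ = 0 := by
      refine eq_zero_of_eventually_inner_le (C := c + ‖A₁‖ + 1) ?_
      filter_upwards [(hexp 1 one_pos).1] with w hw
      have h1 := hVge (z + w) x hx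
      rw [← sub_sub, norm_sub_sq_real (x - z) w] at h1
      have h2 := abs_le.1 (hAle A₁ w)
      have h3 := norm_nonneg A₁
      rw [inner_sub_left, inner_smul_left]
      simp only [conj_trivial]
      nlinarith [sq_nonneg ‖w‖]
    exact (sub_eq_zero.1 this).symm
  · have : p₂ - (2 * c) • (z - y) = 0 := by
      refine eq_zero_of_eventually_inner_le (C := c + ‖A₂‖ + 1) ?_
      filter_upwards [(hexp 1 one_pos).2] with w hw
      have h1 := hWge (z + w) y hy
      rw [← sub_sub, norm_sub_sq_real (y - z) w] at h1
      have h2 := abs_le.1 (hAle A₂ w)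
      have h3 := norm_nonneg A₂
      rw [inner_sub_left, inner_smul_left, ← neg_sub y z, inner_neg_left]
      simp only [conj_trivial]
      nlinarith [sq_nonneg ‖w‖]
    exact sub_eq_zero.1 this
  · intro x₀ hx₀
    have h1 := hz x₀
    have h2 := hVge x₀ x₀ hx₀
    have h3 := hWge x₀ x₀ hx₀
    simp only [sub_self, norm_zero] at h2 h3
    linarith
  · filter_upwards [(hexp δ hδ).1] with w hw hwK
    have h1 := hVge (z + w) (x + w) hwK
    rw [add_sub_add_right_eq_sub] at h1
    linarith
  · filter_upwards [(hexp δ hδ).2] with w hw hwK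
    have h1 := hWge (z + w) (y + w) hwK
    rw [add_sub_add_right_eq_sub] at h1
    linarith

end Jensen

section Doubling

open Filter Topology

variable {E : Type*} [NormedAddCommGroup E] [InnerProductSpace ℝ E] [FiniteDimensional ℝ E]

/-- A form of the Jensen--Ishii lemma: doubling of variables for the maximum of `v - u` over a
compact set. -/
theorem exists_doubling_seq {K : Set E} {u v : E → ℝ} (hK : IsCompact K) (hK0 : K.Nonempty)
    (hu : ContinuousOn u K) (hv : ContinuousOn v K) :
    ∃ (a : E) (x y p₁ p₂ : ℕ → E) (A₁ A₂ : ℕ → E →L[ℝ] E) (δ S : ℕ → ℝ), a ∈ K ∧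
      (∀ x₀ ∈ K, v x₀ - u x₀ ≤ v a - u a) ∧ (∀ n, x n ∈ K) ∧ (∀ n, y n ∈ K) ∧
      Tendsto x atTop (𝓝 a) ∧ Tendsto y atTop (𝓝 a) ∧
      Tendsto (fun n => p₁ n - p₂ n) atTop (𝓝 0) ∧ Tendsto δ atTop (𝓝 0) ∧
      Tendsto S atTop (𝓝 0) ∧ (∀ n, 0 < δ n) ∧ (∀ n, ‖x n - y n‖ * ‖p₁ n‖ ≤ S n) ∧
      (∀ n w, ⟪A₁ n w, w⟫ ≤ ⟪A₂ n w, w⟫) ∧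
      (∀ n, ∀ᶠ w in 𝓝 (0 : E), x n + w ∈ K →
        v (x n + w) ≤ v (x n) + ⟪p₁ n, w⟫ + 1 / 2 * ⟪A₁ n w, w⟫ + δ n * ‖w‖ ^ 2) ∧
      ∀ n, ∀ᶠ w in 𝓝 (0 : E), y n + w ∈ K →
        u (y n) + ⟪p₂ n, w⟫ + 1 / 2 * ⟪A₂ n w, w⟫ - δ n * ‖w‖ ^ 2 ≤ u (y n + w) := by
  choose x y z p₁ p₂ A₁ A₂ hx hy hp hp₁ hp₂ hmax hA hexp using fun n : ℕ =>
    exists_doubling_max (c := (n : ℝ) + 1) (r := 1 / ((n : ℝ) + 1)) (by positivity) (by positivity)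
      hK hK0 hu hv
  obtain ⟨a, ha, θ, hθ, hxa⟩ := hK.tendsto_subseq hx
  have hr : Tendsto (fun n => 1 / ((θ n : ℝ) + 1)) atTop (𝓝 0) :=
    (tendsto_one_div_add_atTop_nhds_zero_nat (𝕜 := ℝ)).comp hθ.tendsto_atTop
  have hp0 : Tendsto (fun n => p₁ (θ n) - p₂ (θ n)) atTop (𝓝 0) :=
    squeeze_zero_norm (fun n => (hp (θ n)).le) hr
  obtain ⟨R, hR⟩ := hK.isBounded.exists_norm_le
  obtain ⟨Mv, hMv⟩ := (hK.image_of_continuousOn hv).isBounded.exists_norm_le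
  obtain ⟨Mu, hMu⟩ := (hK.image_of_continuousOn hu).isBounded.exists_norm_le
  have hMv' : ∀ w ∈ K, |v w| ≤ Mv := fun w hw => hMv _ ⟨w, hw, rfl⟩
  have hMu' : ∀ w ∈ K, |u w| ≤ Mu := fun w hw => hMu _ ⟨w, hw, rfl⟩
  let T : ℕ → ℝ := fun n => ((n : ℝ) + 1) * (‖x n - z n‖ ^ 2 + ‖y n - z n‖ ^ 2)
  have hT : ∀ n, ∀ x₀ ∈ K, T n ≤ v (x n) - u (y n) - (v x₀ - u x₀) + ⟪p₁ n - p₂ n, x₀ - z n⟫ :=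
    fun n x₀ hx₀ => by
      have := hmax n x₀ hx₀
      simp only [T]
      rw [inner_sub_right]
      linarith
  have hTbd : ∀ n, T n ≤ 2 * (2 * Mv + 2 * Mu + 2 * R + 1) := fun n => by
    have h1 := hT n (x n) (hx n)
    have h2 := abs_le.1 (hMv' _ (hx n))
    have h3 := abs_le.1 (hMu' _ (hx n))
    have h4 := abs_le.1 (hMu' _ (hy n))
    have hr1 : 1 / ((n : ℝ) + 1) ≤ 1 := by
      rw [div_le_one (by positivity)]; linarith [(Nat.cast_nonneg n : (0 : ℝ) ≤ n)]
    have h5 : ⟪p₁ n - p₂ n, x n - z n⟫ ≤ ‖x n - z n‖ :=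
      (real_inner_le_norm _ _).trans
        (mul_le_of_le_one_left (norm_nonneg _) ((hp n).le.trans hr1))
    have h6 : ‖x n - z n‖ ^ 2 ≤ T n := by
      have : (0 : ℝ) ≤ n := Nat.cast_nonneg n
      simp only [T]
      nlinarith [sq_nonneg ‖x n - z n‖, sq_nonneg ‖y n - z n‖,
        mul_nonneg this (sq_nonneg ‖x n - z n‖), mul_nonneg this (sq_nonneg ‖y n - z n‖)]
    have hR0 : 0 ≤ R := (norm_nonneg _).trans (hR _ (hx n))
    nlinarith [sq_nonneg (‖x n - z n‖ - 1)]
  set C := 2 * (2 * Mv + 2 * Mu + 2 * R + 1) with hC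
  have hsq : Tendsto (fun n => C * (1 / ((θ n : ℝ) + 1))) atTop (𝓝 0) := by
    simpa using hr.const_mul C
  have hsmall : ∀ f : ℕ → E, (∀ n : ℕ, ((n : ℝ) + 1) * ‖f n‖ ^ 2 ≤ T n) →
      Tendsto (fun n => f (θ n)) atTop (𝓝 0) := fun f hf => by
    have h1 : Tendsto (fun n => ‖f (θ n)‖ ^ 2) atTop (𝓝 0) := by
      refine squeeze_zero (fun n => by positivity) (fun n => ?_) hsq
      rw [mul_one_div, le_div_iff₀ (by positivity), mul_comm]
      exact (hf _).trans (hTbd _)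
    have h2 := (Real.continuous_sqrt.tendsto 0).comp h1
    simp only [Real.sqrt_zero, Function.comp_def, Real.sqrt_sq (norm_nonneg _)] at h2
    exact tendsto_zero_iff_norm_tendsto_zero.2 h2
  have hxz : Tendsto (fun n => x (θ n) - z (θ n)) atTop (𝓝 0) :=
    hsmall (fun n => x n - z n) fun n =>
      mul_le_mul_of_nonneg_left (le_add_of_nonneg_right (by positivity)) (by positivity)
  have hyz : Tendsto (fun n => y (θ n) - z (θ n)) atTop (𝓝 0) :=
    hsmall (fun n => y n - z n) fun n =>
      mul_le_mul_of_nonneg_left (le_add_of_nonneg_left (by positivity)) (by positivity)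
  have hza : Tendsto (fun n => z (θ n)) atTop (𝓝 a) := by
    simpa using hxa.sub hxz
  have hya : Tendsto (fun n => y (θ n)) atTop (𝓝 a) := by
    simpa using hyz.add hza
  have hva : Tendsto (fun n => v (x (θ n))) atTop (𝓝 (v a)) :=
    (hv a ha).tendsto.comp (tendsto_nhdsWithin_iff.2 ⟨hxa, .of_forall fun n => hx _⟩)
  have hua : Tendsto (fun n => u (y (θ n))) atTop (𝓝 (u a)) :=
    (hu a ha).tendsto.comp (tendsto_nhdsWithin_iff.2 ⟨hya, .of_forall fun n => hy _⟩)
  have hlim : ∀ x₀, Tendsto (fun n => v (x (θ n)) - u (y (θ n)) - (v x₀ - u x₀) +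
      ⟪p₁ (θ n) - p₂ (θ n), x₀ - z (θ n)⟫) atTop (𝓝 (v a - u a - (v x₀ - u x₀))) := fun x₀ => by
    simpa using ((hva.sub hua).sub_const (v x₀ - u x₀)).add (hp0.inner (hza.const_sub x₀))
  have hT0 : ∀ n, 0 ≤ T n := fun n => by positivity
  have hTlim : Tendsto (fun n => T (θ n)) atTop (𝓝 0) :=
    squeeze_zero (fun n => hT0 _) (fun n => hT _ a ha) (by simpa using hlim a)
  refine ⟨a, x ∘ θ, y ∘ θ, p₁ ∘ θ, p₂ ∘ θ, A₁ ∘ θ, A₂ ∘ θ, fun n => 1 / ((θ n : ℝ) + 1),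
    fun n => 4 * T (θ n), ha, fun x₀ hx₀ => ?_, fun n => hx _, fun n => hy _, hxa, hya, hp0, hr,
    by simpa using hTlim.const_mul 4, fun n => by positivity, fun n => ?_, fun n => hA _,
    fun n => (hexp (θ n) _ (by positivity)).1, fun n => (hexp (θ n) _ (by positivity)).2⟩
  · have := ge_of_tendsto' (hlim x₀) fun n => (hT0 _).trans (hT _ x₀ hx₀)
    linarith
  · simp only [Function.comp_apply]
    generalize θ n = m
    have h1 : ‖x m - y m‖ ≤ ‖x m - z m‖ + ‖y m - z m‖ := by
      have := norm_sub_le (x m - z m) (y m - z m)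
      rwa [sub_sub_sub_cancel_right] at this
    have hm : (0 : ℝ) < m + 1 := by positivity
    have h2 : ‖p₁ m‖ = 2 * ((m : ℝ) + 1) * ‖x m - z m‖ := by
      rw [hp₁, norm_smul, Real.norm_of_nonneg (by positivity)]
    rw [h2]
    calc _ ≤ (‖x m - z m‖ + ‖y m - z m‖) * (2 * ((m : ℝ) + 1) * ‖x m - z m‖) := by gcongr
      _ = ((m : ℝ) + 1) * (2 * ‖x m - z m‖ ^ 2 + 2 * (‖x m - z m‖ * ‖y m - z m‖)) := by ring
      _ ≤ ((m : ℝ) + 1) * (4 * (‖x m - z m‖ ^ 2 + ‖y m - z m‖ ^ 2)) := by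
        gcongr
        nlinarith [sq_nonneg (‖x m - z m‖ - ‖y m - z m‖), sq_nonneg ‖x m - z m‖,
          sq_nonneg ‖y m - z m‖]
      _ = _ := by simp only [T]; ring

end Doubling

section Quadratic

variable {N : ℕ}

/-- The matrix of a continuous linear endomorphism of `ℝ^N` as a bilinear form. -/
def formMatrix (B : Euc N →L[ℝ] Euc N) : Matrix (Fin N) (Fin N) ℝ :=
  Matrix.of fun i j => ⟪B (EuclideanSpace.single i 1), EuclideanSpace.single j 1⟫

theorem formMatrix_isSymm {B : Euc N →L[ℝ] Euc N} (hB : ∀ x y, ⟪B x, y⟫ = ⟪x, B y⟫) :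
    (formMatrix B).IsSymm := by
  ext i j
  simp only [formMatrix, Matrix.transpose_apply, Matrix.of_apply]
  rw [hB, real_inner_comm]

theorem dotProduct_formMatrix_mulVec (B : Euc N →L[ℝ] Euc N) (x : Fin N → ℝ) :
    x ⬝ᵥ (formMatrix B).mulVec x = ⟪B (WithLp.toLp 2 x), WithLp.toLp 2 x⟫ := by
  have hx : WithLp.toLp 2 x = ∑ i, x i • (EuclideanSpace.single i 1 : Euc N) := by
    ext k
    simp [Finset.sum_apply, Pi.single_apply]
  rw [hx, map_sum, sum_inner]
  simp only [dotProduct, Matrix.mulVec, formMatrix, Matrix.of_apply, map_smul, inner_smul_left,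
    inner_sum, inner_smul_right, conj_trivial, Finset.mul_sum]
  refine Finset.sum_congr rfl fun i _ => Finset.sum_congr rfl fun j _ => ?_
  ring

theorem UnifElliptic.le_of_inner_le {lam Lam : ℝ} {F : Matrix (Fin N) (Fin N) ℝ → ℝ}
    (hlam : 0 ≤ lam) (hF : UnifElliptic lam Lam F) {B₁ B₂ : Euc N →L[ℝ] Euc N} {η : ℝ}
    (hη : 0 ≤ η) (h₁ : ∀ x y, ⟪B₁ x, y⟫ = ⟪x, B₁ y⟫) (h₂ : ∀ x y, ⟪B₂ x, y⟫ = ⟪x, B₂ y⟫)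
    (hle : ∀ w, ⟪B₁ w, w⟫ ≤ ⟪B₂ w, w⟫ + η * ‖w‖ ^ 2) :
    F (formMatrix B₁) ≤ F (formMatrix B₂) + Lam * (η * N) := by
  have hs₁ := formMatrix_isSymm h₁
  have hs₂ := formMatrix_isSymm h₂
  have hη1 : (η • (1 : Matrix (Fin N) (Fin N) ℝ)).PosSemidef := Matrix.PosSemidef.one.smul hη
  have hP : (formMatrix B₂ + η • (1 : Matrix (Fin N) (Fin N) ℝ) - formMatrix B₁).PosSemidef := by
    refine .of_dotProduct_mulVec_nonneg ?_ fun x => ?_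
    · have hsymm : (formMatrix B₂ + η • (1 : Matrix (Fin N) (Fin N) ℝ) -
          formMatrix B₁).IsSymm := (hs₂.add (Matrix.isSymm_one.smul η)).sub hs₁
      rw [Matrix.IsHermitian, Matrix.conjTranspose_eq_transpose_of_trivial]
      exact hsymm
    · have h3 := hle (WithLp.toLp 2 x)
      have h4 : ‖(WithLp.toLp 2 x : Euc N)‖ ^ 2 = x ⬝ᵥ x := by
        rw [EuclideanSpace.norm_sq_eq]; simp [dotProduct, sq]
      rw [← dotProduct_formMatrix_mulVec, ← dotProduct_formMatrix_mulVec, h4] at h3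
      simp only [star_trivial, Matrix.sub_mulVec, Matrix.add_mulVec, Matrix.smul_mulVec,
        Matrix.one_mulVec, dotProduct_sub, dotProduct_add, dotProduct_smul, smul_eq_mul]
      linarith
  have h5 := (hF _ _ hs₁ hP).1
  have h6 := (hF _ _ hs₂ hη1).2
  rw [add_sub_cancel] at h5
  have h7 : Matrix.trace (η • (1 : Matrix (Fin N) (Fin N) ℝ)) = η * N := by simp
  rw [h7] at h6
  have h8 := mul_nonneg hlam hP.trace_nonneg
  linarith

section TestFunction

variable (a : ℝ) (x₀ p : Euc N) {B : Euc N →L[ℝ] Euc N}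

theorem hasFDerivAt_quadratic (hB : ∀ x y, ⟪B x, y⟫ = ⟪x, B y⟫) (x : Euc N) :
    HasFDerivAt (fun x => a + ⟪p, x - x₀⟫ + 1 / 2 * ⟪B (x - x₀), x - x₀⟫)
      (innerSL ℝ (p + B (x - x₀))) x := by
  have h1 : HasFDerivAt (fun x => x - x₀) (ContinuousLinearMap.id ℝ (Euc N)) x :=
    (hasFDerivAt_id x).sub_const x₀
  have h2 := (B.hasFDerivAt (x := x - x₀)).comp x h1
  refine ((((hasFDerivAt_const p x).inner ℝ h1).const_add a).add
    ((h2.inner ℝ h1).const_mul (1 / 2))).congr_fderiv ?_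
  ext y
  have h3 : ⟪B y, x - x₀⟫ = ⟪B (x - x₀), y⟫ := by rw [hB, real_inner_comm]
  simp only [map_sub, inner_sub_left, inner_sub_right] at h3
  simp [inner_sub_left, inner_sub_right]
  linarith

theorem contDiff_quadratic :
    ContDiff ℝ 2 fun x => a + ⟪p, x - x₀⟫ + 1 / 2 * ⟪B (x - x₀), x - x₀⟫ := by
  have h : ContDiff ℝ 2 fun x => x - x₀ := contDiff_id.sub contDiff_const
  exact (contDiff_const.add (contDiff_const.inner ℝ h)).add
    (contDiff_const.mul ((B.contDiff.comp h).inner ℝ h))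

theorem gradient_quadratic (hB : ∀ x y, ⟪B x, y⟫ = ⟪x, B y⟫) :
    gradient (fun x => a + ⟪p, x - x₀⟫ + 1 / 2 * ⟪B (x - x₀), x - x₀⟫) x₀ = p := by
  refine HasGradientAt.gradient (hasGradientAt_iff_hasFDerivAt.2
    ((hasFDerivAt_quadratic a x₀ p hB x₀).congr_fderiv ?_))
  ext y
  simp

theorem hess_quadratic (hB : ∀ x y, ⟪B x, y⟫ = ⟪x, B y⟫) :
    hess (fun x => a + ⟪p, x - x₀⟫ + 1 / 2 * ⟪B (x - x₀), x - x₀⟫) x₀ = formMatrix B := by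
  have h1 : fderiv ℝ (fun x => a + ⟪p, x - x₀⟫ + 1 / 2 * ⟪B (x - x₀), x - x₀⟫) =
      fun x => innerSL ℝ (p + B (x - x₀)) :=
    funext fun x => (hasFDerivAt_quadratic a x₀ p hB x).fderiv
  have h2 : HasFDerivAt (fun x => p + B (x - x₀)) B x₀ := by
    have h0 : HasFDerivAt (fun x => x - x₀) (ContinuousLinearMap.id ℝ (Euc N)) x₀ :=
      (hasFDerivAt_id x₀).sub_const x₀
    exact (HasFDerivAt.comp (f := fun x => x - x₀) x₀ B.hasFDerivAt h0).const_add p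
  have h3 : HasFDerivAt (fun x => innerSL ℝ (p + B (x - x₀))) ((innerSL ℝ).comp B) x₀ :=
    (innerSL ℝ).hasFDerivAt.comp x₀ h2
  ext i j
  simp only [hess, formMatrix, Matrix.of_apply, iteratedFDeriv_two_apply]
  rw [h1, h3.fderiv]
  simp

end TestFunction

open Filter Topology

variable {Ω : Set (Euc N)} {G : Euc N → Euc N → Matrix (Fin N) (Fin N) ℝ → ℝ} {f u : Euc N → ℝ}
  {x₀ p : Euc N} {B : Euc N →L[ℝ] Euc N}

theorem eventually_nhdsWithin_of_add {P : Euc N → Prop}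
    (h : ∀ᶠ w in 𝓝 (0 : Euc N), x₀ + w ∈ Ω → P (x₀ + w)) : ∀ᶠ x in 𝓝[Ω] x₀, P x := by
  rw [eventually_nhdsWithin_iff]
  have ht : Tendsto (fun x => x - x₀) (𝓝 x₀) (𝓝 0) := by
    simpa using (continuous_sub_right x₀).tendsto x₀
  simpa using ht.eventually h

theorem ViscSub.le_of_quadratic (hu : ViscSub Ω G f u) (hx₀ : x₀ ∈ Ω)
    (hB : ∀ x y, ⟪B x, y⟫ = ⟪x, B y⟫)
    (h : ∀ᶠ w in 𝓝 (0 : Euc N), x₀ + w ∈ Ω → u (x₀ + w) ≤ u x₀ + ⟪p, w⟫ + 1 / 2 * ⟪B w, w⟫) :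
    f x₀ ≤ G x₀ p (formMatrix B) := by
  have := hu x₀ hx₀ _ (contDiff_quadratic (u x₀) x₀ p (B := B)) <|
    eventually_nhdsWithin_of_add <| h.mono fun w hw hwΩ => by
      have := hw hwΩ
      simp only [add_sub_cancel_left, sub_self, map_zero, inner_zero_right]
      linarith
  rwa [gradient_quadratic _ _ _ hB, hess_quadratic _ _ _ hB] at this

theorem ViscSuper.le_of_quadratic (hu : ViscSuper Ω G f u) (hx₀ : x₀ ∈ Ω)
    (hB : ∀ x y, ⟪B x, y⟫ = ⟪x, B y⟫)
    (h : ∀ᶠ w in 𝓝 (0 : Euc N), x₀ + w ∈ Ω → u x₀ + ⟪p, w⟫ + 1 / 2 * ⟪B w, w⟫ ≤ u (x₀ + w)) :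
    G x₀ p (formMatrix B) ≤ f x₀ := by
  have := hu x₀ hx₀ _ (contDiff_quadratic (u x₀) x₀ p (B := B)) <|
    eventually_nhdsWithin_of_add <| h.mono fun w hw hwΩ => by
      have := hw hwΩ
      simp only [add_sub_cancel_left, sub_self, map_zero, inner_zero_right]
      linarith
  rwa [gradient_quadratic _ _ _ hB, hess_quadratic _ _ _ hB] at this

theorem exists_symm_quadratic_eq (A : Euc N →L[ℝ] Euc N) (δ : ℝ) :
    ∃ B : Euc N →L[ℝ] Euc N, (∀ x y, ⟪B x, y⟫ = ⟪x, B y⟫) ∧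
      ∀ w, ⟪B w, w⟫ = ⟪A w, w⟫ + 2 * δ * ‖w‖ ^ 2 := by
  refine ⟨(1 / 2 : ℝ) • (A + ContinuousLinearMap.adjoint A) +
    (2 * δ) • ContinuousLinearMap.id ℝ (Euc N), fun x y => ?_, fun w => ?_⟩
  · simp [inner_add_left, inner_add_right, inner_smul_left, inner_smul_right,
      ContinuousLinearMap.adjoint_inner_left, ContinuousLinearMap.adjoint_inner_right]
    ring
  · simp [inner_add_left, inner_smul_left, ContinuousLinearMap.adjoint_inner_left,
      real_inner_comm w (A w)]
    ring

end Quadratic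

theorem rpow_sub_one_mul_le {Q s t β : ℝ} (hQ : 0 < Q) (ht : 0 ≤ t)
    (hts : t ≤ Q * s) (hβ : β ∈ Ioo (0 : ℝ) 1) : s ^ (β - 1) * t ≤ (1 + Q) * t ^ β := by
  rcases ht.eq_or_lt with rfl | ht
  · rw [mul_zero]; positivity
  have h1 : s ^ (β - 1) ≤ (t / Q) ^ (β - 1) :=
    Real.rpow_le_rpow_of_nonpos (by positivity) (by rw [div_le_iff₀ hQ]; linarith)
      (by linarith [hβ.2])
  have h2 : Q ^ (1 - β) ≤ 1 + Q :=
    calc Q ^ (1 - β) ≤ (1 + Q) ^ (1 - β) :=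
          Real.rpow_le_rpow hQ.le (by linarith) (by linarith [hβ.2])
      _ ≤ (1 + Q) ^ (1 : ℝ) := Real.rpow_le_rpow_of_exponent_le (by linarith) (by linarith [hβ.1])
      _ = 1 + Q := Real.rpow_one _
  have h3 : (t / Q) ^ (β - 1) * t = Q ^ (1 - β) * t ^ β := by
    rw [Real.div_rpow ht.le hQ.le, ← neg_sub 1 β, Real.rpow_neg hQ.le, div_inv_eq_mul, neg_sub,
      Real.rpow_sub_one ht.ne']
    field_simp
  calc _ ≤ (t / Q) ^ (β - 1) * t := by gcongr
    _ = Q ^ (1 - β) * t ^ β := h3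
    _ ≤ _ := by gcongr

/-- The conditions `[b1]` and `[b2]` force `b` to have a uniform power modulus of continuity in its
second variable. -/
theorem exists_holder_bound {E : Type*} [NormedAddCommGroup E] {β₀ βinf M₀ Cb Q : ℝ}
    (hβ₀ : β₀ ∈ Ioo (0 : ℝ) 1) (hβinf : βinf ∈ Ioo (0 : ℝ) 1)
    (hM₀ : 0 < M₀) (hCb : 0 < Cb) (hQ : 0 < Q) {b : E → E → ℝ}
    (hb1 : ∀ x q, |b x q| ≤ M₀ * (‖q‖ ^ β₀ + ‖q‖ ^ βinf))
    (hb2 : ∀ x p q, p ≠ 0 → ‖q‖ ≤ Q * ‖p‖ →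
      |b x (p + q) - b x p| ≤ Cb * max (‖p‖ ^ (βinf - 1)) (‖p‖ ^ (β₀ - 1)) * ‖q‖) :
    ∃ C, ∀ x p q, |b x p - b x q| ≤ C * (‖p - q‖ ^ β₀ + ‖p - q‖ ^ βinf) := by
  set L := 1 + 1 / Q with hL
  have hL1 : 1 ≤ L := by rw [hL]; linarith [one_div_pos.2 hQ]
  have hscale : ∀ s t β : ℝ, 0 ≤ s → 0 ≤ t → s ≤ L * t → β ∈ Ioo (0 : ℝ) 1 → s ^ β ≤ L * t ^ β := by
    intro s t β hs ht hst hβ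
    calc s ^ β ≤ (L * t) ^ β := Real.rpow_le_rpow hs hst hβ.1.le
      _ = L ^ β * t ^ β := Real.mul_rpow (by positivity) ht
      _ ≤ L ^ (1 : ℝ) * t ^ β := by
        gcongr
        exact hβ.2.le
      _ = _ := by rw [Real.rpow_one]
  have hlarge : ∀ x r w : E, ‖r‖ ≤ L * ‖w‖ → |b x r| ≤ M₀ * L * (‖w‖ ^ β₀ + ‖w‖ ^ βinf) := by
    intro x r w hrw
    have h1 := hscale _ _ β₀ (norm_nonneg r) (norm_nonneg w) hrw hβ₀
    have h2 := hscale _ _ βinf (norm_nonneg r) (norm_nonneg w) hrw hβinf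
    calc _ ≤ _ := hb1 x r
      _ ≤ M₀ * (L * ‖w‖ ^ β₀ + L * ‖w‖ ^ βinf) := by gcongr
      _ = _ := by ring
  refine ⟨Cb * (1 + Q) + 2 * (M₀ * L), fun x p q => ?_⟩
  obtain ⟨w, rfl⟩ : ∃ w, p = q + w := ⟨p - q, by abel⟩
  rw [add_sub_cancel_left]
  have hs : 0 ≤ ‖w‖ ^ β₀ + ‖w‖ ^ βinf := by positivity
  by_cases hcase : q ≠ 0 ∧ ‖w‖ ≤ Q * ‖q‖
  · have h1 := rpow_sub_one_mul_le hQ (norm_nonneg w) hcase.2 hβ₀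
    have h2 := rpow_sub_one_mul_le hQ (norm_nonneg w) hcase.2 hβinf
    have h3 : max (‖q‖ ^ (βinf - 1)) (‖q‖ ^ (β₀ - 1)) * ‖w‖ ≤
        (1 + Q) * (‖w‖ ^ β₀ + ‖w‖ ^ βinf) := by
      have e₀ : 0 ≤ (1 + Q) * ‖w‖ ^ β₀ := by positivity
      have e₁ : 0 ≤ (1 + Q) * ‖w‖ ^ βinf := by positivity
      rw [max_mul_of_nonneg _ _ (norm_nonneg w)]
      exact max_le (by linarith) (by linarith)
    have h4 := hb2 x q w hcase.1 hcase.2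
    have h5 := mul_le_mul_of_nonneg_left h3 hCb.le
    have h6 : 0 ≤ 2 * (M₀ * L) * (‖w‖ ^ β₀ + ‖w‖ ^ βinf) := by positivity
    linarith
  · have hqw : Q * ‖q‖ ≤ ‖w‖ := by
      rcases not_and_or.1 hcase with h0 | h0
      · rw [not_not.1 h0, norm_zero, mul_zero]; positivity
      · exact (not_le.1 h0).le
    have hqw' : ‖q‖ ≤ 1 / Q * ‖w‖ := by
      rw [one_div_mul_eq_div, le_div_iff₀ hQ]; linarith
    have h1 := hlarge x (q + w) w ((norm_add_le _ _).trans (by rw [hL]; linarith))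
    have h2 := hlarge x q w (by rw [hL]; linarith [norm_nonneg w])
    have h3 := abs_sub (b x (q + w)) (b x q)
    have h4 : 0 ≤ Cb * (1 + Q) * (‖w‖ ^ β₀ + ‖w‖ ^ βinf) := by positivity
    linarith

open Filter Topology

/-- comparison principle for `F(D²u) + h·∇u + b(x,∇u) - j(u) = f`. -/
theorem comparison_principle
    (N : ℕ) (lam Lam β₀ βinf M₀ Cb Q γ : ℝ) (Kh : NNReal)
    (hlam : 0 < lam) (hlL : lam ≤ Lam)
    (hβ₀ : β₀ ∈ Ioo (0 : ℝ) 1) (hβinf : βinf ∈ Ioo (0 : ℝ) 1)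
    (hM₀ : 0 < M₀) (hCb : 0 < Cb) (hQ : 0 < Q) (hγ : max β₀ βinf ≤ γ)
    (F : Matrix (Fin N) (Fin N) ℝ → ℝ) (hF : UnifElliptic lam Lam F)
    (h : Euc N → Euc N) (hh : LipschitzWith Kh h)
    (b : Euc N → Euc N → ℝ)
    (hb1 : ∀ x q : Euc N, |b x q| ≤ M₀ * (‖q‖ ^ β₀ + ‖q‖ ^ βinf))
    (hb2 : ∀ x p q : Euc N, p ≠ 0 → ‖q‖ ≤ Q * ‖p‖ →
      |b x (p + q) - b x p| ≤ Cb * max (‖p‖ ^ (βinf - 1)) (‖p‖ ^ (β₀ - 1)) * ‖q‖)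
    (hbx : ∀ x y q : Euc N, |b x q - b y q| ≤ Cb * ‖x - y‖ ^ γ * (‖q‖ ^ β₀ + ‖q‖ ^ βinf))
    (j : ℝ → ℝ)
    (Ω : Set (Euc N)) (hΩo : IsOpen Ω) (hΩb : Bornology.IsBounded Ω)
    (f g u v : Euc N → ℝ)
    (hf : ContinuousOn f Ω) (hg : ContinuousOn g Ω)
    (hu : ContinuousOn u (closure Ω)) (hv : ContinuousOn v (closure Ω))
    (hfg : ∀ x ∈ Ω, f x ≤ g x)
    (hsuper : ViscSuper Ω (fun x p M => F M + ⟪h x, p⟫ + b x p - j (u x)) f u)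
    (hsub : ViscSub Ω (fun x p M => F M + ⟪h x, p⟫ + b x p - j (v x)) g v)
    (hbdry : ∀ x ∈ frontier Ω, v x ≤ u x)
    (hcase : StrictMono j ∨ (Monotone j ∧ ∀ x ∈ Ω, f x < g x)) :
    ∀ x ∈ Ω, v x ≤ u x := by
  intro x₀ hx₀
  by_contra! hlt
  obtain ⟨a, x, y, p₁, p₂, A₁, A₂, δ, S, haK, hmax, hxK, hyK, hxa, hya, hp, hδ, hS, hδ0, hpS, hA,
    hvx, huy⟩ := exists_doubling_seq hΩb.isCompact_closure ⟨x₀, subset_closure hx₀⟩ hu hv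
  have hpos := hmax x₀ (subset_closure hx₀)
  have haΩ : a ∈ Ω := by
    by_contra haΩ
    have := hbdry a (by rw [hΩo.frontier_eq]; exact ⟨haK, haΩ⟩)
    linarith
  choose B₁ hB₁ hB₁q using fun n => exists_symm_quadratic_eq (A₁ n) (δ n)
  choose B₂ hB₂ hB₂q using fun n => exists_symm_quadratic_eq (A₂ n) (-δ n)
  obtain ⟨C, hC⟩ := exists_holder_bound hβ₀ hβinf hM₀ hCb hQ hb1 hb2
  have hxΩ : ∀ᶠ n in atTop, x n ∈ Ω := hxa.eventually (hΩo.mem_nhds haΩ)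
  have hyΩ : ∀ᶠ n in atTop, y n ∈ Ω := hya.eventually (hΩo.mem_nhds haΩ)
  have hxy : Tendsto (fun n => ‖x n - y n‖) atTop (𝓝 0) := by
    simpa using (hxa.sub hya).norm
  have hmain : ∀ᶠ n in atTop, g (x n) - f (y n) + j (v (x n)) - j (u (y n)) ≤
      Lam * (4 * δ n * N) + Kh * S n + ⟪h (y n), p₁ n - p₂ n⟫ +
        Cb * (S n ^ β₀ + S n ^ βinf) + C * (‖p₁ n - p₂ n‖ ^ β₀ + ‖p₁ n - p₂ n‖ ^ βinf) := by
    filter_upwards [hxΩ, hyΩ, hxy.eventually_le_const one_pos] with n hxn hyn hxyn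
    have h1 := hsub.le_of_quadratic hxn (hB₁ n) (p := p₁ n) <| (hvx n).mono fun w hw hwΩ => by
      rw [hB₁q]
      linarith [hw (subset_closure hwΩ)]
    have h2 := hsuper.le_of_quadratic hyn (hB₂ n) (p := p₂ n) <| (huy n).mono fun w hw hwΩ => by
      rw [hB₂q]
      linarith [hw (subset_closure hwΩ)]
    have h3 := hF.le_of_inner_le hlam.le (η := 4 * δ n) (by linarith [hδ0 n]) (hB₁ n) (hB₂ n)
      fun w => by
        rw [hB₁q, hB₂q]
        linarith [hA n w]
    have h4 : ⟪h (x n) - h (y n), p₁ n⟫ ≤ Kh * S n :=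
      calc _ ≤ ‖h (x n) - h (y n)‖ * ‖p₁ n‖ := real_inner_le_norm _ _
        _ ≤ Kh * ‖x n - y n‖ * ‖p₁ n‖ := by gcongr; exact hh.norm_sub_le _ _
        _ = Kh * (‖x n - y n‖ * ‖p₁ n‖) := mul_assoc _ _ _
        _ ≤ _ := by gcongr; exact hpS n
    have hpow : ∀ β ∈ Ioo (0 : ℝ) 1, β ≤ γ → ‖x n - y n‖ ^ γ * ‖p₁ n‖ ^ β ≤ S n ^ β :=
      fun β hβ hβγ =>
        calc _ ≤ ‖x n - y n‖ ^ β * ‖p₁ n‖ ^ β := by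
              gcongr ?_ * _
              exact Real.rpow_le_rpow_of_exponent_ge' (norm_nonneg _) hxyn hβ.1.le hβγ
          _ = (‖x n - y n‖ * ‖p₁ n‖) ^ β :=
              (Real.mul_rpow (norm_nonneg _) (norm_nonneg _)).symm
          _ ≤ _ := Real.rpow_le_rpow (by positivity) (hpS n) hβ.1.le
    have h5 : b (x n) (p₁ n) - b (y n) (p₁ n) ≤ Cb * (S n ^ β₀ + S n ^ βinf) :=
      calc _ ≤ _ := (le_abs_self _).trans (hbx (x n) (y n) (p₁ n))
        _ = Cb * (‖x n - y n‖ ^ γ * ‖p₁ n‖ ^ β₀ + ‖x n - y n‖ ^ γ * ‖p₁ n‖ ^ βinf) := by ring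
        _ ≤ _ := by
          gcongr
          · exact hpow _ hβ₀ ((le_max_left _ _).trans hγ)
          · exact hpow _ hβinf ((le_max_right _ _).trans hγ)
    have h6 := (le_abs_self _).trans (hC (y n) (p₁ n) (p₂ n))
    rw [inner_sub_left] at h4
    rw [inner_sub_right]
    linarith
  have hrpow : ∀ (s : ℕ → ℝ) (β : ℝ), β ∈ Ioo (0 : ℝ) 1 → Tendsto s atTop (𝓝 0) →
      Tendsto (fun n => s n ^ β) atTop (𝓝 0) := fun s β hβ hs => by
    simpa [Real.zero_rpow hβ.1.ne'] using hs.rpow_const (.inr hβ.1.le)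
  have hpn : Tendsto (fun n => ‖p₁ n - p₂ n‖) atTop (𝓝 0) := by simpa using hp.norm
  have hT : Tendsto (fun n => Lam * (4 * δ n * N) + Kh * S n + ⟪h (y n), p₁ n - p₂ n⟫ +
      Cb * (S n ^ β₀ + S n ^ βinf) + C * (‖p₁ n - p₂ n‖ ^ β₀ + ‖p₁ n - p₂ n‖ ^ βinf)) atTop
      (𝓝 0) := by
    simpa using (((((hδ.const_mul 4).mul_const (N : ℝ)).const_mul Lam).add
      (hS.const_mul (Kh : ℝ))).add (((hh.continuous.tendsto a).comp hya).inner hp)).add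
      (((hrpow S β₀ hβ₀ hS).add (hrpow S βinf hβinf hS)).const_mul Cb) |>.add
      (((hrpow _ β₀ hβ₀ hpn).add (hrpow _ βinf hβinf hpn)).const_mul C)
  obtain ⟨c, huc, hcv⟩ := exists_between (show u a < v a by linarith)
  obtain ⟨d, hcd, hdv⟩ := exists_between hcv
  have hj : Monotone j := hcase.elim StrictMono.monotone And.left
  have hvd : ∀ᶠ n in atTop, d ≤ v (x n) :=
    (((hv a haK).tendsto.comp (tendsto_nhdsWithin_iff.2 ⟨hxa, .of_forall hxK⟩))).eventually_const_le
      hdv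
  have huc' : ∀ᶠ n in atTop, u (y n) ≤ c :=
    (((hu a haK).tendsto.comp (tendsto_nhdsWithin_iff.2 ⟨hya, .of_forall hyK⟩))).eventually_le_const
      huc
  have hgx : Tendsto (fun n => g (x n)) atTop (𝓝 (g a)) :=
    (hg.continuousAt (hΩo.mem_nhds haΩ)).tendsto.comp hxa
  have hfy : Tendsto (fun n => f (y n)) atTop (𝓝 (f a)) :=
    (hf.continuousAt (hΩo.mem_nhds haΩ)).tendsto.comp hya
  have hlim : g a - f a + j d - j c ≤ 0 :=
    le_of_tendsto_of_tendsto (((hgx.sub hfy).add_const (j d)).sub_const (j c)) hT <| by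
      filter_upwards [hmain, hvd, huc'] with n hn hdn hcn
      linarith [hj hdn, hj hcn]
  rcases hcase with hj' | ⟨_, hfg'⟩
  · linarith [hj' hcd, hfg a haΩ]
  · linarith [hj hcd.le, hfg' a haΩ]
end
end

section
/- Let N ≥ 1, β ∈ (0,1), γ = (2−β)/(1−β) and C = γ^{−1}(γ + N − 2)^{1/(β−1)}. Then the function u : ℝ^N → ℝ defined by u(x) = C(1 − |x|^γ) is twice continuously differentiable, satisfies Δu(x) + |∇u(x)|^β = 0 at every point x of the open unit ball B₁ ⊂ ℝ^N, and u(x) = 0 for every x with |x| = 1. -/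
open Metric Set Real
open scoped RealInnerProductSpace

noncomputable section

section NormRpow

variable {E : Type*} [NormedAddCommGroup E] [InnerProductSpace ℝ E]

theorem hasFDerivAt_norm_rpow_smul (x : E) {q : ℝ} (hq : 0 < q) :
    HasFDerivAt (fun y : E => ‖y‖ ^ q • y)
      (‖x‖ ^ q • ContinuousLinearMap.id ℝ E +
        (q * ‖x‖ ^ (q - 2)) • (innerSL ℝ x).smulRight x) x := by
  by_cases hx : x = 0
  · subst hx
    refine .of_isLittleO ?_
    have h1 : (fun y : E => ‖y‖ ^ q) =o[nhds 0] (fun _ : E => (1 : ℝ)) := by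
      refine (Asymptotics.isLittleO_const_iff one_ne_zero).mpr ?_
      have : ContinuousAt (fun y : E => ‖y‖ ^ q) 0 :=
        continuousAt_id.norm.rpow_const (.inr hq.le)
      simpa [ContinuousAt, hq.ne'] using this
    simpa [hq.ne'] using h1.smul_isBigO (Asymptotics.isBigO_refl (fun y : E => y) (nhds 0))
  · have h1 : HasFDerivAt (fun y : E => ‖y‖ ^ q) ((q * ‖x‖ ^ (q - 2)) • innerSL ℝ x) x := by
      apply HasStrictFDerivAt.hasFDerivAt
      convert! (hasStrictFDerivAt_norm_sq x).rpow_const (p := q / 2) (by simp [hx]) using 0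
      simp_rw [← Real.rpow_natCast_mul (norm_nonneg _), ← Nat.cast_smul_eq_nsmul ℝ, smul_smul]
      ring_nf
    refine (h1.smul (hasFDerivAt_id x)).congr_fderiv ?_
    ext y
    simp [smul_smul]

theorem contDiff_norm_rpow_smul {q : ℝ} (hq : 0 < q) :
    ContDiff ℝ 1 (fun y : E => ‖y‖ ^ q • y) := by
  rw [contDiff_one_iff_hasFDerivAt]
  refine ⟨_, continuous_iff_continuousAt.mpr fun x => ?_,
    fun x => hasFDerivAt_norm_rpow_smul x hq⟩
  refine ContinuousAt.add ?_ ?_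
  · exact (continuousAt_id.norm.rpow_const (.inr hq.le)).smul continuousAt_const
  by_cases hx : x = 0
  · subst hx
    have h0 : Filter.Tendsto (fun y : E => q * ‖y‖ ^ q) (nhds 0) (nhds 0) := by
      have : ContinuousAt (fun y : E => q * ‖y‖ ^ q) 0 :=
        continuousAt_const.mul (continuousAt_id.norm.rpow_const (.inr hq.le))
      simpa [ContinuousAt, hq.ne'] using this
    have : Filter.Tendsto (fun y : E => (q * ‖y‖ ^ (q - 2)) • (innerSL ℝ y).smulRight y)
        (nhds 0) (nhds 0) := by
      refine squeeze_zero_norm (fun y => le_of_eq ?_) h0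
      rw [norm_smul, ContinuousLinearMap.norm_smulRight_apply, innerSL_apply_norm,
        Real.norm_of_nonneg (by positivity), mul_assoc]
      by_cases hy : y = 0
      · simp [hy, hq.ne']
      · have hy' : 0 < ‖y‖ := norm_pos_iff.mpr hy
        rw [← sq, ← Real.rpow_natCast, ← Real.rpow_add hy']
        norm_num
    simpa [ContinuousAt] using this
  · refine ContinuousAt.smul (f := fun y : E => q * ‖y‖ ^ (q - 2)) ?_ ?_
    · exact ContinuousAt.mul continuousAt_const (continuousAt_id.norm.rpow_const (.inl (by simpa using hx)))
    · exact (((ContinuousLinearMap.smulRightL ℝ E E).continuous.comp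
        (innerSL ℝ).continuous).clm_apply continuous_id).continuousAt

variable (c : ℝ) {p : ℝ}

theorem hasFDerivAt_const_mul_one_sub_norm_rpow (x : E) (hp : 1 < p) :
    HasFDerivAt (fun y : E => c * (1 - ‖y‖ ^ p))
      (innerSL ℝ (-(c * p) • ‖x‖ ^ (p - 2) • x)) x := by
  refine (((hasFDerivAt_norm_rpow x hp).const_sub 1).const_mul c).congr_fderiv ?_
  ext y
  simp
  ring

theorem contDiff_const_mul_one_sub_norm_rpow (hp : 2 < p) :
    ContDiff ℝ 2 (fun y : E => c * (1 - ‖y‖ ^ p)) := by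
  rw [show (2 : WithTop ℕ∞) = ((1 : ℕ) : WithTop ℕ∞) + 1 by norm_num]
  refine contDiff_succ_iff_hasFDerivAt.mpr
    ⟨_, ?_, fun x => hasFDerivAt_const_mul_one_sub_norm_rpow c x (by linarith)⟩
  have := (contDiff_norm_rpow_smul (E := E) (q := p - 2) (by linarith)).const_smul (-(c * p))
  exact (innerSL ℝ (E := E)).contDiff.comp this

theorem iteratedFDeriv_two_const_mul_one_sub_norm_rpow (hp : 2 < p) (x v w : E) :
    iteratedFDeriv ℝ 2 (fun y : E => c * (1 - ‖y‖ ^ p)) x ![v, w] =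
      -(c * p) * (‖x‖ ^ (p - 2) * ⟪v, w⟫ +
        (p - 2) * ‖x‖ ^ (p - 2 - 2) * (⟪x, v⟫ * ⟪x, w⟫)) := by
  have h1 : fderiv ℝ (fun y : E => c * (1 - ‖y‖ ^ p)) =
      fun x => innerSL ℝ (-(c * p) • ‖x‖ ^ (p - 2) • x) :=
    funext fun x => (hasFDerivAt_const_mul_one_sub_norm_rpow c x (by linarith)).fderiv
  have h2 := (innerSL ℝ (E := E)).hasFDerivAt.comp x
    ((hasFDerivAt_norm_rpow_smul x (q := p - 2) (by linarith)).const_smul (-(c * p)))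
  rw [iteratedFDeriv_two_apply, h1]
  erw [h2.fderiv]
  change ⟪-(c * p) • (‖x‖ ^ (p - 2) • v + ((p - 2) * ‖x‖ ^ (p - 2 - 2)) • ⟪x, v⟫ • x), w⟫ = _
  simp only [inner_smul_left, inner_add_left, conj_trivial]

theorem gradient_const_mul_one_sub_norm_rpow [CompleteSpace E] (hp : 1 < p) (x : E) :
    gradient (fun y : E => c * (1 - ‖y‖ ^ p)) x = -(c * p) • ‖x‖ ^ (p - 2) • x :=
  HasGradientAt.gradient (hasFDerivAt_const_mul_one_sub_norm_rpow c x hp)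

end NormRpow

theorem trace_hess_const_mul_one_sub_norm_rpow {N : ℕ} (c : ℝ) {p : ℝ} (hp : 2 < p) (x : Euc N) :
    Matrix.trace (hess (fun y : Euc N => c * (1 - ‖y‖ ^ p)) x) =
      -(c * p * (p + N - 2) * ‖x‖ ^ (p - 2)) := by
  have h : ‖x‖ ^ (p - 2 - 2) * ‖x‖ ^ 2 = ‖x‖ ^ (p - 2) := by
    rcases (norm_nonneg x).eq_or_lt with hx | hx
    · rw [← hx, Real.zero_rpow (by linarith : p - 2 ≠ 0)]
      simp
    · rw [← Real.rpow_natCast, ← Real.rpow_add hx]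
      norm_num
  simp only [Matrix.trace, Matrix.diag, hess, Matrix.of_apply,
    iteratedFDeriv_two_const_mul_one_sub_norm_rpow c hp]
  rw [← Finset.mul_sum, Finset.sum_add_distrib, ← Finset.mul_sum, ← Finset.mul_sum]
  simp only [EuclideanSpace.inner_single_right]
  have h2 : ∑ i, x i * x i = ‖x‖ ^ 2 := by
    simp [EuclideanSpace.real_norm_sq_eq, ← sq]
  simp [h2]
  linear_combination c * p * (p - 2) * h

/-- the explicit solution `u(x) = C (1 - |x|^γ)` of `Δu + |∇u|^β = 0` in `B₁`,
vanishing on the unit sphere. -/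
theorem explicit_solution
    (N : ℕ) (hN : 1 ≤ N) (β : ℝ) (hβ : β ∈ Ioo (0 : ℝ) 1) :
    ContDiff ℝ 2 (fun x : Euc N =>
      ((2 - β) / (1 - β))⁻¹ * (((2 - β) / (1 - β)) + (N : ℝ) - 2) ^ ((1 : ℝ) / (β - 1)) *
        (1 - ‖x‖ ^ ((2 - β) / (1 - β)))) ∧
    (∀ x ∈ ball (0 : Euc N) 1,
      Matrix.trace (hess (fun x : Euc N =>
        ((2 - β) / (1 - β))⁻¹ * (((2 - β) / (1 - β)) + (N : ℝ) - 2) ^ ((1 : ℝ) / (β - 1)) *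
          (1 - ‖x‖ ^ ((2 - β) / (1 - β)))) x) +
        ‖gradient (fun x : Euc N =>
          ((2 - β) / (1 - β))⁻¹ * (((2 - β) / (1 - β)) + (N : ℝ) - 2) ^ ((1 : ℝ) / (β - 1)) *
            (1 - ‖x‖ ^ ((2 - β) / (1 - β)))) x‖ ^ β = 0) ∧
    ∀ x : Euc N, ‖x‖ = 1 →
      ((2 - β) / (1 - β))⁻¹ * (((2 - β) / (1 - β)) + (N : ℝ) - 2) ^ ((1 : ℝ) / (β - 1)) *
        (1 - ‖x‖ ^ ((2 - β) / (1 - β))) = 0 := by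
  obtain ⟨hβ0, hβ1⟩ := hβ
  have h1β : 0 < 1 - β := by linarith
  have hp : 2 < (2 - β) / (1 - β) := by
    rw [lt_div_iff₀ h1β]
    linarith
  have hpβ : ((2 - β) / (1 - β) - 1) * β = (2 - β) / (1 - β) - 2 := by
    field_simp
    ring
  set p := (2 - β) / (1 - β)
  have hA : 0 < p + (N : ℝ) - 2 := by
    have : (0 : ℝ) ≤ N := N.cast_nonneg
    linarith
  set A := p + (N : ℝ) - 2 with hA_def
  refine ⟨contDiff_const_mul_one_sub_norm_rpow _ hp, fun x _ => ?_, fun x hx => by simp [hx]⟩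
  rw [trace_hess_const_mul_one_sub_norm_rpow _ hp,
    gradient_const_mul_one_sub_norm_rpow _ (by linarith), ← hA_def]
  have hcp : p⁻¹ * A ^ ((1 : ℝ) / (β - 1)) * p = A ^ ((1 : ℝ) / (β - 1)) := by
    field_simp
  have hnorm : ‖x‖ ^ (p - 2) * ‖x‖ = ‖x‖ ^ (p - 1) := by
    rw [← Real.rpow_add_one' (norm_nonneg x) (by linarith)]
    ring_nf
  have hpow : A ^ ((1 : ℝ) / (β - 1)) * A = (A ^ ((1 : ℝ) / (β - 1))) ^ β := by
    rw [← Real.rpow_add_one hA.ne', ← Real.rpow_mul hA.le]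
    congr 1
    have : β - 1 ≠ 0 := by linarith
    field_simp
    ring
  rw [hcp, norm_smul, norm_smul, norm_neg, Real.norm_of_nonneg (by positivity),
    Real.norm_of_nonneg (by positivity), hnorm,
    Real.mul_rpow (by positivity) (by positivity), ← Real.rpow_mul (norm_nonneg x), hpβ, hpow]
  ring
end
end

section
/- Let F : S^N → ℝ be uniformly elliptic with constants 0 < λ ≤ Λ, let h be Lipschitz continuous on B₁, and let f be continuous and bounded on B₁. Let H : B₁ × ℝ^N → ℝ be such that H(·,0) is bounded on B₁ and there exist β₁, β₂ ∈ (0,1] and C > 0 with |H(x,q) − H(x,0)| ≤ C(|q|^{β₁} + |q|^{β₂}) for all x ∈ B₁ and q ∈ ℝ^N. Then there exists C₀ > 0, depending only on N, λ, Λ and Lip(h), such that if C < C₀, every bounded viscosity solution u of F(D²u) + h(x)·∇u + H(x,∇u) = f(x) in B₁ is Lipschitz continuous on B_r for each r < 1, with Lipschitz constant depending only on r, ‖u‖_∞, ‖f‖_∞, C₀, ‖H(·,0)‖_∞, ‖h‖_∞, Lip(h), N, λ, Λ. -/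
open Metric Set Real
open scoped RealInnerProductSpace

noncomputable section

section Alexandrov

variable {E : Type*} [NormedAddCommGroup E] [InnerProductSpace ℝ E]

/-- `p` is a subgradient of `G` at `x`. -/
def IsSubgrad (G : E → ℝ) (p x : E) : Prop := ∀ z, G x + ⟪p, z - x⟫ ≤ G z

/-- `J p` is the maximum point of the strongly concave function `x ↦ ⟪p, x⟫ - G x`. -/
def IsConjArgmax (G : E → ℝ) (J : E → E) : Prop :=
  ∀ p x, ⟪p, x⟫ - G x + ‖x - J p‖ ^ 2 / 2 ≤ ⟪p, J p⟫ - G (J p)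

/-- The Legendre transform of `G`, written with the help of its maximum points `J`. -/
def conjOf (G : E → ℝ) (J : E → E) (p : E) : ℝ := ⟪p, J p⟫ - G (J p)

lemma convex_of_subgrad {g : E → ℝ} (hg : ∀ x, ∃ p, IsSubgrad g p x) (x y : E) (t : ℝ)
    (ht0 : 0 ≤ t) (ht1 : t ≤ 1) : g (x + t • (y - x)) ≤ (1 - t) * g x + t * g y := by
  obtain ⟨p, hp⟩ := hg (x + t • (y - x))
  have h1 := hp x
  have h2 := hp y
  have e1 : ⟪p, x - (x + t • (y - x))⟫ = - t * ⟪p, y - x⟫ := by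
    rw [show x - (x + t • (y - x)) = (-t) • (y - x) by module, inner_smul_right]
  have e2 : ⟪p, y - (x + t • (y - x))⟫ = (1 - t) * ⟪p, y - x⟫ := by
    rw [show y - (x + t • (y - x)) = (1 - t) • (y - x) by module, inner_smul_right]
  rw [e1] at h1
  rw [e2] at h2
  nlinarith [mul_le_mul_of_nonneg_left h1 (sub_nonneg.2 ht1), mul_le_mul_of_nonneg_left h2 ht0]

lemma exists_conjArgmax [FiniteDimensional ℝ E] {g : E → ℝ} (hc : Continuous g)
    (hg : ∀ x, ∃ p, IsSubgrad g p x) :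
    ∃ J : E → E, IsConjArgmax (fun x => g x + ‖x‖ ^ 2 / 2) J := by
  have key : ∀ p : E, ∃ y : E, ∀ x, ⟪p, x⟫ - (g x + ‖x‖ ^ 2 / 2) + ‖x - y‖ ^ 2 / 2
      ≤ ⟪p, y⟫ - (g y + ‖y‖ ^ 2 / 2) := by
    intro p
    obtain ⟨s, hs⟩ := hg 0
    have hcont : Continuous fun x => g x + ‖x‖ ^ 2 / 2 - ⟪p, x⟫ := by fun_prop
    have hlim : Filter.Tendsto (fun x => g x + ‖x‖ ^ 2 / 2 - ⟪p, x⟫) (Filter.cocompact E)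
        Filter.atTop := by
      have h1 : Filter.Tendsto (fun x : E => ‖x‖ + (g 0 - (‖s - p‖ + 1) ^ 2 / 2))
          (Filter.cocompact E) Filter.atTop :=
        Filter.tendsto_atTop_add_const_right _ _ (tendsto_norm_cocompact_atTop)
      refine Filter.tendsto_atTop_mono (fun x => ?_) h1
      have h2 := hs x
      have h3 : -(‖s - p‖ * ‖x‖) ≤ ⟪s - p, x⟫ := by
        have := abs_real_inner_le_norm (s - p) x
        exact (abs_le.1 this).1
      rw [inner_sub_left] at h3
      simp only [sub_zero] at h2
      nlinarith [sq_nonneg (‖x‖ - (‖s - p‖ + 1))]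
    obtain ⟨y, hy⟩ := hcont.exists_forall_le hlim
    refine ⟨y, fun x => ?_⟩
    have hsub : ∀ t : ℝ, 0 < t → t ≤ 1 →
        ⟪p - y, x - y⟫ - t * (‖x - y‖ ^ 2 / 2) ≤ g x - g y := by
      intro t ht0 ht1
      have h1 := hy (y + t • (x - y))
      have h2 := convex_of_subgrad hg y x t ht0.le ht1
      have h3 : ‖y + t • (x - y)‖ ^ 2
          = ‖y‖ ^ 2 + 2 * (t * ⟪y, x - y⟫) + t ^ 2 * ‖x - y‖ ^ 2 := by
        rw [norm_add_sq_real, inner_smul_right, norm_smul, mul_pow, Real.norm_eq_abs, sq_abs]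
      have h4 : ⟪p, y + t • (x - y)⟫ = ⟪p, y⟫ + t * ⟪p, x - y⟫ := by
        rw [inner_add_right, inner_smul_right]
      rw [inner_sub_left]
      simp only [h3, h4] at h1
      have h5 : t * (⟪p, x - y⟫ - ⟪y, x - y⟫ - t * (‖x - y‖ ^ 2 / 2)) ≤ t * (g x - g y) := by
        nlinarith
      exact le_of_mul_le_mul_left h5 ht0
    have hlim2 : ⟪p - y, x - y⟫ ≤ g x - g y := by
      by_contra! hcon
      set δ := ⟪p - y, x - y⟫ - (g x - g y) with hδ
      have hδ0 : 0 < δ := by linarith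
      set n := ‖x - y‖ ^ 2 / 2 with hn
      have hn0 : 0 ≤ n := by positivity
      have ht : 0 < δ / (δ + n + 1) := by positivity
      have ht1 : δ / (δ + n + 1) ≤ 1 := by
        rw [div_le_one (by positivity)]; linarith
      have h1 := hsub _ ht ht1
      have h2 : δ / (δ + n + 1) * n < δ := by
        rw [div_mul_eq_mul_div, div_lt_iff₀ (by positivity)]
        nlinarith
      linarith
    have h6 : ‖x - y‖ ^ 2 = ‖x‖ ^ 2 - 2 * ⟪x, y⟫ + ‖y‖ ^ 2 := norm_sub_sq_real x y
    rw [inner_sub_left, inner_sub_right, inner_sub_right, real_inner_self_eq_norm_sq] at hlim2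
    rw [real_inner_comm] at h6
    linarith
  choose J hJ using key
  exact ⟨J, fun p x => hJ p x⟩

variable {G : E → ℝ} {J : E → E}

lemma IsConjArgmax.isSubgrad (hJ : IsConjArgmax G J) (p : E) : IsSubgrad G p (J p) := by
  intro z
  have := hJ p z
  rw [inner_sub_right]
  nlinarith [sq_nonneg ‖z - J p‖]

lemma IsConjArgmax.eq_of_isSubgrad (hJ : IsConjArgmax G J) {p y : E} (h : IsSubgrad G p y) :
    J p = y := by
  have h1 := hJ p y
  have h2 := h (J p)
  rw [inner_sub_right] at h2
  have h3 : ‖y - J p‖ ^ 2 ≤ 0 := by linarith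
  have h4 : ‖y - J p‖ = 0 := by
    have := sq_nonneg ‖y - J p‖
    exact pow_eq_zero_iff (two_ne_zero) |>.1 (le_antisymm h3 this)
  exact (sub_eq_zero.1 (norm_eq_zero.1 h4)).symm

lemma IsConjArgmax.norm_sub_le (hJ : IsConjArgmax G J) (p q : E) :
    ‖J p - J q‖ ≤ ‖p - q‖ := by
  have h1 := hJ p (J q)
  have h2 := hJ q (J p)
  have h3 : ‖J p - J q‖ ^ 2 ≤ ⟪p - q, J p - J q⟫ := by
    rw [norm_sub_rev (J q)] at h1
    rw [inner_sub_left, inner_sub_right, inner_sub_right]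
    linarith
  have h4 := real_inner_le_norm (p - q) (J p - J q)
  by_contra! hcon
  have h5 : 0 < ‖J p - J q‖ := lt_of_le_of_lt (norm_nonneg _) hcon
  nlinarith

lemma IsConjArgmax.lipschitzWith (hJ : IsConjArgmax G J) : LipschitzWith 1 J :=
  LipschitzWith.of_dist_le_mul fun p q => by
    simpa [dist_eq_norm] using hJ.norm_sub_le p q

lemma IsConjArgmax.conjOf_lower (hJ : IsConjArgmax G J) (p q : E) :
    conjOf G J p + ⟪J p, q - p⟫ ≤ conjOf G J q := by
  have h1 := hJ q (J p)
  unfold conjOf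
  rw [inner_sub_right, real_inner_comm q, real_inner_comm p]
  nlinarith [sq_nonneg ‖J p - J q‖]

lemma IsConjArgmax.hasFDerivAt_conjOf (hJ : IsConjArgmax G J) (p : E) :
    HasFDerivAt (conjOf G J) (innerSL ℝ (J p)) p := by
  have key : ∀ q, ‖conjOf G J q - conjOf G J p - ⟪J p, q - p⟫‖ ≤ ‖q - p‖ ^ 2 := by
    intro q
    have h1 := hJ.conjOf_lower p q
    have h2 := hJ.conjOf_lower q p
    have h3 : ⟪J q, p - q⟫ = - ⟪J q - J p, q - p⟫ - ⟪J p, q - p⟫ := by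
      rw [← neg_sub q p, inner_neg_right, inner_sub_left]; ring
    have h4 := real_inner_le_norm (J q - J p) (q - p)
    have h5 := hJ.norm_sub_le q p
    have h6 := mul_le_mul_of_nonneg_right h5 (norm_nonneg (q - p))
    rw [Real.norm_eq_abs, abs_le]
    constructor <;> nlinarith [sq_nonneg ‖q - p‖]
  rw [hasFDerivAt_iff_isLittleO]
  have h7 : (fun q => conjOf G J q - conjOf G J p - (innerSL ℝ (J p)) (q - p))
      =O[nhds p] fun q => ‖q - p‖ ^ 2 := by
    refine Asymptotics.IsBigO.of_bound 1 (Filter.Eventually.of_forall fun q => ?_)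
    simpa using key q
  refine h7.trans_isLittleO ?_
  have h8 : Filter.Tendsto (fun q : E => ‖q - p‖) (nhds p) (nhds 0) := by
    have : Continuous fun q : E => ‖q - p‖ := by fun_prop
    simpa using this.tendsto p
  rw [← Asymptotics.isLittleO_norm_right]
  have h9 : (fun q : E => ‖q - p‖) =o[nhds p] (fun _ => (1 : ℝ)) :=
    (Asymptotics.isLittleO_one_iff ℝ).2 h8
  simpa [sq] using h9.mul_isBigO (Asymptotics.isBigO_refl (fun q : E => ‖q - p‖) (nhds p))

lemma IsConjArgmax.symmetric_of_hasFDerivAt (hJ : IsConjArgmax G J) {p₀ : E} {A : E →L[ℝ] E}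
    (hA : HasFDerivAt J A p₀) (v w : E) : ⟪A v, w⟫ = ⟪v, A w⟫ := by
  have h1 : HasFDerivAt (fun p => innerSL ℝ (J p)) ((innerSL ℝ).comp A) p₀ :=
    (innerSL ℝ (E := E)).hasFDerivAt.comp p₀ hA
  have h2 := second_derivative_symmetric_of_eventually
    (Filter.Eventually.of_forall fun p => hJ.hasFDerivAt_conjOf p) h1 v w
  simpa [real_inner_comm] using h2

lemma IsConjArgmax.conjOf_taylor (hJ : IsConjArgmax G J) {p₀ : E} {A : E →L[ℝ] E}
    (hA : HasFDerivAt J A p₀) {η : ℝ} (hη : 0 < η) :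
    ∀ᶠ p in nhds p₀, |conjOf G J p - conjOf G J p₀ - ⟪J p₀, p - p₀⟫
      - ⟪A (p - p₀), p - p₀⟫ / 2| ≤ η * ‖p - p₀‖ ^ 2 := by
  have hsym := hJ.symmetric_of_hasFDerivAt hA
  have h1 := (hasFDerivAt_iff_isLittleO.1 hA).def hη
  obtain ⟨ρ, hρ, hball⟩ := Metric.eventually_nhds_iff_ball.1 h1
  refine Metric.eventually_nhds_iff_ball.2 ⟨ρ, hρ, fun p hp => ?_⟩
  set R : E → ℝ := fun p => conjOf G J p - ⟪J p₀, p - p₀⟫ - 1 / 2 * ⟪A (p - p₀), p - p₀⟫ with hR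
  have hder : ∀ q : E, HasFDerivAt R (innerSL ℝ (J q - J p₀ - A (q - p₀))) q := by
    intro q
    have d0 : HasFDerivAt (fun q : E => q - p₀) (ContinuousLinearMap.id ℝ E) q :=
      (hasFDerivAt_id q).sub_const p₀
    have d1 : HasFDerivAt (fun q : E => A (q - p₀)) A q := by
      have := A.hasFDerivAt.comp q d0
      rwa [ContinuousLinearMap.comp_id] at this
    have d2 := d1.inner ℝ d0
    have d3 := (innerSL ℝ (J p₀)).hasFDerivAt.comp q d0
    have d4 := ((hJ.hasFDerivAt_conjOf q).sub d3).sub (d2.const_mul (1 / 2))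
    refine d4.congr_fderiv ?_
    ext v
    simp [fderivInnerCLM_apply, inner_sub_left, inner_sub_right]
    have e1 := hsym q v
    have e2 := hsym p₀ v
    have e3 := hsym v q
    have e4 := hsym v p₀
    simp only [real_inner_comm] at *
    linarith
  have hconv : Convex ℝ (closedBall p₀ ‖p - p₀‖) := convex_closedBall _ _
  have hb : ∀ q ∈ closedBall p₀ ‖p - p₀‖,
      ‖innerSL ℝ (J q - J p₀ - A (q - p₀))‖ ≤ η * ‖p - p₀‖ := by
    intro q hq
    rw [innerSL_apply_norm]
    rw [mem_closedBall, dist_eq_norm] at hq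
    have hq' : q ∈ ball p₀ ρ := by
      rw [mem_ball, dist_eq_norm] at hp ⊢
      linarith
    exact (hball q hq').trans (mul_le_mul_of_nonneg_left hq hη.le)
  have h2 := hconv.norm_image_sub_le_of_norm_hasFDerivWithin_le
    (fun q _ => (hder q).hasFDerivWithinAt) hb
    (mem_closedBall_self (norm_nonneg _)) (show p ∈ closedBall p₀ ‖p - p₀‖ by
      simp [mem_closedBall, dist_eq_norm])
  have h3 : R p - R p₀ = conjOf G J p - conjOf G J p₀ - ⟪J p₀, p - p₀⟫
      - ⟪A (p - p₀), p - p₀⟫ / 2 := by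
    simp [hR]; ring
  rw [h3, Real.norm_eq_abs] at h2
  calc _ ≤ _ := h2
    _ = _ := by ring

/-- A function homogeneous of degree two which is at most `o(‖v‖ ^ 2)` at zero is nonpositive. -/
lemma nonpos_of_eventually_le {V : Type*} [NormedAddCommGroup V] [NormedSpace ℝ V] {q : V → ℝ}
    (hq : ∀ (t : ℝ) v, q (t • v) = t ^ 2 * q v)
    (h : ∀ η > 0, ∀ᶠ v in nhds 0, q v ≤ η * ‖v‖ ^ 2) (v : V) : q v ≤ 0 := by
  have key : ∀ η > 0, q v ≤ η * ‖v‖ ^ 2 := by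
    intro η hη
    have h1 : Filter.Tendsto (fun t : ℝ => t • v) (nhds 0) (nhds 0) := by
      have : Continuous fun t : ℝ => t • v := by fun_prop
      simpa using this.tendsto 0
    have h2 := h1.eventually (h η hη)
    obtain ⟨ρ, hρ, hb⟩ := Metric.eventually_nhds_iff_ball.1 h2
    have h3 := hb (ρ / 2) (by simp [abs_of_pos hρ]; linarith)
    rw [hq, norm_smul, mul_pow, Real.norm_eq_abs, sq_abs] at h3
    have h4 : 0 < (ρ / 2) ^ 2 := by positivity
    refine le_of_mul_le_mul_left ?_ h4
    linarith
  by_contra! hcon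
  have h5 := key (q v / (2 * (‖v‖ ^ 2 + 1))) (by positivity)
  rw [div_mul_eq_mul_div, le_div_iff₀ (by positivity)] at h5
  nlinarith [mul_nonneg hcon.le (sq_nonneg ‖v‖)]

lemma dist_subgrad_le {M : ℝ} (hM : 0 < M) {p₀ y : E}
    (hcontact : ∀ z, G z ≤ G y + ⟪p₀, z - y⟫ + M * ‖z - y‖ ^ 2) {p z : E}
    (hp : IsSubgrad G p z) (hy : IsSubgrad G p₀ y) : ‖p - p₀‖ ≤ 4 * M * ‖z - y‖ := by
  set τ := 1 / (4 * M) with hτ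
  have hτ0 : 0 < τ := by positivity
  have hτM : M * τ = 1 / 4 := by rw [hτ]; field_simp
  have h1 := hp (z + τ • (p - p₀))
  have h2 := hcontact (z + τ • (p - p₀))
  have h3 := hy z
  have e1 : ⟪p, z + τ • (p - p₀) - z⟫ - ⟪p₀, τ • (p - p₀)⟫ = τ * ‖p - p₀‖ ^ 2 := by
    rw [add_sub_cancel_left, ← inner_sub_left, inner_smul_right, real_inner_self_eq_norm_sq]
  have e2 : z + τ • (p - p₀) - y = (z - y) + τ • (p - p₀) := by abel
  have e3 : ⟪p₀, z + τ • (p - p₀) - y⟫ = ⟪p₀, z - y⟫ + ⟪p₀, τ • (p - p₀)⟫ := by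
    rw [e2, inner_add_right]
  have e4 : ‖z + τ • (p - p₀) - y‖ ≤ ‖z - y‖ + τ * ‖p - p₀‖ := by
    rw [e2]
    refine (norm_add_le _ _).trans ?_
    rw [norm_smul, Real.norm_eq_abs, abs_of_pos hτ0]
  have e5 : ‖z + τ • (p - p₀) - y‖ ^ 2 ≤ 2 * ‖z - y‖ ^ 2 + 2 * (τ * ‖p - p₀‖) ^ 2 := by
    have := pow_le_pow_left₀ (norm_nonneg _) e4 2
    nlinarith [sq_nonneg (‖z - y‖ - τ * ‖p - p₀‖)]
  have e6 := mul_le_mul_of_nonneg_left e5 hM.le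
  have e7 : M * (2 * (τ * ‖p - p₀‖) ^ 2) = τ * ‖p - p₀‖ ^ 2 / 2 := by
    calc _ = 2 * (M * τ) * (τ * ‖p - p₀‖ ^ 2) := by ring
      _ = _ := by rw [hτM]; ring
  have e8 : τ * ‖p - p₀‖ ^ 2 ≤ 4 * M * ‖z - y‖ ^ 2 := by
    rw [e3] at h2
    nlinarith
  have e9 : ‖p - p₀‖ ^ 2 ≤ (4 * M * ‖z - y‖) ^ 2 := by
    have := mul_le_mul_of_nonneg_left e8 (show 0 ≤ 4 * M by positivity)
    have e10 : 4 * M * (τ * ‖p - p₀‖ ^ 2) = ‖p - p₀‖ ^ 2 := by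
      calc _ = 4 * (M * τ) * ‖p - p₀‖ ^ 2 := by ring
        _ = _ := by rw [hτM]; ring
    rw [e10] at this
    calc _ ≤ _ := this
      _ = _ := by ring
  exact le_of_sq_le_sq e9 (by positivity)

/-- A convex function has a second order expansion at a point where it is touched from above by a
paraboloid and where the gradient of its Legendre transform is differentiable. -/
theorem IsConjArgmax.exists_taylor [FiniteDimensional ℝ E] (hJ : IsConjArgmax G J)
    (hG : ∀ x, ∃ p, IsSubgrad G p x) {M : ℝ} (hM : 0 < M) {p₀ : E}
    (hcontact : ∀ z, G z ≤ G (J p₀) + ⟪p₀, z - J p₀⟫ + M * ‖z - J p₀‖ ^ 2)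
    (hdiff : DifferentiableAt ℝ J p₀) :
    ∃ B : E →L[ℝ] E, (∀ v w, ⟪B v, w⟫ = ⟪v, B w⟫) ∧
      ∀ η > 0, ∀ᶠ v in nhds 0,
        |G (J p₀ + v) - G (J p₀) - ⟪p₀, v⟫ - ⟪B v, v⟫ / 2| ≤ η * ‖v‖ ^ 2 := by
  obtain ⟨A, hA⟩ := hdiff
  have hsym := hJ.symmetric_of_hasFDerivAt hA
  have hbound : ∀ p, ‖p - p₀‖ ≤ 4 * M * ‖J p - J p₀‖ := fun p =>
    dist_subgrad_le hM hcontact (hJ.isSubgrad p) (hJ.isSubgrad p₀)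
  have hinj : Function.Injective (A : E →ₗ[ℝ] E) := by
    rw [injective_iff_map_eq_zero]
    intro v hv
    have h1 := (hasFDerivAt_iff_isLittleO.1 hA).def (show 0 < 1 / (8 * M) by positivity)
    have h2 : Filter.Tendsto (fun t : ℝ => p₀ + t • v) (nhds 0) (nhds p₀) := by
      have : Continuous fun t : ℝ => p₀ + t • v := by fun_prop
      simpa using this.tendsto 0
    obtain ⟨ρ, hρ, hb⟩ := Metric.eventually_nhds_iff_ball.1 (h2.eventually h1)
    have h3 := hb (ρ / 2) (by simp [abs_of_pos hρ]; linarith)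
    have hv' : A v = 0 := hv
    rw [add_sub_cancel_left, map_smul, hv', smul_zero, sub_zero] at h3
    have h4 := hbound (p₀ + (ρ / 2) • v)
    rw [add_sub_cancel_left] at h4
    have h5 : 4 * M * ‖J (p₀ + (ρ / 2) • v) - J p₀‖ ≤ ‖(ρ / 2) • v‖ / 2 := by
      calc _ ≤ 4 * M * (1 / (8 * M) * ‖(ρ / 2) • v‖) := by gcongr
        _ = _ := by field_simp; ring
    have h6 : ‖(ρ / 2) • v‖ = 0 := le_antisymm (by linarith) (norm_nonneg _)
    rw [norm_eq_zero, smul_eq_zero] at h6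
    rcases h6 with h6 | h6
    · linarith
    · exact h6
  set e := LinearEquiv.ofInjectiveEndo (A : E →ₗ[ℝ] E) hinj with he
  set B : E →L[ℝ] E := LinearMap.toContinuousLinearMap (e.symm : E →ₗ[ℝ] E) with hB
  have hAB : ∀ v, A (B v) = v := fun v => e.apply_symm_apply v
  have hBsym : ∀ v w, ⟪B v, w⟫ = ⟪v, B w⟫ := by
    intro v w
    conv_lhs => rw [← hAB w]
    rw [← hsym, hAB]
  have hpos : ∀ v, 0 ≤ ⟪A v, v⟫ := by
    intro v
    have := nonpos_of_eventually_le (q := fun v => -(⟪A v, v⟫ / 2)) (fun t v => by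
      simp only [map_smul, inner_smul_left, inner_smul_right, conj_trivial]; ring) ?_ v
    · linarith
    intro η hη
    have h1 := hJ.conjOf_taylor hA hη
    have h2 : Filter.Tendsto (fun v : E => p₀ + v) (nhds 0) (nhds p₀) := by
      have : Continuous fun v : E => p₀ + v := by fun_prop
      simpa using this.tendsto 0
    filter_upwards [h2.eventually h1] with v hv
    rw [add_sub_cancel_left] at hv
    have h3 := hJ.conjOf_lower p₀ (p₀ + v)
    rw [add_sub_cancel_left] at h3
    have := (abs_le.1 hv).2
    linarith
  refine ⟨B, hBsym, fun η hη => ?_⟩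
  set κ := 16 * M ^ 2 + ‖B‖ ^ 2 + 1 with hκ
  have hκ0 : 0 < κ := by positivity
  obtain ⟨ρ, hρ, hb⟩ := Metric.eventually_nhds_iff_ball.1
    (hJ.conjOf_taylor hA (show 0 < η / κ by positivity))
  have hκM : η / κ * (16 * M ^ 2) ≤ η := by
    rw [div_mul_eq_mul_div, div_le_iff₀ hκ0]
    have : 0 ≤ ‖B‖ ^ 2 := by positivity
    nlinarith
  have hκB : η / κ * ‖B‖ ^ 2 ≤ η := by
    rw [div_mul_eq_mul_div, div_le_iff₀ hκ0]
    have : 0 ≤ M ^ 2 := by positivity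
    nlinarith
  refine Metric.eventually_nhds_iff_ball.2 ⟨ρ / (4 * M + ‖B‖ + 1), by positivity, fun v hv => ?_⟩
  rw [mem_ball_zero_iff, lt_div_iff₀ (by positivity)] at hv
  have hn := norm_nonneg v
  have hnB := mul_nonneg hn (norm_nonneg B)
  have hnM := mul_nonneg hn hM.le
  rw [abs_le]
  constructor
  · have h1 := hJ (p₀ + B v) (J p₀ + v)
    have hBv : ‖B v‖ ≤ ‖B‖ * ‖v‖ := B.le_opNorm v
    have h2 := hb (p₀ + B v) (by
      rw [mem_ball, dist_eq_norm, add_sub_cancel_left]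
      nlinarith)
    rw [add_sub_cancel_left, hAB] at h2
    have h3 := (abs_le.1 h2).2
    have h4 : η / κ * ‖B v‖ ^ 2 ≤ η * ‖v‖ ^ 2 := by
      calc _ ≤ η / κ * (‖B‖ * ‖v‖) ^ 2 := by gcongr
        _ = η / κ * ‖B‖ ^ 2 * ‖v‖ ^ 2 := by ring
        _ ≤ _ := by gcongr
    unfold conjOf at h3
    have h5 : ⟪v, B v⟫ = ⟪B v, v⟫ := real_inner_comm _ _
    have h6 : ⟪J p₀, B v⟫ = ⟪B v, J p₀⟫ := real_inner_comm _ _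
    have h7 : ⟪p₀ + B v, J p₀ + v⟫ = ⟪p₀, J p₀⟫ + ⟪B v, J p₀⟫ + ⟪p₀, v⟫ + ⟪B v, v⟫ := by
      rw [inner_add_left, inner_add_right, inner_add_right]; ring
    rw [h7] at h1
    have h8 := sq_nonneg ‖J p₀ + v - J (p₀ + B v)‖
    linarith
  · obtain ⟨p, hp⟩ := hG (J p₀ + v)
    have hJp := hJ.eq_of_isSubgrad hp
    have hdp := hbound p
    rw [hJp, add_sub_cancel_left] at hdp
    have h2 := hb p (by
      rw [mem_ball, dist_eq_norm]
      nlinarith)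
    have h3 := (abs_le.1 h2).1
    have h4 : η / κ * ‖p - p₀‖ ^ 2 ≤ η * ‖v‖ ^ 2 := by
      calc _ ≤ η / κ * (4 * M * ‖v‖) ^ 2 := by gcongr
        _ = η / κ * (16 * M ^ 2) * ‖v‖ ^ 2 := by ring
        _ ≤ _ := by gcongr
    have h5 := hpos (p - p₀ - B v)
    have h6 : ⟪A (p - p₀ - B v), p - p₀ - B v⟫
        = ⟪A (p - p₀), p - p₀⟫ - 2 * ⟪p - p₀, v⟫ + ⟪B v, v⟫ := by
      rw [map_sub, hAB, inner_sub_left, inner_sub_right (A (p - p₀)), hsym (p - p₀) (B v), hAB,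
        inner_sub_right v, real_inner_comm v (p - p₀), real_inner_comm v (B v)]
      ring
    unfold conjOf at h3
    rw [hJp] at h3
    have h7 : ⟪p, J p₀ + v⟫ = ⟪p₀, J p₀⟫ + ⟪J p₀, p - p₀⟫ + ⟪p₀, v⟫ + ⟪p - p₀, v⟫ := by
      rw [real_inner_comm (J p₀) (p - p₀) |>.symm, inner_add_right, inner_sub_left, inner_sub_left]
      ring
    rw [h7] at h3
    linarith

end Alexandrov

section Doubling

variable {E : Type*} [NormedAddCommGroup E] [InnerProductSpace ℝ E]

lemma exists_supConv [FiniteDimensional ℝ E] {a : E → ℝ} {R : ℝ} (hR : 0 < R)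
    (ha : ContinuousOn a (closedBall 0 R)) (l : ℝ) :
    ∃ (g : E → ℝ) (s : E → E), (∀ ξ, s ξ ∈ closedBall (0 : E) R) ∧
      (∀ ξ, g ξ = a (s ξ) - l / 2 * ‖s ξ - ξ‖ ^ 2) ∧
      ∀ ξ, ∀ x ∈ closedBall (0 : E) R, a x - l / 2 * ‖x - ξ‖ ^ 2 ≤ g ξ := by
  have : ProperSpace E := FiniteDimensional.proper ℝ E
  have key : ∀ ξ : E, ∃ x ∈ closedBall (0 : E) R,
      IsMaxOn (fun x => a x - l / 2 * ‖x - ξ‖ ^ 2) (closedBall 0 R) x := by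
    intro ξ
    refine (isCompact_closedBall (0 : E) R).exists_isMaxOn ⟨0, mem_closedBall_self hR.le⟩ ?_
    exact ha.sub (by fun_prop)
  choose s hs hmax using key
  exact ⟨fun ξ => a (s ξ) - l / 2 * ‖s ξ - ξ‖ ^ 2, s, hs, fun _ => rfl, fun ξ x hx => hmax ξ hx⟩

lemma supConv_isSubgrad {a g : E → ℝ} {s : E → E} {R l : ℝ}
    (hs : ∀ ξ, s ξ ∈ closedBall (0 : E) R)
    (hg : ∀ ξ, g ξ = a (s ξ) - l / 2 * ‖s ξ - ξ‖ ^ 2)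
    (hle : ∀ ξ, ∀ x ∈ closedBall (0 : E) R, a x - l / 2 * ‖x - ξ‖ ^ 2 ≤ g ξ) (ξ : E) :
    IsSubgrad (fun ξ => g ξ + l / 2 * ‖ξ‖ ^ 2) (l • s ξ) ξ := by
  intro z
  have h1 := hle z (s ξ) (hs ξ)
  rw [norm_sub_sq_real] at h1
  simp only [hg ξ, norm_sub_sq_real (s ξ) ξ, inner_smul_left, inner_sub_right, conj_trivial]
  linarith

lemma IsSubgrad.continuous {g : E → ℝ} {s : E → E} {R : ℝ} (hR : 0 ≤ R)
    (hs : ∀ ξ, ‖s ξ‖ ≤ R) (hg : ∀ ξ, IsSubgrad g (s ξ) ξ) : Continuous g := by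
  refine LipschitzWith.continuous (K := R.toNNReal) (LipschitzWith.of_le_add_mul _ fun x y => ?_)
  have h1 := hg x y
  have h2 := abs_real_inner_le_norm (s x) (y - x)
  have h3 := mul_le_mul_of_nonneg_right (hs x) (norm_nonneg (y - x))
  have h4 := (abs_le.1 h2).1
  rw [dist_comm, dist_eq_norm]
  rw [Real.coe_toNNReal R hR]
  linarith

lemma IsSubgrad.add_sq {g : E → ℝ} {p x : E} (h : IsSubgrad g p x) :
    IsSubgrad (fun x => g x + ‖x‖ ^ 2 / 2) (p + x) x := by
  intro z
  have h1 := h z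
  have h2 : ‖z‖ ^ 2 = ‖x‖ ^ 2 + 2 * ⟪x, z - x⟫ + ‖z - x‖ ^ 2 := by
    rw [← norm_add_sq_real, add_sub_cancel]
  simp only [h2, inner_add_left]
  nlinarith [sq_nonneg ‖z - x‖]

lemma IsSubgrad.eq_of_contact {G : E → ℝ} {p Q x : E} {M : ℝ} (hM : 0 < M)
    (hp : IsSubgrad G p x) (h : ∀ v, G (x + v) ≤ G x + ⟪Q, v⟫ + M * ‖v‖ ^ 2) : p = Q := by
  have h1 := hp (x + (1 / (2 * M)) • (p - Q))
  have h2 := h ((1 / (2 * M)) • (p - Q))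
  rw [add_sub_cancel_left] at h1
  have h3 : ⟪p, (1 / (2 * M)) • (p - Q)⟫ - ⟪Q, (1 / (2 * M)) • (p - Q)⟫
      = 1 / (2 * M) * ‖p - Q‖ ^ 2 := by
    rw [← inner_sub_left, inner_smul_right, real_inner_self_eq_norm_sq]
  have h4 : M * ‖(1 / (2 * M)) • (p - Q)‖ ^ 2 = 1 / (2 * M) * ‖p - Q‖ ^ 2 / 2 := by
    rw [norm_smul, mul_pow, Real.norm_eq_abs, sq_abs]
    field_simp
  have h5 : 1 / (2 * M) * ‖p - Q‖ ^ 2 ≤ 0 := by linarith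
  have h6 : ‖p - Q‖ ^ 2 ≤ 0 := by
    by_contra! hcon
    have : 0 < 1 / (2 * M) * ‖p - Q‖ ^ 2 := by positivity
    linarith
  have h7 : ‖p - Q‖ = 0 := pow_eq_zero_iff two_ne_zero |>.1 (le_antisymm h6 (sq_nonneg _))
  exact sub_eq_zero.1 (norm_eq_zero.1 h7)

/-- The Euclidean inner product of the product space `E × E`. -/
def prodInner (E : Type*) [NormedAddCommGroup E] [InnerProductSpace ℝ E] :
    (E × E) →L[ℝ] (E × E) →L[ℝ] ℝ :=
  (innerSL ℝ).bilinearComp (ContinuousLinearMap.fst ℝ E E) (ContinuousLinearMap.fst ℝ E E)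
    + (innerSL ℝ).bilinearComp (ContinuousLinearMap.snd ℝ E E) (ContinuousLinearMap.snd ℝ E E)

@[simp] lemma prodInner_apply (z w : E × E) :
    prodInner E z w = ⟪z.1, w.1⟫ + ⟪z.2, w.2⟫ := by
  simp [prodInner]

lemma abs_prodInner_le (z w : E × E) : |prodInner E z w| ≤ 2 * ‖z‖ * ‖w‖ := by
  rw [prodInner_apply]
  have h1 := abs_real_inner_le_norm z.1 w.1
  have h2 := abs_real_inner_le_norm z.2 w.2
  have h3 : ‖z.1‖ * ‖w.1‖ ≤ ‖z‖ * ‖w‖ :=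
    mul_le_mul (norm_fst_le z) (norm_fst_le w) (norm_nonneg _) (norm_nonneg _)
  have h4 : ‖z.2‖ * ‖w.2‖ ≤ ‖z‖ * ‖w‖ :=
    mul_le_mul (norm_snd_le z) (norm_snd_le w) (norm_nonneg _) (norm_nonneg _)
  have h5 := abs_add_le (⟪z.1, w.1⟫) (⟪z.2, w.2⟫)
  linarith

lemma sq_norm_le_prodInner (z : E × E) : ‖z‖ ^ 2 ≤ prodInner E z z := by
  rw [prodInner_apply, real_inner_self_eq_norm_sq, real_inner_self_eq_norm_sq, Prod.norm_def]
  rcases max_choice ‖z.1‖ ‖z.2‖ with h | h <;> rw [h] <;>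
    nlinarith [sq_nonneg ‖z.1‖, sq_nonneg ‖z.2‖]

/-- Every bilinear form on `E × E` is represented by a linear map with respect to `prodInner`. -/
lemma exists_prodInner_eq [FiniteDimensional ℝ E] (m : (E × E) →L[ℝ] (E × E) →L[ℝ] ℝ) :
    ∃ L : (E × E) →L[ℝ] (E × E), ∀ z w, prodInner E (L z) w = m z w := by
  let L₀ : (E × E) →ₗ[ℝ] (E × E) :=
    { toFun := fun z =>
        ((InnerProductSpace.toDual ℝ E).symm ((m z).comp (ContinuousLinearMap.inl ℝ E E)),
          (InnerProductSpace.toDual ℝ E).symm ((m z).comp (ContinuousLinearMap.inr ℝ E E)))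
      map_add' := fun z w => by simp [ContinuousLinearMap.add_comp]
      map_smul' := fun c z => by simp [ContinuousLinearMap.smul_comp] }
  refine ⟨LinearMap.toContinuousLinearMap L₀, fun z w => ?_⟩
  have : m z w = m z (w.1, 0) + m z (0, w.2) := by
    rw [← map_add]; simp
  simp [L₀, this]

lemma bilin_add_self {V : Type*} [NormedAddCommGroup V] [NormedSpace ℝ V]
    (m : V →L[ℝ] V →L[ℝ] ℝ) (hm : ∀ z w, m z w = m w z) (z w : V) :
    m (z + w) (z + w) = m z z + 2 * m z w + m w w := by
  simp only [map_add, add_apply]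
  rw [hm w z]; ring

lemma exists_bilin_bound {V : Type*} [NormedAddCommGroup V] [NormedSpace ℝ V]
    (m : V →L[ℝ] V →L[ℝ] ℝ) : ∃ c : ℝ, 0 ≤ c ∧ ∀ z w, |m z w| ≤ c * ‖z‖ * ‖w‖ :=
  ⟨‖m‖, m.opNorm_nonneg, fun z w => by simpa using m.le_opNorm₂ z w⟩

lemma exists_perturbed_max [FiniteDimensional ℝ E] {D : E × E → ℝ} (hD : Continuous D) {c : ℝ}
    (hc : 0 < c) (hD0 : 0 ≤ D 0) (hDle : ∀ z, D z ≤ -(c * ‖z‖ ^ 2)) {P : E × E}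
    (hP : 2 * ‖P‖ < c) :
    ∃ z : E × E, c * ‖z‖ ≤ 2 * ‖P‖ ∧ ∀ w, D w - prodInner E P w ≤ D z - prodInner E P z := by
  have : ProperSpace (E × E) := FiniteDimensional.proper ℝ (E × E)
  have hcont : Continuous fun z => D z - prodInner E P z := by fun_prop
  obtain ⟨z, hz, hmax⟩ := (isCompact_closedBall (0 : E × E) 1).exists_isMaxOn
    ⟨0, mem_closedBall_self zero_le_one⟩ hcont.continuousOn
  have h0 : 0 ≤ D z - prodInner E P z := by
    have := hmax (mem_closedBall_self (x := (0 : E × E)) zero_le_one)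
    simp only [mem_ofPred_eq, map_zero, sub_zero] at this
    linarith
  refine ⟨z, ?_, fun w => ?_⟩
  · have h1 := hDle z
    have h2 := (abs_le.1 (abs_prodInner_le P z)).1
    rcases eq_or_lt_of_le (norm_nonneg z) with h | h
    · rw [← h]; have := norm_nonneg P; linarith
    · refine le_of_mul_le_mul_right ?_ h
      nlinarith
  · by_cases hw : ‖w‖ ≤ 1
    · exact hmax (by simpa using hw)
    · push Not at hw
      have h1 := hDle w
      have h2 := (abs_le.1 (abs_prodInner_le P w)).1
      have h3 : 2 * ‖P‖ * ‖w‖ ≤ c * ‖w‖ ^ 2 := by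
        have := mul_le_mul_of_nonneg_right hP.le (norm_nonneg w)
        nlinarith [mul_nonneg hc.le (norm_nonneg w)]
      linarith

open MeasureTheory in
/-- A property which holds at all preimages, under a Lipschitz map, of points of a ball holds
simultaneously with differentiability of another Lipschitz map. -/
lemma exists_differentiableAt_of_ball_subset_image {W : Type*} [NormedAddCommGroup W]
    [NormedSpace ℝ W] [FiniteDimensional ℝ W] {T J : W → W} {K K' : NNReal}
    (hT : LipschitzWith K T) (hJ : LipschitzWith K' J) {S : Set W} {δ : ℝ} (hδ : 0 < δ)
    (hS : ball 0 δ ⊆ T '' S) : ∃ Q ∈ S, DifferentiableAt ℝ J Q := by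
  let : MeasurableSpace W := borel W
  have : BorelSpace W := ⟨rfl⟩
  set ν : Measure W := Measure.hausdorffMeasure (Module.finrank ℝ W) with hν
  have : ν.IsAddHaarMeasure := isAddHaarMeasure_hausdorffMeasure
  by_contra! hcon
  have h1 : ν S = 0 :=
    measure_mono_null (fun Q hQ => hcon Q hQ) (ae_iff.1 (hJ.ae_differentiableAt (μ := ν)))
  have h2 : ν (T '' S) = 0 := by
    have := hT.hausdorffMeasure_image_le (d := (Module.finrank ℝ W : ℝ)) (Nat.cast_nonneg _) S
    rw [← hν, h1, mul_zero] at this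
    exact le_antisymm this zero_le
  exact (measure_ball_pos ν 0 hδ).ne' (measure_mono_null hS h2)

lemma exists_contact_differentiable [FiniteDimensional ℝ E] {G₁ G₂ : E → ℝ} {J₁ J₂ : E → E}
    (hc₁ : Continuous G₁) (hc₂ : Continuous G₂)
    (hJ₁ : IsConjArgmax G₁ J₁) (hJ₂ : IsConjArgmax G₂ J₂)
    (hG₁ : ∀ x, ∃ p, IsSubgrad G₁ p x) (hG₂ : ∀ x, ∃ p, IsSubgrad G₂ p x)
    {m : (E × E) →L[ℝ] (E × E) →L[ℝ] ℝ} (hm : ∀ z w, m z w = m w z) {c : ℝ} (hc : 0 < c)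
    (h0 : 0 ≤ G₁ 0 + G₂ 0)
    (hle : ∀ z : E × E, G₁ z.1 + G₂ z.2 - m z z ≤ -(c * ‖z‖ ^ 2)) {δ : ℝ} (hδ : 0 < δ) :
    ∃ Q₁ Q₂ : E, ‖Q₁‖ < δ ∧ ‖Q₂‖ < δ ∧ ‖J₁ Q₁‖ < δ ∧ ‖J₂ Q₂‖ < δ ∧
      DifferentiableAt ℝ J₁ Q₁ ∧ DifferentiableAt ℝ J₂ Q₂ ∧
      ∀ v w, G₁ (J₁ Q₁ + v) + G₂ (J₂ Q₂ + w)
        ≤ G₁ (J₁ Q₁) + G₂ (J₂ Q₂) + ⟪Q₁, v⟫ + ⟪Q₂, w⟫ + m (v, w) (v, w) := by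
  obtain ⟨L, hL⟩ := exists_prodInner_eq ((2 : ℝ) • m)
  have hJ : LipschitzWith (max 1 1) fun Q : E × E => (J₁ Q.1, J₂ Q.2) := by
    have e1 := hJ₁.lipschitzWith.comp (LipschitzWith.prod_fst (α := E) (β := E))
    have e2 := hJ₂.lipschitzWith.comp (LipschitzWith.prod_snd (α := E) (β := E))
    simpa using e1.prodMk e2
  have hT : LipschitzWith (1 + ‖L‖₊ * max 1 1)
      fun Q : E × E => Q - L (J₁ Q.1, J₂ Q.2) :=
    LipschitzWith.id.sub (L.lipschitz.comp hJ)
  obtain ⟨cm, hcm0, hcm⟩ := exists_bilin_bound m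
  set ρ := min (c / 4) (min (δ * c / 4) (δ / (2 * (1 + 2 * ‖L‖ / c)))) with hρ
  have hρ0 : 0 < ρ := by positivity
  have hρ1 : ρ ≤ c / 4 := min_le_left _ _
  have hρ2 : ρ ≤ δ * c / 4 := (min_le_right _ _).trans (min_le_left _ _)
  have hρ3 : ρ ≤ δ / (2 * (1 + 2 * ‖L‖ / c)) := (min_le_right _ _).trans (min_le_right _ _)
  set S : Set (E × E) := {Q | ‖Q‖ < δ ∧ ‖J₁ Q.1‖ < δ ∧ ‖J₂ Q.2‖ < δ ∧
    ∀ v w, G₁ (J₁ Q.1 + v) + G₂ (J₂ Q.2 + w)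
        ≤ G₁ (J₁ Q.1) + G₂ (J₂ Q.2) + ⟪Q.1, v⟫ + ⟪Q.2, w⟫ + m (v, w) (v, w)} with hS
  have hsub : ball 0 ρ ⊆ (fun Q : E × E => Q - L (J₁ Q.1, J₂ Q.2)) '' S := by
    intro P hP
    rw [mem_ball_zero_iff] at hP
    obtain ⟨z, hz, hmax⟩ := exists_perturbed_max (D := fun z => G₁ z.1 + G₂ z.2 - m z z)
      (by fun_prop) hc (by simpa using h0) hle (P := P) (by linarith)
    have hcontact : ∀ v w, G₁ (z.1 + v) + G₂ (z.2 + w)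
        ≤ G₁ z.1 + G₂ z.2 + ⟪(P + L z).1, v⟫ + ⟪(P + L z).2, w⟫ + m (v, w) (v, w) := by
      intro v w
      have e1 := hmax (z + (v, w))
      rw [bilin_add_self m hm, map_add] at e1
      have e2 := hL z (v, w)
      simp only [prodInner_apply, smul_apply, smul_eq_mul, Prod.fst_add,
        Prod.snd_add, inner_add_left] at *
      linarith
    have hM : 0 < cm + 1 := by positivity
    have hz1 : J₁ (P + L z).1 = z.1 := by
      obtain ⟨p, hp⟩ := hG₁ z.1
      have := hp.eq_of_contact hM (Q := (P + L z).1) fun v => by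
        have e1 := hcontact v 0
        have e2 := (abs_le.1 (hcm (v, 0) (v, 0))).2
        simp only [Prod.norm_mk, norm_zero, max_eq_left (norm_nonneg v)] at e2
        simp only [add_zero, inner_zero_right] at e1
        nlinarith [sq_nonneg ‖v‖]
      rw [← this]
      exact hJ₁.eq_of_isSubgrad hp
    have hz2 : J₂ (P + L z).2 = z.2 := by
      obtain ⟨p, hp⟩ := hG₂ z.2
      have := hp.eq_of_contact hM (Q := (P + L z).2) fun v => by
        have e1 := hcontact 0 v
        have e2 := (abs_le.1 (hcm (0, v) (0, v))).2
        simp only [Prod.norm_mk, norm_zero, max_eq_right (norm_nonneg v)] at e2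
        simp only [add_zero, inner_zero_right] at e1
        nlinarith [sq_nonneg ‖v‖]
      rw [← this]
      exact hJ₂.eq_of_isSubgrad hp
    have hzn : ‖z‖ ≤ 2 * ‖P‖ / c := by rw [le_div_iff₀ hc]; linarith
    have hzδ : ‖z‖ < δ := by
      refine hzn.trans_lt ?_
      rw [div_lt_iff₀ hc]
      nlinarith [mul_pos hδ hc]
    have hQn : ‖P + L z‖ < δ := by
      have hb : 0 ≤ 2 * ‖L‖ / c := by positivity
      calc ‖P + L z‖ ≤ ‖P‖ + ‖L‖ * ‖z‖ := (norm_add_le _ _).trans (by gcongr; exact L.le_opNorm z)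
        _ ≤ ‖P‖ + ‖L‖ * (2 * ‖P‖ / c) := by gcongr
        _ = ‖P‖ * (1 + 2 * ‖L‖ / c) := by ring
        _ ≤ δ / (2 * (1 + 2 * ‖L‖ / c)) * (1 + 2 * ‖L‖ / c) := by
            gcongr; exact hP.le.trans hρ3
        _ = δ / 2 := by field_simp
        _ < δ := by linarith
    refine ⟨P + L z, ⟨hQn, ?_, ?_, ?_⟩, ?_⟩
    · rw [hz1]; exact (norm_fst_le z).trans_lt hzδ
    · rw [hz2]; exact (norm_snd_le z).trans_lt hzδ
    · rw [hz1, hz2]; exact hcontact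
    · simp only [hz1, hz2, Prod.mk.eta, add_sub_cancel_right]
  obtain ⟨Q, ⟨hQ1, hQ2, hQ3, hQ4⟩, hd⟩ :=
    exists_differentiableAt_of_ball_subset_image hT hJ hρ0 hsub
  refine ⟨Q.1, Q.2, (norm_fst_le Q).trans_lt hQ1, (norm_snd_le Q).trans_lt hQ1, hQ2, hQ3, ?_, ?_,
    hQ4⟩
  · have e1 : DifferentiableAt ℝ (fun x : E => (x, Q.2)) Q.1 := by fun_prop
    exact (DifferentiableAt.comp (g := fun Q : E × E => (J₁ Q.1, J₂ Q.2)) Q.1 hd e1).fst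
  · have e1 : DifferentiableAt ℝ (fun x : E => (Q.1, x)) Q.2 := by fun_prop
    exact (DifferentiableAt.comp (g := fun Q : E × E => (J₁ Q.1, J₂ Q.2)) Q.2 hd e1).snd

/-- `(p, X)` is a second order superjet of `a` at `x`. -/
def IsSuperjet (a : E → ℝ) (x p : E) (X : E →L[ℝ] E) : Prop :=
  (∀ v w, ⟪X v, w⟫ = ⟪v, X w⟫) ∧
    ∀ η > 0, ∀ᶠ v in nhds 0, a (x + v) ≤ a x + ⟪p, v⟫ + ⟪X v, v⟫ / 2 + η * ‖v‖ ^ 2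

lemma bilin_le_add_sq (q : (E × E) →L[ℝ] (E × E) →L[ℝ] ℝ) (hq : ∀ z w, q z w = q w z)
    {c : ℝ} (hc0 : 0 ≤ c) (hc : ∀ z w, |q z w| ≤ c * ‖z‖ * ‖w‖)
    {μ l : ℝ} (hμ : 0 < μ) (hl : 2 * (2 * c ^ 2 / μ + c) ≤ l) (z w : E × E) :
    q z z ≤ q w w + μ / 2 * prodInner E w w + l / 2 * prodInner E (z - w) (z - w) := by
  have h1 := bilin_add_self q hq w (z - w)
  rw [add_sub_cancel] at h1
  have h2 := (abs_le.1 (hc w (z - w))).2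
  have h3 := (abs_le.1 (hc (z - w) (z - w))).2
  have h4 := sq_norm_le_prodInner w
  have h5 := sq_norm_le_prodInner (z - w)
  have h6 : 2 * (c * ‖w‖ * ‖z - w‖) ≤ μ / 2 * ‖w‖ ^ 2 + 2 * c ^ 2 / μ * ‖z - w‖ ^ 2 := by
    have : μ / 2 * ‖w‖ ^ 2 + 2 * c ^ 2 / μ * ‖z - w‖ ^ 2 - 2 * (c * ‖w‖ * ‖z - w‖)
        = (μ * ‖w‖ - 2 * c * ‖z - w‖) ^ 2 / (2 * μ) := by field_simp; ring
    have h7 : 0 ≤ (μ * ‖w‖ - 2 * c * ‖z - w‖) ^ 2 / (2 * μ) := by positivity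
    linarith
  have h8 : μ / 2 * ‖w‖ ^ 2 ≤ μ / 2 * prodInner E w w := by gcongr
  have hl0 : 0 ≤ l := le_trans (by positivity) hl
  have h9 : l / 2 * ‖z - w‖ ^ 2 ≤ l / 2 * prodInner E (z - w) (z - w) := by gcongr
  have h10 : (2 * c ^ 2 / μ + c) * ‖z - w‖ ^ 2 ≤ l / 2 * ‖z - w‖ ^ 2 := by
    gcongr; linarith
  linarith

lemma superjet_of_supConv {a g : E → ℝ} {s : E → E} {R l : ℝ}
    (hg : ∀ ξ, g ξ = a (s ξ) - l / 2 * ‖s ξ - ξ‖ ^ 2)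
    (hle : ∀ ξ, ∀ x ∈ closedBall (0 : E) R, a x - l / 2 * ‖x - ξ‖ ^ 2 ≤ g ξ) {ξ Q : E}
    {B : E →L[ℝ] E} (hB : ∀ v w, ⟪B v, w⟫ = ⟪v, B w⟫)
    (hQ : l • s ξ + ξ = Q) (hsξ : ‖s ξ‖ < R)
    (hexp : ∀ η > 0, ∀ᶠ v in nhds 0,
        |(g (ξ + v) + l / 2 * ‖ξ + v‖ ^ 2 + ‖ξ + v‖ ^ 2 / 2)
          - (g ξ + l / 2 * ‖ξ‖ ^ 2 + ‖ξ‖ ^ 2 / 2) - ⟪Q, v⟫ - ⟪B v, v⟫ / 2| ≤ η * ‖v‖ ^ 2) :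
    IsSuperjet a (s ξ) (l • (s ξ - ξ)) (B - (l + 1) • ContinuousLinearMap.id ℝ E) := by
  refine ⟨fun v w => ?_, fun η hη => ?_⟩
  · simp [inner_sub_left, inner_sub_right, hB, inner_smul_left, inner_smul_right]
  have hnear : ∀ᶠ v in nhds (0 : E), s ξ + v ∈ closedBall (0 : E) R := by
    have h1 : Filter.Tendsto (fun v : E => ‖s ξ + v‖) (nhds 0) (nhds ‖s ξ‖) := by
      have : Continuous fun v : E => ‖s ξ + v‖ := by fun_prop
      simpa using this.tendsto 0
    filter_upwards [h1.eventually (gt_mem_nhds hsξ)] with v hv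
    simpa using le_of_lt hv
  filter_upwards [hexp η hη, hnear] with v hv hvR
  have h1 := hle (ξ + v) _ hvR
  rw [add_sub_add_right_eq_sub] at h1
  have h2 := hg ξ
  have h3 := (abs_le.1 hv).2
  have h4 : ‖ξ + v‖ ^ 2 = ‖ξ‖ ^ 2 + 2 * ⟪ξ, v⟫ + ‖v‖ ^ 2 := norm_add_sq_real _ _
  rw [h4, ← hQ] at h3
  simp only [inner_add_left, inner_smul_left, conj_trivial] at h3
  simp only [sub_apply, smul_apply,
    ContinuousLinearMap.id_apply, inner_sub_left, inner_smul_left, conj_trivial,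
    real_inner_self_eq_norm_sq]
  linarith

lemma norm_lt_of_smul_add_eq {l δ μ R : ℝ} (hl : 1 ≤ l) (hδμ : 2 * δ + 2 * (l * δ) ≤ μ)
    (hδR : δ ≤ R / 2) {s x Q : E} (h : l • s + x = Q) (hQ : ‖Q‖ < δ) (hx : ‖x‖ < δ) :
    ‖s‖ < μ ∧ ‖s‖ < R ∧ ‖l • (s - x)‖ < μ := by
  have hl0 : 0 < l := by linarith
  have hlδ : 0 ≤ l * δ := mul_nonneg hl0.le ((norm_nonneg x).trans hx.le)
  have h1 : ‖l • s‖ < 2 * δ := by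
    have : l • s = Q - x := by rw [← h]; abel
    rw [this]
    linarith [norm_sub_le Q x]
  have h2 : ‖s‖ ≤ ‖l • s‖ := by
    rw [norm_smul, Real.norm_eq_abs, abs_of_pos hl0]
    exact le_mul_of_one_le_left (norm_nonneg s) hl
  have h3 : ‖l • (s - x)‖ < 2 * δ + l * δ := by
    rw [smul_sub]
    refine (norm_sub_le _ _).trans_lt ?_
    rw [norm_smul l x, Real.norm_eq_abs, abs_of_pos hl0]
    have := mul_lt_mul_of_pos_left hx hl0
    linarith
  refine ⟨?_, ?_, ?_⟩ <;> linarith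

/-- Theorem on sums: if `a x + b y` is touched from above at the origin by a quadratic form `q`,
then `a` and `b` have superjets near the origin whose Hessians are controlled by `q`. -/
theorem exists_superjets [FiniteDimensional ℝ E] {a b : E → ℝ} {R : ℝ} (hR : 0 < R)
    (ha : ContinuousOn a (closedBall 0 R)) (hb : ContinuousOn b (closedBall 0 R))
    (ha0 : a 0 = 0) (hb0 : b 0 = 0) (q : (E × E) →L[ℝ] (E × E) →L[ℝ] ℝ)
    (hq : ∀ z w, q z w = q w z)
    (hle : ∀ x ∈ closedBall (0 : E) R, ∀ y ∈ closedBall (0 : E) R,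
      a x + b y ≤ q (x, y) (x, y)) {μ : ℝ} (hμ : 0 < μ) :
    ∃ (x y p p' : E) (X Y : E →L[ℝ] E), ‖x‖ < μ ∧ ‖y‖ < μ ∧ ‖p‖ < μ ∧ ‖p'‖ < μ ∧
      IsSuperjet a x p X ∧ IsSuperjet b y p' Y ∧
      ∀ v w, ⟪X v, v⟫ / 2 + ⟪Y w, w⟫ / 2
        ≤ q (v, w) (v, w) + μ * (‖v‖ ^ 2 + ‖w‖ ^ 2) := by
  obtain ⟨cq, hcq0, hcq⟩ := exists_bilin_bound q
  set l := 2 * (2 * cq ^ 2 / μ + cq) + 1 with hl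
  have hl1 : 1 ≤ l := by
    have : 0 ≤ 2 * (2 * cq ^ 2 / μ + cq) := by positivity
    linarith
  have hl0 : 0 < l := by linarith
  obtain ⟨ga, sa, hsa, hga, hlea⟩ := exists_supConv hR ha l
  obtain ⟨gb, sb, hsb, hgb, hleb⟩ := exists_supConv hR hb l
  have hsuba := supConv_isSubgrad hsa hga hlea
  have hsubb := supConv_isSubgrad hsb hgb hleb
  have hnorm : ∀ {s : E → E}, (∀ ξ, s ξ ∈ closedBall (0 : E) R) → ∀ ξ, ‖l • s ξ‖ ≤ l * R := by
    intro s hs ξ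
    rw [norm_smul, Real.norm_eq_abs, abs_of_pos hl0]
    have := hs ξ
    rw [mem_closedBall_zero_iff] at this
    gcongr
  have hca := IsSubgrad.continuous (by positivity) (hnorm hsa) hsuba
  have hcb := IsSubgrad.continuous (by positivity) (hnorm hsb) hsubb
  obtain ⟨Ja, hJa⟩ := exists_conjArgmax hca fun x => ⟨_, hsuba x⟩
  obtain ⟨Jb, hJb⟩ := exists_conjArgmax hcb fun x => ⟨_, hsubb x⟩
  have hGa := fun x => (hsuba x).add_sq
  have hGb := fun x => (hsubb x).add_sq
  set m : (E × E) →L[ℝ] (E × E) →L[ℝ] ℝ := q + (μ + (l + 1) / 2) • prodInner E with hm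
  have hmapp : ∀ z w, m z w = q z w + (μ + (l + 1) / 2) * (⟪z.1, w.1⟫ + ⟪z.2, w.2⟫) := by
    intro z w; simp [hm]
  have hmsymm : ∀ z w, m z w = m w z := by
    intro z w
    rw [hmapp, hmapp, hq, real_inner_comm, real_inner_comm z.2]
  have ha1 : 0 ≤ ga 0 := by
    have := hlea 0 0 (mem_closedBall_self hR.le)
    simpa [ha0] using this
  have hb1 : 0 ≤ gb 0 := by
    have := hleb 0 0 (mem_closedBall_self hR.le)
    simpa [hb0] using this
  set δ := min (μ / (2 * (l + 1))) (R / 2) with hδ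
  have hδ0 : 0 < δ := by positivity
  have hδ1 : δ * (2 * (l + 1)) ≤ μ := by
    rw [← le_div_iff₀ (by positivity)]; exact min_le_left _ _
  have hδ2 : δ ≤ R / 2 := min_le_right _ _
  obtain ⟨Q₁, Q₂, hQ1, hQ2, hx, hy, hd1, hd2, hcontact⟩ :=
    exists_contact_differentiable (by fun_prop) (by fun_prop) hJa hJb (fun x => ⟨_, hGa x⟩)
      (fun x => ⟨_, hGb x⟩) hmsymm (show 0 < μ / 2 by positivity) (by simp; positivity)
      (fun z => by
        rw [hmapp]
        have h1 := hle _ (hsa z.1) _ (hsb z.2)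
        have h2 := bilin_le_add_sq q hq hcq0 hcq hμ (show _ ≤ l by linarith) (sa z.1, sb z.2) z
        have h3 := sq_norm_le_prodInner z
        simp only [prodInner_apply, real_inner_self_eq_norm_sq, Prod.fst_sub, Prod.snd_sub] at *
        rw [hga, hgb]
        nlinarith) hδ0
  obtain ⟨cm, hcm0, hcm⟩ := exists_bilin_bound m
  have hM : 0 < cm + 1 := by positivity
  have hMa : ∀ v, m (v, 0) (v, 0) ≤ (cm + 1) * ‖v‖ ^ 2 := fun v => by
    have e2 := (abs_le.1 (hcm (v, 0) (v, 0))).2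
    simp only [Prod.norm_mk, norm_zero, max_eq_left (norm_nonneg v)] at e2
    nlinarith [sq_nonneg ‖v‖]
  have hMb : ∀ v, m (0, v) (0, v) ≤ (cm + 1) * ‖v‖ ^ 2 := fun v => by
    have e2 := (abs_le.1 (hcm (0, v) (0, v))).2
    simp only [Prod.norm_mk, norm_zero, max_eq_right (norm_nonneg v)] at e2
    nlinarith [sq_nonneg ‖v‖]
  have hcona : ∀ v, (fun x => ga x + l / 2 * ‖x‖ ^ 2 + ‖x‖ ^ 2 / 2) (Ja Q₁ + v)
      ≤ (fun x => ga x + l / 2 * ‖x‖ ^ 2 + ‖x‖ ^ 2 / 2) (Ja Q₁) + ⟪Q₁, v⟫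
        + (cm + 1) * ‖v‖ ^ 2 := fun v => by
    have e1 := hcontact v 0
    have e2 := hMa v
    simp only [add_zero, inner_zero_right] at e1 ⊢
    linarith
  have hconb : ∀ v, (fun x => gb x + l / 2 * ‖x‖ ^ 2 + ‖x‖ ^ 2 / 2) (Jb Q₂ + v)
      ≤ (fun x => gb x + l / 2 * ‖x‖ ^ 2 + ‖x‖ ^ 2 / 2) (Jb Q₂) + ⟪Q₂, v⟫
        + (cm + 1) * ‖v‖ ^ 2 := fun v => by
    have e1 := hcontact 0 v
    have e2 := hMb v
    simp only [add_zero, inner_zero_right] at e1 ⊢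
    linarith
  obtain ⟨B₁, hB₁, hexp₁⟩ := hJa.exists_taylor (fun x => ⟨_, hGa x⟩) hM
    (fun z => by simpa only [add_sub_cancel] using hcona (z - Ja Q₁)) hd1
  obtain ⟨B₂, hB₂, hexp₂⟩ := hJb.exists_taylor (fun x => ⟨_, hGb x⟩) hM
    (fun z => by simpa only [add_sub_cancel] using hconb (z - Jb Q₂)) hd2
  have hQa : l • sa (Ja Q₁) + Ja Q₁ = Q₁ := (hGa (Ja Q₁)).eq_of_contact hM hcona
  have hQb : l • sb (Jb Q₂) + Jb Q₂ = Q₂ := (hGb (Jb Q₂)).eq_of_contact hM hconb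
  have hδl : 2 * δ + 2 * (l * δ) ≤ μ := by linarith
  obtain ⟨hx1, hx2, hx3⟩ := norm_lt_of_smul_add_eq hl1 hδl hδ2 hQa hQ1 hx
  obtain ⟨hy1, hy2, hy3⟩ := norm_lt_of_smul_add_eq hl1 hδl hδ2 hQb hQ2 hy
  refine ⟨sa (Ja Q₁), sb (Jb Q₂), _, _, _, _, hx1, hy1, hx3, hy3,
    superjet_of_supConv hga hlea hB₁ hQa hx2 hexp₁,
    superjet_of_supConv hgb hleb hB₂ hQb hy2 hexp₂, fun v w => ?_⟩
  have hmain : ⟪B₁ v, v⟫ / 2 + ⟪B₂ w, w⟫ / 2 - m (v, w) (v, w) ≤ 0 := by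
    refine nonpos_of_eventually_le
      (q := fun z : E × E => ⟪B₁ z.1, z.1⟫ / 2 + ⟪B₂ z.2, z.2⟫ / 2 - m z z) (fun t z => ?_)
      (fun η hη => ?_) (v, w)
    · simp only [Prod.smul_fst, Prod.smul_snd, map_smul, inner_smul_left, inner_smul_right,
        conj_trivial, smul_apply, smul_eq_mul]
      ring
    · have t1 : Filter.Tendsto (fun z : E × E => z.1) (nhds 0) (nhds 0) :=
        continuous_fst.tendsto 0
      have t2 : Filter.Tendsto (fun z : E × E => z.2) (nhds 0) (nhds 0) :=
        continuous_snd.tendsto 0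
      filter_upwards [t1.eventually (hexp₁ (η / 2) (by positivity)),
        t2.eventually (hexp₂ (η / 2) (by positivity))] with z h1 h2
      have h3 := hcontact z.1 z.2
      have h4 := (abs_le.1 h1).1
      have h5 := (abs_le.1 h2).1
      have h6 : ‖z.1‖ ^ 2 ≤ ‖z‖ ^ 2 := pow_le_pow_left₀ (norm_nonneg _) (norm_fst_le z) 2
      have h7 : ‖z.2‖ ^ 2 ≤ ‖z‖ ^ 2 := pow_le_pow_left₀ (norm_nonneg _) (norm_snd_le z) 2
      simp only [Prod.mk.eta] at h3
      have h8 : η / 2 * ‖z.1‖ ^ 2 ≤ η / 2 * ‖z‖ ^ 2 := by gcongr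
      have h9 : η / 2 * ‖z.2‖ ^ 2 ≤ η / 2 * ‖z‖ ^ 2 := by gcongr
      linarith
  rw [hmapp] at hmain
  simp only [sub_apply, smul_apply,
    ContinuousLinearMap.id_apply, inner_sub_left, inner_smul_left, conj_trivial,
    real_inner_self_eq_norm_sq] at hmain ⊢
  linarith

end Doubling

section DistanceFunction

variable {E : Type*} [NormedAddCommGroup E] [InnerProductSpace ℝ E]

lemma norm_le_inner_add {e w : E} {s : ℝ} (he : ‖e‖ = 1) (hs : 0 < s) (h : s / 2 ≤ ⟪e, w⟫) :
    ‖w‖ ≤ ⟪e, w⟫ + (‖w‖ ^ 2 - ⟪e, w⟫ ^ 2) / s := by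
  have h1 : ⟪e, w⟫ ≤ ‖w‖ := by simpa [he] using real_inner_le_norm e w
  have h2 : s * (‖w‖ - ⟪e, w⟫) ≤ ‖w‖ ^ 2 - ⟪e, w⟫ ^ 2 := by
    nlinarith [mul_nonneg (sub_nonneg.2 h1) (show 0 ≤ ‖w‖ + ⟪e, w⟫ - s by linarith)]
  have h3 : ‖w‖ - ⟪e, w⟫ ≤ (‖w‖ ^ 2 - ⟪e, w⟫ ^ 2) / s := by
    rw [le_div_iff₀ hs]; linarith
  linarith

/-- Second order upper expansion of `‖w‖ - K * ‖w‖ ^ 2` at `w = s • e`. -/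
lemma norm_sub_sq_le_expansion {e z : E} {s K : ℝ} (he : ‖e‖ = 1) (hs : 0 < s)
    (hz : ‖z‖ ≤ s / 2) :
    ‖s • e + z‖ - K * ‖s • e + z‖ ^ 2 ≤ s - K * s ^ 2 + (1 - 2 * K * s) * ⟪e, z⟫
      + ((1 / s - K) * ‖z‖ ^ 2 - 1 / s * ⟪e, z⟫ ^ 2) := by
  have h1 : ⟪e, s • e + z⟫ = s + ⟪e, z⟫ := by
    rw [inner_add_right, inner_smul_right, real_inner_self_eq_norm_sq, he]; ring
  have h2 : ‖s • e + z‖ ^ 2 = s ^ 2 + 2 * s * ⟪e, z⟫ + ‖z‖ ^ 2 := by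
    rw [norm_add_sq_real, inner_smul_left, norm_smul, he, Real.norm_eq_abs, mul_one, sq_abs,
      conj_trivial]
    ring
  have h3 : |⟪e, z⟫| ≤ ‖z‖ := by simpa [he] using abs_real_inner_le_norm e z
  have h4 := norm_le_inner_add (w := s • e + z) he hs (by rw [h1]; linarith [(abs_le.1 h3).1])
  have h5 : (‖s • e + z‖ ^ 2 - ⟪e, s • e + z⟫ ^ 2) / s
      = 1 / s * ‖z‖ ^ 2 - 1 / s * ⟪e, z⟫ ^ 2 := by
    rw [h1, h2]; field_simp; ring
  rw [h5, h1] at h4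
  rw [h2]
  linarith

/-- The bilinear form `A ⟪d, d'⟫ - B ⟪e, d⟫ ⟪e, d'⟫ + M ⟪x, x'⟫` on `E × E`, where `d = x - y`. -/
def doublingForm (e : E) (A B M : ℝ) : (E × E) →L[ℝ] (E × E) →L[ℝ] ℝ :=
  let D := ContinuousLinearMap.fst ℝ E E - ContinuousLinearMap.snd ℝ E E
  let I : E →L[ℝ] E →L[ℝ] ℝ := innerSL ℝ
  A • I.bilinearComp D D - B • ((I e).smulRight (I e)).bilinearComp D D
    + M • I.bilinearComp (ContinuousLinearMap.fst ℝ E E) (ContinuousLinearMap.fst ℝ E E)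

lemma doublingForm_apply (e : E) (A B M : ℝ) (z w : E × E) :
    doublingForm e A B M z w = A * ⟪z.1 - z.2, w.1 - w.2⟫
      - B * (⟪e, z.1 - z.2⟫ * ⟪e, w.1 - w.2⟫) + M * ⟪z.1, w.1⟫ := by
  simp [doublingForm, -map_sub]
  rfl

variable [FiniteDimensional ℝ E]

/-- Second order information at a maximum of
`u x - u y - L * (‖x - y‖ - K * ‖x - y‖ ^ 2) - M * ‖x - x₀‖ ^ 2`. -/
lemma exists_jets_of_max {u : E → ℝ} {a b x₀ : E} {L K M R : ℝ} (hL : 0 ≤ L) (hK : 0 ≤ K)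
    (hM : 0 ≤ M) (hR : 0 < R) (hab : 4 * R ≤ ‖a - b‖) (hKab : 2 * K * ‖a - b‖ ≤ 1)
    (ha₀ : ‖a - x₀‖ ≤ 1) (hua : ContinuousOn u (closedBall a R))
    (hub : ContinuousOn u (closedBall b R))
    (hmax : ∀ x ∈ closedBall a R, ∀ y ∈ closedBall b R,
      u x - u y - L * (‖x - y‖ - K * ‖x - y‖ ^ 2) - M * ‖x - x₀‖ ^ 2
        ≤ u a - u b - L * (‖a - b‖ - K * ‖a - b‖ ^ 2) - M * ‖a - x₀‖ ^ 2) :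
    ∃ (x y p p' e : E) (X Y : E →L[ℝ] E), x ∈ closedBall a R ∧ y ∈ closedBall b R ∧
      ‖p‖ ≤ L + 2 * M + 1 ∧ ‖p'‖ ≤ L + 2 * M + 1 ∧ ‖e‖ = 1 ∧
      (∀ v w, ⟪X v, w⟫ = ⟪v, X w⟫) ∧ (∀ v w, ⟪Y v, w⟫ = ⟪v, Y w⟫) ∧
      (∀ᶠ v in nhds 0, u (x + v) ≤ u x + ⟪p, v⟫ + ⟪X v, v⟫ / 2) ∧
      (∀ᶠ v in nhds 0, u y + ⟪p', v⟫ - ⟪Y v, v⟫ / 2 ≤ u (y + v)) ∧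
      (∀ v, ⟪X v, v⟫ + ⟪Y v, v⟫ ≤ (2 * M + 1) * ‖v‖ ^ 2) ∧
      ⟪X e, e⟫ + ⟪Y e, e⟫ ≤ 2 * M + 1 - 8 * (L * K) := by
  set s := ‖a - b‖ with hs
  have hs0 : 0 < s := by linarith
  obtain ⟨e, he1, hse⟩ : ∃ e : E, ‖e‖ = 1 ∧ s • e = a - b := by
    refine ⟨(1 / s) • (a - b), ?_, ?_⟩
    · rw [norm_smul, ← hs, Real.norm_eq_abs, abs_of_pos (by positivity)]
      field_simp
    · rw [smul_smul, mul_one_div_cancel hs0.ne', one_smul]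
  set t := L * (1 - 2 * K * s) with ht
  have htL : ‖t • e‖ ≤ L := by
    have h0 : 0 ≤ K * s := by positivity
    rw [norm_smul, he1, mul_one, Real.norm_eq_abs, abs_of_nonneg (mul_nonneg hL (by linarith))]
    nlinarith
  set g := t • e + (2 * M) • (a - x₀) with hg
  have hgL : ‖g‖ ≤ L + 2 * M := by
    refine (norm_add_le _ _).trans (add_le_add htL ?_)
    rw [norm_smul, Real.norm_eq_abs, abs_of_nonneg (by positivity)]
    nlinarith
  have hshift : ∀ {c x : E}, x ∈ closedBall (0 : E) R → c + x ∈ closedBall c R := by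
    intro c x hx
    rw [mem_closedBall_zero_iff] at hx
    simpa [mem_closedBall, dist_eq_norm] using hx
  obtain ⟨x, y, p, p', X, Y, hx, hy, hp, hp', ⟨hX, hXj⟩, ⟨hY, hYj⟩, hXY⟩ := exists_superjets
    (a := fun x => u (a + x) - u a - ⟪g, x⟫) (b := fun y => -(u (b + y) - u b) + ⟪t • e, y⟫) hR
    (((hua.comp (by fun_prop) fun x hx => hshift hx).sub continuousOn_const).sub
      (by fun_prop))
    (((hub.comp (by fun_prop) fun x hx => hshift hx).sub continuousOn_const).neg.add
      (by fun_prop)) (by simp) (by simp)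
    (doublingForm e (L * (1 / s - K)) (L * (1 / s)) M)
    (fun z w => by
      rw [doublingForm_apply, doublingForm_apply, real_inner_comm, real_inner_comm z.1]; ring)
    (fun x hx y hy => by
      have h1 := hmax _ (hshift hx) _ (hshift hy)
      rw [mem_closedBall_zero_iff] at hx hy
      have h2 := norm_sub_sq_le_expansion (K := K) (z := x - y) he1 hs0
        (by linarith [norm_sub_le x y])
      have h3 := mul_le_mul_of_nonneg_left h2 hL
      have h4 : a + x - (b + y) = s • e + (x - y) := by rw [hse]; abel
      have h5 : ‖a + x - x₀‖ ^ 2 = ‖a - x₀‖ ^ 2 + 2 * ⟪a - x₀, x⟫ + ‖x‖ ^ 2 := by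
        rw [← norm_add_sq_real]; congr 2; abel
      rw [h4, h5] at h1
      simp only [doublingForm_apply, real_inner_self_eq_norm_sq, hg, inner_add_left,
        inner_smul_left, conj_trivial, ht]
      have h6 : L * (1 - 2 * K * s) * ⟪e, x - y⟫
          = L * (1 - 2 * K * s) * ⟪e, x⟫ - L * (1 - 2 * K * s) * ⟪e, y⟫ := by
        rw [inner_sub_right]; ring
      linarith)
    (μ := min (1 / 8) R) (by positivity)
  have hμ1 : min (1 / 8) R ≤ 1 / 8 := min_le_left _ _
  have hμ2 : min (1 / 8) R ≤ R := min_le_right _ _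
  set μ := min (1 / 8) R
  have hsum : ∀ v w, ⟪X v, v⟫ / 2 + ⟪Y w, w⟫ / 2 ≤ L * (1 / s - K) * ‖v - w‖ ^ 2
      - L * (1 / s) * ⟪e, v - w⟫ ^ 2 + M * ‖v‖ ^ 2 + 1 / 8 * (‖v‖ ^ 2 + ‖w‖ ^ 2) := by
    intro v w
    have h1 := hXY v w
    rw [doublingForm_apply, real_inner_self_eq_norm_sq, real_inner_self_eq_norm_sq] at h1
    have h2 : μ * (‖v‖ ^ 2 + ‖w‖ ^ 2) ≤ 1 / 8 * (‖v‖ ^ 2 + ‖w‖ ^ 2) := by gcongr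
    simp only at h1
    linarith
  refine ⟨a + x, b + y, p + g, t • e - p', e, X + (1 / 4 : ℝ) • ContinuousLinearMap.id ℝ E,
    Y + (1 / 4 : ℝ) • ContinuousLinearMap.id ℝ E, hshift (by simpa using hx.le.trans hμ2),
    hshift (by simpa using hy.le.trans hμ2), ?_, ?_, he1, ?_, ?_, ?_, ?_, ?_, ?_⟩
  · linarith [norm_add_le p g]
  · linarith [norm_sub_le (t • e) p']
  · intro v w
    simp [inner_add_left, inner_add_right, hX, inner_smul_left, inner_smul_right]
  · intro v w
    simp [inner_add_left, inner_add_right, hY, inner_smul_left, inner_smul_right]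
  · filter_upwards [hXj (1 / 8) (by norm_num)] with v hv
    simp only [inner_add_right, inner_add_left, inner_smul_left, conj_trivial, add_apply,
      smul_apply, ContinuousLinearMap.id_apply, real_inner_self_eq_norm_sq, add_assoc] at hv ⊢
    linarith
  · filter_upwards [hYj (1 / 8) (by norm_num)] with v hv
    simp only [inner_add_right, inner_add_left, inner_sub_left, inner_smul_left, conj_trivial,
      add_apply, smul_apply, ContinuousLinearMap.id_apply, real_inner_self_eq_norm_sq,
      add_assoc] at hv ⊢
    linarith
  · intro v
    have h1 := hsum v v
    simp only [sub_self, norm_zero, inner_zero_right, inner_add_left, inner_smul_left,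
      conj_trivial, add_apply, smul_apply, ContinuousLinearMap.id_apply,
      real_inner_self_eq_norm_sq] at h1 ⊢
    linarith
  · have h1 := hsum e (-e)
    have h2 : e - -e = (2 : ℝ) • e := by rw [two_smul]; abel
    rw [h2, inner_smul_right, norm_smul, real_inner_self_eq_norm_sq, norm_neg, he1, map_neg,
      inner_neg_neg] at h1
    norm_num at h1
    simp only [inner_add_left, inner_smul_left, conj_trivial, add_apply, smul_apply,
      ContinuousLinearMap.id_apply, real_inner_self_eq_norm_sq, he1]
    linarith

end DistanceFunction

section Application

variable {N : ℕ}

/-- The quadratic polynomial with gradient `p` and Hessian `B` at `x`. -/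
def quadPoly (x p : Euc N) (B : Euc N →L[ℝ] Euc N) (z : Euc N) : ℝ :=
  ⟪p, z - x⟫ + ⟪B (z - x), z - x⟫ / 2

/-- The matrix of an operator of `ℝ^N` in the standard basis. -/
def matOf (B : Euc N →L[ℝ] Euc N) : Matrix (Fin N) (Fin N) ℝ :=
  LinearMap.toMatrix (EuclideanSpace.basisFun (Fin N) ℝ).toBasis
    (EuclideanSpace.basisFun (Fin N) ℝ).toBasis B.toLinearMap

lemma contDiff_quadPoly (x p : Euc N) (B : Euc N →L[ℝ] Euc N) :
    ContDiff ℝ 2 (quadPoly x p B) := by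
  have h1 : ContDiff ℝ 2 fun z : Euc N => z - x := contDiff_id.sub contDiff_const
  exact (contDiff_const.inner ℝ h1).add (((B.contDiff.comp h1).inner ℝ h1).div_const 2)

lemma fderiv_quadPoly (x p : Euc N) {B : Euc N →L[ℝ] Euc N}
    (hB : ∀ v w, ⟪B v, w⟫ = ⟪v, B w⟫) (z : Euc N) :
    HasFDerivAt (quadPoly x p B) (innerSL ℝ (p + B (z - x))) z := by
  have h1 : HasFDerivAt (fun z => z - x) (ContinuousLinearMap.id ℝ (Euc N)) z :=
    (hasFDerivAt_id z).sub_const x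
  have h2 := (hasFDerivAt_const p z).inner ℝ h1
  have h3 := (B.hasFDerivAt.comp z h1).inner ℝ h1
  refine (h2.add (h3.mul_const (1 / 2))).congr_fderiv (ContinuousLinearMap.ext fun w => ?_)
    |>.congr_of_eventuallyEq (Filter.Eventually.of_forall fun w => ?_)
  · have h4 := hB w (z - x)
    have h5 := real_inner_comm w (B (z - x))
    simp [-map_sub]
    linarith
  · simp [quadPoly, -map_sub]; ring

lemma gradient_quadPoly (x p : Euc N) {B : Euc N →L[ℝ] Euc N}
    (hB : ∀ v w, ⟪B v, w⟫ = ⟪v, B w⟫) : gradient (quadPoly x p B) x = p := by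
  refine HasGradientAt.gradient ?_
  rw [hasGradientAt_iff_hasFDerivAt]
  convert! fderiv_quadPoly x p hB x using 1
  ext w; simp

lemma hess_quadPoly (x p : Euc N) {B : Euc N →L[ℝ] Euc N}
    (hB : ∀ v w, ⟪B v, w⟫ = ⟪v, B w⟫) : hess (quadPoly x p B) x = matOf B := by
  have h1 : fderiv ℝ (quadPoly x p B) = fun z => innerSL ℝ (p + B (z - x)) :=
    funext fun z => (fderiv_quadPoly x p hB z).fderiv
  have h2 : HasFDerivAt (fun z => innerSL ℝ (p + B (z - x)))
      ((innerSL ℝ (E := Euc N)).comp B) x := by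
    have h3 : HasFDerivAt (fun z => p + B (z - x)) B x :=
      (B.hasFDerivAt.comp x ((hasFDerivAt_id x).sub_const x)).const_add p
    exact ((innerSL ℝ (E := Euc N)).hasFDerivAt).comp x h3
  ext i j
  rw [hess, Matrix.of_apply, iteratedFDeriv_two_apply, h1, h2.fderiv, matOf,
    LinearMap.toMatrix_apply]
  simp [hB, EuclideanSpace.inner_single_left]

lemma matOf_add (A B : Euc N →L[ℝ] Euc N) : matOf (A + B) = matOf A + matOf B := by
  simp [matOf]

lemma matOf_smul (c : ℝ) (A : Euc N →L[ℝ] Euc N) : matOf (c • A) = c • matOf A := by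
  simp [matOf]

lemma matOf_isSymm {B : Euc N →L[ℝ] Euc N} (hB : ∀ v w, ⟪B v, w⟫ = ⟪v, B w⟫) :
    (matOf B).IsSymm := by
  ext i j
  have := hB (EuclideanSpace.single i 1) (EuclideanSpace.single j 1)
  simpa [matOf, LinearMap.toMatrix_apply, EuclideanSpace.inner_single_left,
    EuclideanSpace.inner_single_right] using this

lemma matOf_posSemidef {B : Euc N →L[ℝ] Euc N} (hB : ∀ v w, ⟪B v, w⟫ = ⟪v, B w⟫)
    (hpos : ∀ v, 0 ≤ ⟪B v, v⟫) : (matOf B).PosSemidef :=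
  LinearMap.posSemidef_toMatrix_iff _ |>.2 ⟨hB, hpos⟩

lemma trace_matOf_id : Matrix.trace (matOf (ContinuousLinearMap.id ℝ (Euc N))) = N := by
  rw [matOf, ContinuousLinearMap.coe_id, LinearMap.toMatrix_id, Matrix.trace_one, Fintype.card_fin]

lemma inner_le_trace_matOf {B : Euc N →L[ℝ] Euc N} (hpos : ∀ v, 0 ≤ ⟪B v, v⟫) {e : Euc N}
    (he : ‖e‖ = 1) : ⟪B e, e⟫ ≤ Matrix.trace (matOf B) := by
  have ho : Orthonormal ℝ ((↑) : ({e} : Set (Euc N)) → Euc N) := by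
    constructor
    · rintro ⟨x, rfl⟩; exact he
    · rintro ⟨x, rfl⟩ ⟨y, rfl⟩ h; exact (h rfl).elim
  obtain ⟨s, b, hs, hb⟩ := ho.exists_orthonormalBasis_extension
  have hes : e ∈ s := by simpa using hs
  rw [matOf, ← LinearMap.trace_eq_matrix_trace, LinearMap.trace_eq_sum_inner _ b]
  have h1 := Finset.single_le_sum (f := fun i => ⟪b i, B (b i)⟫)
    (fun i _ => by rw [real_inner_comm]; exact hpos _) (Finset.mem_univ (⟨e, hes⟩ : s))
  simp only [hb] at h1 ⊢
  rw [real_inner_comm]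
  exact h1

lemma ViscSub.le_of_eventually {Ω : Set (Euc N)}
    {G : Euc N → Euc N → Matrix (Fin N) (Fin N) ℝ → ℝ} {f u : Euc N → ℝ} (hu : ViscSub Ω G f u)
    {x p : Euc N} (hx : x ∈ Ω) {B : Euc N →L[ℝ] Euc N} (hB : ∀ v w, ⟪B v, w⟫ = ⟪v, B w⟫)
    (h : ∀ᶠ v in nhds 0, u (x + v) ≤ u x + ⟪p, v⟫ + ⟪B v, v⟫ / 2) :
    f x ≤ G x p (matOf B) := by
  have h1 := hu x hx (quadPoly x p B) (contDiff_quadPoly x p B) ?_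
  · rwa [gradient_quadPoly x p hB, hess_quadPoly x p hB] at h1
  have h2 : Filter.Tendsto (fun z : Euc N => z - x) (nhds x) (nhds 0) := by
    have : Continuous fun z : Euc N => z - x := by fun_prop
    simpa using this.tendsto x
  filter_upwards [nhdsWithin_le_nhds (h2.eventually h)] with z hz
  rw [add_sub_cancel] at hz
  simp only [quadPoly, sub_self, map_zero, inner_zero_right]
  linarith

lemma ViscSuper.le_of_eventually {Ω : Set (Euc N)}
    {G : Euc N → Euc N → Matrix (Fin N) (Fin N) ℝ → ℝ} {f u : Euc N → ℝ} (hu : ViscSuper Ω G f u)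
    {x p : Euc N} (hx : x ∈ Ω) {B : Euc N →L[ℝ] Euc N} (hB : ∀ v w, ⟪B v, w⟫ = ⟪v, B w⟫)
    (h : ∀ᶠ v in nhds 0, u x + ⟪p, v⟫ + ⟪B v, v⟫ / 2 ≤ u (x + v)) :
    G x p (matOf B) ≤ f x := by
  have h1 := hu x hx (quadPoly x p B) (contDiff_quadPoly x p B) ?_
  · rwa [gradient_quadPoly x p hB, hess_quadPoly x p hB] at h1
  have h2 : Filter.Tendsto (fun z : Euc N => z - x) (nhds x) (nhds 0) := by
    have : Continuous fun z : Euc N => z - x := by fun_prop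
    simpa using this.tendsto x
  filter_upwards [nhdsWithin_le_nhds (h2.eventually h)] with z hz
  rw [add_sub_cancel] at hz
  simp only [quadPoly, sub_self, map_zero, inner_zero_right]
  linarith

lemma UnifElliptic.add_le_of_inner_le {lam Lam : ℝ} {F : Matrix (Fin N) (Fin N) ℝ → ℝ}
    (hF : UnifElliptic lam Lam F) (hlam : 0 ≤ lam) {X Y : Euc N →L[ℝ] Euc N}
    (hX : ∀ v w, ⟪X v, w⟫ = ⟪v, X w⟫) (hY : ∀ v w, ⟪Y v, w⟫ = ⟪v, Y w⟫) {c : ℝ} (hc : 0 ≤ c)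
    (hXY : ∀ v, ⟪X v, v⟫ + ⟪Y v, v⟫ ≤ c * ‖v‖ ^ 2) {e : Euc N} (he : ‖e‖ = 1) :
    F (matOf X) + lam * (c - (⟪X e, e⟫ + ⟪Y e, e⟫)) ≤ F (matOf (-Y)) + Lam * (N * c) := by
  set I := c • ContinuousLinearMap.id ℝ (Euc N) with hI
  have hIs : ∀ v w, ⟪I v, w⟫ = ⟪v, I w⟫ := fun v w => by
    simp [hI, inner_smul_left, inner_smul_right]
  have hIv : ∀ v, ⟪I v, v⟫ = c * ‖v‖ ^ 2 := fun v => by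
    simp [hI, inner_smul_left]
  set P := I - X - Y with hP
  have hPs : ∀ v w, ⟪P v, w⟫ = ⟪v, P w⟫ := fun v w => by
    simp [hP, inner_sub_left, inner_sub_right, hIs, hX, hY]
  have hPv : ∀ v, ⟪P v, v⟫ = c * ‖v‖ ^ 2 - (⟪X v, v⟫ + ⟪Y v, v⟫) := fun v => by
    simp only [hP, sub_apply, inner_sub_left, hIv]; ring
  have hP0 : ∀ v, 0 ≤ ⟪P v, v⟫ := fun v => by rw [hPv]; linarith [hXY v]
  have h1 := (hF (matOf X) (matOf P) (matOf_isSymm hX) (matOf_posSemidef hPs hP0)).1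
  have h2 := (hF (matOf (-Y)) (matOf I) (matOf_isSymm fun v w => by simp [hY])
    (matOf_posSemidef hIs fun v => by rw [hIv]; positivity)).2
  have h3 : matOf X + matOf P = matOf (-Y) + matOf I := by
    rw [← matOf_add, ← matOf_add]; congr 1; rw [hP]; abel
  have h4 : Matrix.trace (matOf I) = N * c := by
    rw [hI, matOf_smul, Matrix.trace_smul, trace_matOf_id, smul_eq_mul, mul_comm]
  have h5 := mul_le_mul_of_nonneg_left (inner_le_trace_matOf hP0 he) hlam
  rw [hPv, he] at h5
  rw [h3] at h1
  rw [h4] at h2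
  norm_num at h5
  linarith

/-- The Ishii-Lions doubling argument: a bounded function whose second order jets satisfy the
extremal inequalities with first order terms of linear growth is Lipschitz at small scales. -/
lemma sub_le_mul_norm_of_jets {lam Lam : ℝ} {F : Matrix (Fin N) (Fin N) ℝ → ℝ}
    (hF : UnifElliptic lam Lam F) (hlam : 0 < lam) {u : Euc N → ℝ} {A₀ A₁ Cu d K L M : ℝ}
    (hu : ContinuousOn u (ball 0 1)) (hCu : ∀ x ∈ ball (0 : Euc N) 1, |u x| ≤ Cu)
    (hsub : ∀ x ∈ ball (0 : Euc N) 1, ∀ (p : Euc N) (B : Euc N →L[ℝ] Euc N),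
      (∀ v w, ⟪B v, w⟫ = ⟪v, B w⟫) →
      (∀ᶠ v in nhds 0, u (x + v) ≤ u x + ⟪p, v⟫ + ⟪B v, v⟫ / 2) →
      -(A₀ + A₁ * ‖p‖) ≤ F (matOf B))
    (hsuper : ∀ x ∈ ball (0 : Euc N) 1, ∀ (p : Euc N) (B : Euc N →L[ℝ] Euc N),
      (∀ v w, ⟪B v, w⟫ = ⟪v, B w⟫) →
      (∀ᶠ v in nhds 0, u x + ⟪p, v⟫ + ⟪B v, v⟫ / 2 ≤ u (x + v)) →
      F (matOf B) ≤ A₀ + A₁ * ‖p‖)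
    {x₀ : Euc N} (hx₀ : closedBall x₀ (2 * d) ⊆ ball 0 1) (hd0 : 0 < d) (hd1 : d ≤ 1)
    (hA₁ : 0 ≤ A₁) (hK : 0 < K) (hKd : 1 / (4 * K) ≤ d) (hKA : 2 * A₁ + 1 ≤ 8 * lam * K)
    (hM0 : 0 ≤ M) (hM : 2 * Cu < M * d ^ 2) (hL0 : 0 ≤ L)
    (hLCu : 2 * Cu < L * (3 / 4 * (1 / (4 * K))))
    (hL : Lam * (N * (2 * M + 1)) + 2 * A₀ + 2 * A₁ * (2 * M + 1) < L)
    {y : Euc N} (hy : ‖x₀ - y‖ ≤ 1 / (4 * K)) : u x₀ - u y ≤ L * ‖x₀ - y‖ := by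
  set s₀ := 1 / (4 * K) with hs₀
  have hs₀K : K * s₀ = 1 / 4 := by rw [hs₀]; field_simp
  have hs₀0 : 0 < s₀ := by positivity
  set Φ : Euc N × Euc N → ℝ := fun z =>
    u z.1 - u z.2 - L * (‖z.1 - z.2‖ - K * ‖z.1 - z.2‖ ^ 2) - M * ‖z.1 - x₀‖ ^ 2 with hΦ
  set D : Set (Euc N × Euc N) :=
    (closedBall x₀ (2 * d) ×ˢ closedBall x₀ (2 * d)) ∩ {z | ‖z.1 - z.2‖ ≤ s₀} with hD
  have hmemD : ∀ x y : Euc N, ‖x - x₀‖ ≤ 2 * d → ‖y - x₀‖ ≤ 2 * d → ‖x - y‖ ≤ s₀ →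
      (x, y) ∈ D := fun x y h1 h2 h3 =>
    ⟨⟨by simpa [dist_eq_norm] using h1, by simpa [dist_eq_norm] using h2⟩, h3⟩
  have hDc : IsCompact D :=
    ((isCompact_closedBall _ _).prod (isCompact_closedBall _ _)).inter_right
      (isClosed_le (by fun_prop) continuous_const)
  have hΦc : ContinuousOn Φ D := by
    have h1 : ContinuousOn (fun z : Euc N × Euc N => u z.1) D :=
      hu.comp continuousOn_fst fun z hz => hx₀ hz.1.1
    have h2 : ContinuousOn (fun z : Euc N × Euc N => u z.2) D :=
      hu.comp continuousOn_snd fun z hz => hx₀ hz.1.2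
    exact ((h1.sub h2).sub (by fun_prop)).sub (by fun_prop)
  have hyD : (x₀, y) ∈ D :=
    hmemD _ _ (by simpa using hd0.le) (by rw [norm_sub_rev]; linarith) hy
  obtain ⟨⟨a, b⟩, habD, hmax⟩ := hDc.exists_isMaxOn ⟨_, hyD⟩ hΦc
  have hab_a : ‖a - x₀‖ ≤ 2 * d := by simpa [dist_eq_norm] using habD.1.1
  have hs_le : ‖a - b‖ ≤ s₀ := habD.2
  by_cases hpos : Φ (a, b) ≤ 0
  · have h1 : Φ (x₀, y) ≤ 0 := (hmax hyD).trans hpos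
    simp only [hΦ, sub_self, norm_zero] at h1
    have h2 : 0 ≤ L * (K * ‖x₀ - y‖ ^ 2) := by positivity
    linarith
  exfalso
  push Not at hpos
  simp only [hΦ] at hpos
  have hua := (abs_le.1 (hCu a (hx₀ habD.1.1))).2
  have hub := (abs_le.1 (hCu b (hx₀ habD.1.2))).1
  set s := ‖a - b‖ with hs
  have hψ : 0 ≤ L * (s - K * s ^ 2) := by
    have h1 : K * s ≤ 1 / 4 := by rw [← hs₀K]; gcongr
    have h2 : 0 ≤ s := norm_nonneg _
    refine mul_nonneg hL0 ?_
    nlinarith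
  have hs0 : 0 < s := by
    refine lt_of_le_of_ne (norm_nonneg _) fun h => ?_
    have hab : a = b := sub_eq_zero.1 (norm_eq_zero.1 h.symm)
    rw [← h, hab] at hpos
    have : 0 ≤ M * ‖b - x₀‖ ^ 2 := by positivity
    linarith
  have hMa : 0 ≤ M * ‖a - x₀‖ ^ 2 := by positivity
  have hs1 : s < s₀ := by
    refine lt_of_le_of_ne hs_le fun h => ?_
    have h1 : s - K * s ^ 2 = 3 / 4 * s₀ := by
      rw [h, sq, ← mul_assoc, hs₀K]; ring
    rw [h1] at hpos
    linarith
  have ha : ‖a - x₀‖ < d := by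
    by_contra! h
    have : M * d ^ 2 ≤ M * ‖a - x₀‖ ^ 2 := by gcongr
    linarith
  have hb : ‖b - x₀‖ < 2 * d := by
    have h1 : b - x₀ = (a - x₀) - (a - b) := by abel
    rw [h1]
    linarith [norm_sub_le (a - x₀) (a - b)]
  obtain ⟨R, hR0, hR1, hR2, hR3, hR4⟩ : ∃ R > 0, R ≤ d - ‖a - x₀‖ ∧ R ≤ 2 * d - ‖b - x₀‖ ∧
      R ≤ (s₀ - s) / 2 ∧ R ≤ s / 4 := by
    refine ⟨min (min (d - ‖a - x₀‖) (2 * d - ‖b - x₀‖)) (min ((s₀ - s) / 2) (s / 4)), ?_, ?_⟩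
    · simp only [gt_iff_lt, lt_min_iff]
      refine ⟨⟨?_, ?_⟩, ?_, ?_⟩ <;> linarith
    · simp
  have hballa : ∀ x ∈ closedBall a R, ‖x - x₀‖ ≤ 2 * d := fun x hx => by
    rw [mem_closedBall, dist_eq_norm] at hx
    linarith [norm_sub_le_norm_sub_add_norm_sub x a x₀]
  have hballb : ∀ x ∈ closedBall b R, ‖x - x₀‖ ≤ 2 * d := fun x hx => by
    rw [mem_closedBall, dist_eq_norm] at hx
    linarith [norm_sub_le_norm_sub_add_norm_sub x b x₀]
  have hsuba : closedBall a R ⊆ ball 0 1 := fun x hx =>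
    hx₀ (by simpa [dist_eq_norm] using hballa x hx)
  have hsubb : closedBall b R ⊆ ball 0 1 := fun x hx =>
    hx₀ (by simpa [dist_eq_norm] using hballb x hx)
  obtain ⟨x, y, p, p', e, X, Y, hx, hy, hp, hp', he, hX, hY, hXj, hYj, hXY, hXYe⟩ :=
    exists_jets_of_max (u := u) (a := a) (b := b) (x₀ := x₀) hL0 hK.le hM0 hR0
      (by linarith) (by nlinarith) (by linarith) (hu.mono hsuba) (hu.mono hsubb)
      (fun x hx y hy => by
        refine hmax (hmemD x y (hballa x hx) (hballb y hy) ?_)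
        rw [mem_closedBall, dist_eq_norm] at hx hy
        have h1 : x - y = (x - a) + (a - b) - (y - b) := by abel
        rw [h1]
        linarith [norm_sub_le ((x - a) + (a - b)) (y - b), norm_add_le (x - a) (a - b)])
  have h1 := hsub x (hsuba hx) p X hX hXj
  have h2 := hsuper y (hsubb hy) p' (-Y) (fun v w => by simp [hY]) (by
    filter_upwards [hYj] with v hv
    simp only [neg_apply, inner_neg_left]
    linarith)
  have h3 := hF.add_le_of_inner_le hlam.le hX hY (by positivity) hXY he
  have h4 : lam * (8 * (L * K)) ≤ lam * (2 * M + 1 - (⟪X e, e⟫ + ⟪Y e, e⟫)) := by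
    gcongr; linarith
  have h5 := mul_le_mul_of_nonneg_left hp hA₁
  have h6 := mul_le_mul_of_nonneg_left hp' hA₁
  have h7 := mul_le_mul_of_nonneg_left hKA hL0
  linarith

lemma rpow_le_one_add {t β : ℝ} (ht : 0 ≤ t) (hβ : β ∈ Ioc (0 : ℝ) 1) : t ^ β ≤ 1 + t := by
  rcases le_total t 1 with h | h
  · linarith [Real.rpow_le_one ht h hβ.1.le]
  · have := Real.rpow_le_rpow_of_exponent_le h hβ.2
    rw [Real.rpow_one] at this
    linarith

end Application

/-- interior Lipschitz regularity for
`F(D²u) + h·∇u + H(x,∇u) = f` when the sublinear coefficient of `H` is small. -/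
theorem lipschitz_regularity
    (N : ℕ) (lam Lam : ℝ) (Kh : NNReal) (hlam : 0 < lam) (hlL : lam ≤ Lam) :
    ∃ C₀ > (0 : ℝ), ∀ r Cu Cf CH Ch : ℝ, r ∈ Ioo (0 : ℝ) 1 →
      ∃ K : NNReal,
        ∀ (F : Matrix (Fin N) (Fin N) ℝ → ℝ) (h : Euc N → Euc N)
          (H : Euc N → Euc N → ℝ) (f u : Euc N → ℝ) (C β₁ β₂ : ℝ),
          UnifElliptic lam Lam F →
          LipschitzWith Kh h →
          (∀ x ∈ ball (0 : Euc N) 1, ‖h x‖ ≤ Ch) →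
          β₁ ∈ Ioc (0 : ℝ) 1 → β₂ ∈ Ioc (0 : ℝ) 1 →
          0 < C → C < C₀ →
          (∀ x ∈ ball (0 : Euc N) 1, |H x 0| ≤ CH) →
          (∀ x q : Euc N, |H x q - H x 0| ≤ C * (‖q‖ ^ β₁ + ‖q‖ ^ β₂)) →
          ContinuousOn f (ball 0 1) →
          (∀ x ∈ ball (0 : Euc N) 1, |f x| ≤ Cf) →
          ContinuousOn u (ball 0 1) →
          (∀ x ∈ ball (0 : Euc N) 1, |u x| ≤ Cu) →
          ViscSol (ball 0 1) (fun x p M => F M + ⟪h x, p⟫ + H x p) f u →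
          LipschitzOnWith K u (ball 0 r) := by
  refine ⟨1, one_pos, fun r Cu Cf CH Ch hr => ?_⟩
  obtain ⟨hr0, hr1⟩ := hr
  have hLam : 0 < Lam := hlam.trans_le hlL
  set d := (1 - r) / 4 with hd
  have hd0 : 0 < d := by linarith
  set A₀ := |Cf| + |CH| + 2 with hA₀
  set A₁ := |Ch| + 2 with hA₁
  have hA₀0 : 0 ≤ A₀ := by positivity
  have hA₁0 : 0 ≤ A₁ := by positivity
  set K := max (1 / (4 * d)) ((2 * A₁ + 1) / (8 * lam)) with hK
  have hK0 : 0 < K := lt_max_of_lt_left (by positivity)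
  have hKd : 1 / (4 * K) ≤ d := by
    have h1 : 1 / (4 * d) ≤ K := le_max_left _ _
    rw [div_le_iff₀ (by positivity)] at h1 ⊢
    linarith
  have hKA : 2 * A₁ + 1 ≤ 8 * lam * K := by
    have h1 : (2 * A₁ + 1) / (8 * lam) ≤ K := le_max_right _ _
    rw [div_le_iff₀ (by positivity)] at h1
    linarith
  set M := (2 * |Cu| + 1) / d ^ 2 with hM
  have hM0 : 0 ≤ M := by positivity
  have hCuM : 2 * |Cu| < M * d ^ 2 := by
    rw [hM, div_mul_cancel₀ _ (by positivity)]; linarith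
  set L := Lam * (N * (2 * M + 1)) + 2 * A₀ + 2 * A₁ * (2 * M + 1) + 1 + 16 * K * (|Cu| + 1)
    with hL
  have hL0 : 0 ≤ L := by positivity
  have hLK : 4 * (|Cu| + 1) ≤ L * (1 / (4 * K)) := by
    have h1 : 16 * K * (|Cu| + 1) ≤ L := by
      have : 0 ≤ Lam * (N * (2 * M + 1)) + 2 * A₀ + 2 * A₁ * (2 * M + 1) + 1 := by positivity
      linarith
    rw [mul_one_div, le_div_iff₀ (by positivity)]
    linarith
  have hLA : Lam * (N * (2 * M + 1)) + 2 * A₀ + 2 * A₁ * (2 * M + 1) < L := by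
    have : 0 ≤ 16 * K * (|Cu| + 1) := by positivity
    linarith
  refine ⟨L.toNNReal, fun F h H f u C β₁ β₂ hF _ hhb hβ₁ hβ₂ hC0 hC1 hH0 hHq _ hfb hu hub
    hsol => ?_⟩
  have hCu : ∀ x ∈ ball (0 : Euc N) 1, |u x| ≤ |Cu| := fun x hx =>
    (hub x hx).trans (le_abs_self _)
  have hlow : ∀ x ∈ ball (0 : Euc N) 1, ∀ p : Euc N,
      |⟪h x, p⟫ + H x p - f x| ≤ A₀ + A₁ * ‖p‖ := by
    intro x hx p
    have h1 : |⟪h x, p⟫| ≤ |Ch| * ‖p‖ := (abs_real_inner_le_norm _ _).trans <| by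
      gcongr
      exact (hhb x hx).trans (le_abs_self _)
    have h2 : C * (‖p‖ ^ β₁ + ‖p‖ ^ β₂) ≤ 2 + 2 * ‖p‖ := by
      have h3 := rpow_le_one_add (norm_nonneg p) hβ₁
      have h4 := rpow_le_one_add (norm_nonneg p) hβ₂
      have h5 : 0 ≤ ‖p‖ ^ β₁ + ‖p‖ ^ β₂ := by positivity
      have h6 := mul_le_of_le_one_left h5 hC1.le
      linarith
    have h7 := abs_le.1 (hHq x p)
    have h8 := abs_le.1 ((hH0 x hx).trans (le_abs_self CH))
    have h9 := abs_le.1 ((hfb x hx).trans (le_abs_self Cf))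
    have h10 := abs_le.1 h1
    rw [abs_le, hA₀, hA₁]
    constructor <;> linarith
  have hlocal : ∀ x ∈ ball (0 : Euc N) r, ∀ y ∈ ball (0 : Euc N) r,
      u x - u y ≤ L * ‖x - y‖ := by
    intro x hx y hy
    have hsubset : closedBall x (2 * d) ⊆ ball (0 : Euc N) 1 := by
      intro z hz
      rw [mem_ball_zero_iff] at hx ⊢
      rw [mem_closedBall, dist_eq_norm] at hz
      linarith [norm_le_norm_add_norm_sub' z x]
    by_cases hxy : ‖x - y‖ ≤ 1 / (4 * K)
    · refine sub_le_mul_norm_of_jets hF hlam hu hCu (fun z hz p B hB hev => ?_)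
        (fun z hz p B hB hev => ?_) hsubset hd0 (by linarith) hA₁0 hK0 hKd hKA hM0 hCuM hL0
        (by linarith [abs_nonneg Cu]) hLA hxy
      · have h1 := hsol.1.le_of_eventually hz hB hev
        have h2 := (abs_le.1 (hlow z hz p)).2
        linarith
      · have h1 := hsol.2.le_of_eventually hz hB hev
        have h2 := (abs_le.1 (hlow z hz p)).1
        linarith
    · push Not at hxy
      have h1 := (abs_le.1 (hCu x (ball_subset_ball hr1.le hx))).2
      have h2 := (abs_le.1 (hCu y (ball_subset_ball hr1.le hy))).1
      have h3 : L * (1 / (4 * K)) ≤ L * ‖x - y‖ := by gcongr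
      linarith [abs_nonneg Cu]
  refine LipschitzOnWith.of_dist_le_mul fun x hx y hy => ?_
  rw [Real.coe_toNNReal L hL0, Real.dist_eq, dist_eq_norm, abs_sub_le_iff]
  exact ⟨hlocal x hx y hy, by rw [norm_sub_rev]; exact hlocal y hy x hx⟩
end
end
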